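/- arXiv:math/0403079 — 2 statements merged into one kernel-verified Lean document; each statement's English description precedes it below -/
import Mathlib

section
/- Let f be a function holomorphic in a neighborhood of 0 in ℂ² and let X₀ = x²∂x + (y + x·f(x,y))∂y (a saddle-node germ in Dulac prenormal form with formal invariant k = 1). Then X₀ is analytically equivalent as a singular foliation to a vector field of the form X_g = x²∂x + (y + x·g(y))∂y, where g is a function of one variable holomorphic near 0 ∈ ℂ with g(0) ≠ 0. That is, there exist a germ of biholomorphism Φ : (ℂ²,0) → (ℂ²,0) and a holomorphic function u near 0 with u(0) ≠ 0 such that DΦ(p)·X₀(p) = u(p)·X_g(Φ(p)) for all p near 0. -/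
open Filter

/-- Two germs at `0` of holomorphic vector fields on `ℂ × ℂ` (a vector field
`a ∂x + b ∂y` being identified with the map `p ↦ (a p, b p)`) are *analytically
equivalent as singular foliations* if a germ of biholomorphism `Φ` fixing `0`
carries the first to a nonvanishing holomorphic multiple of the second. -/
def FoliationEquiv (X X' : ℂ × ℂ → ℂ × ℂ) : Prop :=
  ∃ (Φ : ℂ × ℂ → ℂ × ℂ) (u : ℂ × ℂ → ℂ),
    AnalyticAt ℂ Φ 0 ∧ Φ 0 = 0 ∧
    LinearMap.det ((fderiv ℂ Φ 0).toLinearMap) ≠ 0 ∧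
    AnalyticAt ℂ u 0 ∧ u 0 ≠ 0 ∧
    ∀ᶠ p in nhds (0 : ℂ × ℂ), fderiv ℂ Φ p (X p) = u p • X' (Φ p)

namespace SaddleNode

/-- The weight of the monomial `x ^ n 0 * s ^ n 1`. -/
noncomputable def weight (n : Fin 2 →₀ ℕ) : ℝ := ((n 0 + n 1).choose (n 1) : ℝ)⁻¹

lemma weight_pos (n : Fin 2 →₀ ℕ) : 0 < weight n :=
  inv_pos.2 (by exact_mod_cast Nat.choose_pos (Nat.le_add_left _ _))

lemma weight_zero : weight 0 = 1 := by simp [weight]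

lemma weight_add_le (m n : Fin 2 →₀ ℕ) : weight (m + n) ≤ weight m * weight n := by
  have h : (m 0 + m 1).choose (m 1) * (n 0 + n 1).choose (n 1) ≤
      ((m + n) 0 + (m + n) 1).choose ((m + n) 1) := by
    have e : (m + n) 0 + (m + n) 1 = (m 0 + m 1) + (n 0 + n 1) := by
      simp only [Finsupp.add_apply]; ring
    rw [e, Nat.add_choose_eq (m 0 + m 1)]
    exact Finset.single_le_sum
      (f := fun ij : ℕ × ℕ => (m 0 + m 1).choose ij.1 * (n 0 + n 1).choose ij.2)
      (fun _ _ => Nat.zero_le _)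
      (Finset.HasAntidiagonal.mem_antidiagonal.2 (rfl : (m 1, n 1).1 + (m 1, n 1).2 = (m + n) 1))
  have hm := weight_pos m
  have hn := weight_pos n
  unfold weight at *
  rw [← mul_inv]
  refine inv_anti₀ ?_ (by exact_mod_cast h)
  rw [inv_pos] at hm hn
  positivity

lemma inv_two_pow_le_weight (n : Fin 2 →₀ ℕ) : (1 / 2 : ℝ) ^ (n 0) * (1 / 2) ^ (n 1) ≤ weight n := by
  rw [← pow_add, one_div, inv_pow]
  have hn := weight_pos n
  unfold weight at *
  refine inv_anti₀ (inv_pos.1 hn) ?_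
  exact_mod_cast Nat.choose_le_two_pow _ _

/-- The absolute value of the `n`-th coefficient multiplied by the weight. -/
noncomputable def wabs (f : MvPowerSeries (Fin 2) ℂ) (n : Fin 2 →₀ ℕ) : ℝ :=
  ‖MvPowerSeries.coeff n f‖ * weight n

lemma wabs_nonneg (f : MvPowerSeries (Fin 2) ℂ) (n : Fin 2 →₀ ℕ) : 0 ≤ wabs f n :=
  mul_nonneg (norm_nonneg _) (weight_pos n).le

lemma wabs_mul_le (f g : MvPowerSeries (Fin 2) ℂ) (n : Fin 2 →₀ ℕ) :
    wabs (f * g) n ≤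
      ∑ p ∈ Finset.HasAntidiagonal.antidiagonal n, wabs f p.1 * wabs g p.2 := by
  classical
  unfold wabs
  rw [MvPowerSeries.coeff_mul]
  refine (mul_le_mul_of_nonneg_right (norm_sum_le _ _) (weight_pos n).le).trans ?_
  rw [Finset.sum_mul]
  refine Finset.sum_le_sum fun p hp => ?_
  rw [norm_mul, ← Finset.HasAntidiagonal.mem_antidiagonal.1 hp]
  calc _ ≤ ‖MvPowerSeries.coeff p.1 f‖ * ‖MvPowerSeries.coeff p.2 g‖ * (weight p.1 * weight p.2) :=
        mul_le_mul_of_nonneg_left (weight_add_le _ _) (by positivity)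
    _ = _ := by ring

lemma wabs_add_le (f g : MvPowerSeries (Fin 2) ℂ) (n : Fin 2 →₀ ℕ) :
    wabs (f + g) n ≤ wabs f n + wabs g n := by
  unfold wabs
  rw [map_add, ← add_mul]
  exact mul_le_mul_of_nonneg_right (norm_add_le _ _) (weight_pos n).le

lemma summable_wabs_mul_wabs {f g : MvPowerSeries (Fin 2) ℂ}
    (hf : Summable (wabs f)) (hg : Summable (wabs g)) :
    Summable fun p : (Fin 2 →₀ ℕ) × (Fin 2 →₀ ℕ) => wabs f p.1 * wabs g p.2 :=
  Summable.mul_of_nonneg hf hg (wabs_nonneg f) (wabs_nonneg g)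

lemma summable_wabs_antidiagonal {f g : MvPowerSeries (Fin 2) ℂ}
    (hf : Summable (wabs f)) (hg : Summable (wabs g)) :
    Summable fun n => ∑ p ∈ Finset.HasAntidiagonal.antidiagonal n, wabs f p.1 * wabs g p.2 :=
  summable_sum_mul_antidiagonal_of_summable_mul (summable_wabs_mul_wabs hf hg)

lemma summable_wabs_mul {f g : MvPowerSeries (Fin 2) ℂ}
    (hf : Summable (wabs f)) (hg : Summable (wabs g)) : Summable (wabs (f * g)) :=
  (summable_wabs_antidiagonal hf hg).of_nonneg_of_le (wabs_nonneg _) (wabs_mul_le f g)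

lemma tsum_wabs_mul_le {f g : MvPowerSeries (Fin 2) ℂ}
    (hf : Summable (wabs f)) (hg : Summable (wabs g)) :
    ∑' n, wabs (f * g) n ≤ (∑' n, wabs f n) * ∑' n, wabs g n := by
  rw [hf.tsum_mul_tsum_eq_tsum_sum_antidiagonal hg (summable_wabs_mul_wabs hf hg)]
  exact Summable.tsum_le_tsum (wabs_mul_le f g) (summable_wabs_mul hf hg)
    (summable_wabs_antidiagonal hf hg)

/-- The weighted `ℓ¹` algebra of power series in two variables. -/
def weightedAlgebra : Subalgebra ℂ (MvPowerSeries (Fin 2) ℂ) where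
  carrier := {f | Summable (wabs f)}
  mul_mem' hf hg := summable_wabs_mul hf hg
  add_mem' {f g} hf hg :=
    (Summable.add hf hg).of_nonneg_of_le (wabs_nonneg _) (wabs_add_le f g)
  algebraMap_mem' r := by
    classical
    refine summable_of_ne_finset_zero (s := {0}) fun n hn => ?_
    rw [wabs, ← MvPowerSeries.c_eq_algebraMap, MvPowerSeries.coeff_C_of_ne_zero (by simpa using hn)]
    simp

/-- The underlying type of `weightedAlgebra`. -/
abbrev Wt : Type := weightedAlgebra

/-- The `n`-th coefficient. -/
noncomputable def co (n : Fin 2 →₀ ℕ) : Wt →ₗ[ℂ] ℂ :=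
  (MvPowerSeries.coeff n).comp weightedAlgebra.val.toLinearMap

lemma co_ext {f g : Wt} (h : ∀ n, co n f = co n g) : f = g :=
  Subtype.ext (MvPowerSeries.ext h)

lemma co_mul (n : Fin 2 →₀ ℕ) (f g : Wt) :
    co n (f * g) = ∑ p ∈ Finset.HasAntidiagonal.antidiagonal n, co p.1 f * co p.2 g :=
  MvPowerSeries.coeff_mul n f.1 g.1

lemma co_one (n : Fin 2 →₀ ℕ) : co n 1 = if n = 0 then 1 else 0 := MvPowerSeries.coeff_one n

lemma Wt.summable (f : Wt) : Summable fun n => ‖co n f‖ * weight n := f.2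

noncomputable instance : NormedRing Wt :=
  RingNorm.toNormedRing
    { toFun := fun f => ∑' n, wabs f.1 n
      map_zero' := by simp [wabs]
      add_le' := fun f g => by
        rw [← Summable.tsum_add f.2 g.2]
        exact Summable.tsum_le_tsum (wabs_add_le f.1 g.1) (f + g).2 (Summable.add f.2 g.2)
      neg' := fun f => by simp [wabs]
      mul_le' := fun f g => tsum_wabs_mul_le f.2 g.2
      eq_zero_of_map_eq_zero' := fun f hf => by
        refine Subtype.ext (MvPowerSeries.ext fun n => ?_)
        have h := (hasSum_zero_iff_of_nonneg (wabs_nonneg f.1)).1 (hf ▸ Summable.hasSum f.2)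
        have h' := congrFun h n
        simpa [wabs, (weight_pos n).ne'] using h' }

lemma norm_def (f : Wt) : ‖f‖ = ∑' n, ‖co n f‖ * weight n := rfl

noncomputable instance : NormedCommRing Wt :=
  { (inferInstance : NormedRing Wt) with mul_comm := mul_comm }

noncomputable instance : NormedAlgebra ℂ Wt where
  norm_smul_le r f := by
    rw [norm_def, norm_def, ← tsum_mul_left]
    simp [mul_assoc]

instance : NormOneClass Wt where
  norm_one := by
    rw [norm_def, tsum_eq_single 0]
    · simp [co_one, weight_zero]
    · intro n hn
      simp [co_one, hn]

lemma norm_co_le (n : Fin 2 →₀ ℕ) (f : Wt) : ‖co n f‖ * weight n ≤ ‖f‖ :=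
  f.summable.le_tsum n fun m _ => wabs_nonneg f.1 m

/-- The element of `Wt` with prescribed coefficients. -/
noncomputable def mk (c : (Fin 2 →₀ ℕ) → ℂ) (hc : Summable fun n => ‖c n‖ * weight n) : Wt :=
  ⟨c, hc⟩

lemma co_mk (c : (Fin 2 →₀ ℕ) → ℂ) (hc) (n : Fin 2 →₀ ℕ) : co n (mk c hc) = c n := rfl

lemma continuous_co (n : Fin 2 →₀ ℕ) : Continuous (co n) :=
  AddMonoidHomClass.continuous_of_bound (co n) (weight n)⁻¹ fun f => by
    rw [inv_mul_eq_div, le_div_iff₀ (weight_pos n)]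
    exact norm_co_le n f

instance : CompleteSpace Wt := by
  let e : Wt ≃ᵢ lp (fun _ : Fin 2 →₀ ℕ => ℂ) 1 := IsometryEquiv.mk'
    (fun f => ⟨fun n => co n f * weight n, memℓp_gen (by
      simpa [abs_of_pos (weight_pos _)] using f.summable)⟩)
    (fun a => mk (fun n => a n * (weight n : ℂ)⁻¹) (by
      have := (lp.memℓp a).summable (by simp)
      simpa [abs_of_pos (weight_pos _), (weight_pos _).ne'] using this))
    (fun a => by
      ext n
      have := (weight_pos n).ne'
      simp [co_mk, this])
    (Isometry.of_dist_eq fun f g => by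
      rw [dist_eq_norm, dist_eq_norm, lp.norm_eq_tsum_rpow (by simp), norm_def]
      simp only [ENNReal.toReal_one, Real.rpow_one, div_one, map_sub]
      refine tsum_congr fun n => ?_
      change ‖co n f * weight n - co n g * weight n‖ = _
      rw [← sub_mul, norm_mul, Complex.norm_real, Real.norm_of_nonneg (weight_pos n).le])
  exact e.completeSpace

lemma Wt.norm_mk (c : (Fin 2 →₀ ℕ) → ℂ) (hc) : ‖mk c hc‖ = ∑' n, ‖c n‖ * weight n := rfl

/-- The coefficients of `shiftOp`. -/
noncomputable def shiftCoeff (e : Fin 2 →₀ ℕ) (l : (Fin 2 →₀ ℕ) → ℂ) (f : Wt) (m : Fin 2 →₀ ℕ) : ℂ :=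
  open Classical in if e ≤ m then l (m - e) * co (m - e) f else 0

lemma shiftCoeff_add (e : Fin 2 →₀ ℕ) (l : (Fin 2 →₀ ℕ) → ℂ) (f : Wt) (n : Fin 2 →₀ ℕ) :
    shiftCoeff e l f (n + e) = l n * co n f := by
  simp [shiftCoeff]

lemma shiftCoeff_of_not_le {e m : Fin 2 →₀ ℕ} (l : (Fin 2 →₀ ℕ) → ℂ) (f : Wt) (h : ¬ e ≤ m) :
    shiftCoeff e l f m = 0 := by
  simp [shiftCoeff, h]

lemma support_shiftCoeff_subset (e : Fin 2 →₀ ℕ) (l : (Fin 2 →₀ ℕ) → ℂ) (f : Wt) :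
    (Function.support fun n => ‖shiftCoeff e l f n‖ * weight n) ⊆ Set.range (· + e) := by
  intro m hm
  by_contra h
  refine hm ?_
  have : ¬ e ≤ m := fun hle => h ⟨m - e, tsub_add_cancel_of_le hle⟩
  simp [shiftCoeff_of_not_le l f this]

lemma shiftCoeff_add_le {e : Fin 2 →₀ ℕ} {l : (Fin 2 →₀ ℕ) → ℂ}
    (hl : ∀ n, ‖l n‖ * weight (n + e) ≤ weight n) (f : Wt) (n : Fin 2 →₀ ℕ) :
    ‖shiftCoeff e l f (n + e)‖ * weight (n + e) ≤ ‖co n f‖ * weight n := by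
  rw [shiftCoeff_add, norm_mul]
  calc _ = ‖co n f‖ * (‖l n‖ * weight (n + e)) := by ring
    _ ≤ _ := mul_le_mul_of_nonneg_left (hl n) (norm_nonneg _)

lemma summable_shiftCoeff_comp {e : Fin 2 →₀ ℕ} {l : (Fin 2 →₀ ℕ) → ℂ}
    (hl : ∀ n, ‖l n‖ * weight (n + e) ≤ weight n) (f : Wt) :
    Summable fun n => ‖shiftCoeff e l f (n + e)‖ * weight (n + e) :=
  f.summable.of_nonneg_of_le (fun _ => mul_nonneg (norm_nonneg _) (weight_pos _).le)
    (shiftCoeff_add_le hl f)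

lemma summable_shiftCoeff {e : Fin 2 →₀ ℕ} {l : (Fin 2 →₀ ℕ) → ℂ}
    (hl : ∀ n, ‖l n‖ * weight (n + e) ≤ weight n) (f : Wt) :
    Summable fun n => ‖shiftCoeff e l f n‖ * weight n := by
  rw [← (add_left_injective e).summable_iff]
  · exact summable_shiftCoeff_comp hl f
  · intro m hm
    by_contra h
    exact hm (support_shiftCoeff_subset e l f h)

/-- The operator mapping the `n`-th monomial to `l n` times the `(n + e)`-th one. -/
noncomputable def shiftOp (e : Fin 2 →₀ ℕ) (l : (Fin 2 →₀ ℕ) → ℂ)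
    (hl : ∀ n, ‖l n‖ * weight (n + e) ≤ weight n) : Wt →ₗ[ℂ] Wt where
  toFun f := mk (shiftCoeff e l f) (summable_shiftCoeff hl f)
  map_add' f g := co_ext fun m => by
    simp only [map_add, co_mk, shiftCoeff]
    split_ifs <;> ring
  map_smul' r f := co_ext fun m => by
    simp only [map_smul, co_mk, shiftCoeff, smul_eq_mul, RingHom.id_apply]
    split_ifs <;> ring

section
variable {e : Fin 2 →₀ ℕ} {l : (Fin 2 →₀ ℕ) → ℂ}
    (hl : ∀ n, ‖l n‖ * weight (n + e) ≤ weight n)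

lemma co_add_shiftOp (f : Wt) (n : Fin 2 →₀ ℕ) :
    co (n + e) (shiftOp e l hl f) = l n * co n f := shiftCoeff_add e l f n

lemma co_shiftOp_of_not_le (f : Wt) {m : Fin 2 →₀ ℕ} (h : ¬ e ≤ m) :
    co m (shiftOp e l hl f) = 0 := shiftCoeff_of_not_le l f h

lemma norm_shiftOp_le (f : Wt) : ‖shiftOp e l hl f‖ ≤ ‖f‖ := by
  change ∑' n, ‖shiftCoeff e l f n‖ * weight n ≤ _
  rw [← (add_left_injective e).tsum_eq (support_shiftCoeff_subset e l f)]
  exact (summable_shiftCoeff_comp hl f).tsum_le_tsum (shiftCoeff_add_le hl f) f.summable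

end

/-- The power series `f` only involves monomials with exponents in `S`. -/
def SuppIn (S : Set (Fin 2 →₀ ℕ)) (f : Wt) : Prop := ∀ n, co n f ≠ 0 → n ∈ S

namespace SuppIn
variable {S T U : Set (Fin 2 →₀ ℕ)} {f g : Wt}

lemma mono (hf : SuppIn S f) (h : S ⊆ T) : SuppIn T f := fun n hn => h (hf n hn)

lemma add (hf : SuppIn S f) (hg : SuppIn S g) : SuppIn S (f + g) := fun n hn => by
  by_contra h
  refine hn ?_
  rw [map_add, not_not.1 fun h' => h (hf n h'), not_not.1 fun h' => h (hg n h'), add_zero]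

lemma neg (hf : SuppIn S f) : SuppIn S (-f) := fun n hn => hf n (by simpa using hn)

lemma sub (hf : SuppIn S f) (hg : SuppIn S g) : SuppIn S (f - g) := by
  rw [sub_eq_add_neg]
  exact hf.add hg.neg

lemma smul (r : ℂ) (hf : SuppIn S f) : SuppIn S (r • f) := fun n hn => hf n fun h => hn (by
  rw [map_smul, h, smul_zero])

lemma mul (hf : SuppIn S f) (hg : SuppIn T g) (h : ∀ m ∈ S, ∀ n ∈ T, m + n ∈ U) :
    SuppIn U (f * g) := fun n hn => by
  rw [co_mul] at hn
  obtain ⟨p, hp, hne⟩ := Finset.exists_ne_zero_of_sum_ne_zero hn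
  rw [← Finset.HasAntidiagonal.mem_antidiagonal.1 hp]
  exact h _ (hf _ (left_ne_zero_of_mul hne)) _ (hg _ (right_ne_zero_of_mul hne))

lemma one (h : 0 ∈ S) : SuppIn S 1 := fun n hn => by
  rw [co_one] at hn
  by_cases h' : n = 0
  · exact h' ▸ h
  · simp [h'] at hn

lemma tsum {ι : Type*} {F : ι → Wt} (hF : Summable F) (h : ∀ i, SuppIn S (F i)) :
    SuppIn S (∑' i, F i) := fun n hn => by
  by_contra hS
  refine hn ?_
  have h1 : HasSum (fun i => co n (F i)) (co n (∑' i, F i)) :=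
    hF.hasSum.map (co n) (continuous_co n)
  have h2 : (fun i => co n (F i)) = fun _ => 0 :=
    funext fun i => not_not.1 fun h' => hS (h i n h')
  rw [h2] at h1
  exact h1.unique hasSum_zero

lemma pow (hf : SuppIn S f) (h0 : 0 ∈ S) (hS : ∀ m ∈ S, ∀ n ∈ S, m + n ∈ S) (k : ℕ) :
    SuppIn S (f ^ k) := by
  induction k with
  | zero => rw [pow_zero]; exact one h0
  | succ k ih => rw [pow_succ]; exact ih.mul hf hS

/-- Multiplicative inverses of series supported in a submonoid are supported there as well. -/
lemma of_mul_eq_one (hf : SuppIn S f) (hS : ∀ m ∈ S, ∀ n ∈ S, m + n ∈ S) (h0 : 0 ∈ S)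
    (hfg : f * g = 1) : SuppIn S g := by
  have hf0 : co 0 f * co 0 g = 1 := by
    simpa [co_mul, co_one] using congrArg (co 0) hfg
  suffices H : ∀ k : ℕ, ∀ n : Fin 2 →₀ ℕ, n.degree = k → n ∉ S → co n g = 0 from
    fun n hn => by_contra fun h => hn (H _ n rfl h)
  intro k
  induction k using Nat.strong_induction_on with
  | _ k ih =>
    intro n hk hn
    have hn0 : n ≠ 0 := fun h => hn (h ▸ h0)
    have h := congrArg (co n) hfg
    rw [co_mul, co_one, if_neg hn0] at h
    rw [Finset.sum_eq_single (0, n)] at h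
    · exact (mul_eq_zero.1 h).resolve_left (left_ne_zero_of_mul_eq_one hf0)
    · rintro ⟨a, b⟩ hab hne
      have hab' : a + b = n := Finset.HasAntidiagonal.mem_antidiagonal.1 hab
      by_cases ha : co a f = 0
      · simp [ha]
      have haS := hf a ha
      have ha0 : a ≠ 0 := by
        rintro rfl
        exact hne (by simpa using hab')
      have hbS : b ∉ S := fun hb => hn (hab' ▸ hS a haS b hb)
      have hdeg : b.degree < k := by
        rw [← hk, ← hab', map_add]
        have : a.degree ≠ 0 := fun h0 => ha0 ((Finsupp.degree_eq_zero_iff a).1 h0)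
        omega
      simp [ih _ hdeg b rfl hbS]
    · intro h'
      exact absurd (Finset.HasAntidiagonal.mem_antidiagonal.2 (zero_add n)) h'

end SuppIn

/-- Evaluation of monomials is dominated by the weights. -/
lemma norm_monomial_le {x s : ℂ} (hx : ‖x‖ ≤ 1 / 2) (hs : ‖s‖ ≤ 1 / 2) (n : Fin 2 →₀ ℕ) :
    ‖x ^ n 0 * s ^ n 1‖ ≤ weight n := by
  refine le_trans ?_ (inv_two_pow_le_weight n)
  rw [norm_mul, norm_pow, norm_pow]
  gcongr

lemma norm_co_mul_monomial_le {x s : ℂ} (hx : ‖x‖ ≤ 1 / 2) (hs : ‖s‖ ≤ 1 / 2) (f : Wt)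
    (n : Fin 2 →₀ ℕ) : ‖co n f * (x ^ n 0 * s ^ n 1)‖ ≤ ‖co n f‖ * weight n := by
  rw [norm_mul]
  exact mul_le_mul_of_nonneg_left (norm_monomial_le hx hs n) (norm_nonneg _)

/-- The value of `f` at the point `(x, s)`. -/
noncomputable def ev (x s : ℂ) (f : Wt) : ℂ := ∑' n, co n f * (x ^ n 0 * s ^ n 1)

section
variable {x s : ℂ} (hx : ‖x‖ ≤ 1 / 2) (hs : ‖s‖ ≤ 1 / 2)
include hx hs

lemma summable_norm_ev (f : Wt) : Summable fun n => ‖co n f * (x ^ n 0 * s ^ n 1)‖ :=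
  f.summable.of_nonneg_of_le (fun _ => norm_nonneg _) (norm_co_mul_monomial_le hx hs f)

lemma hasSum_ev (f : Wt) : HasSum (fun n => co n f * (x ^ n 0 * s ^ n 1)) (ev x s f) :=
  (summable_norm_ev hx hs f).of_norm.hasSum

lemma norm_ev_le (f : Wt) : ‖ev x s f‖ ≤ ‖f‖ :=
  (norm_tsum_le_tsum_norm (summable_norm_ev hx hs f)).trans
    ((summable_norm_ev hx hs f).tsum_le_tsum (norm_co_mul_monomial_le hx hs f) f.summable)

lemma ev_mul (f g : Wt) : ev x s (f * g) = ev x s f * ev x s g := by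
  have h : Summable fun p : (Fin 2 →₀ ℕ) × (Fin 2 →₀ ℕ) =>
      (co p.1 f * (x ^ p.1 0 * s ^ p.1 1)) * (co p.2 g * (x ^ p.2 0 * s ^ p.2 1)) :=
    summable_mul_of_summable_norm (f := fun n : Fin 2 →₀ ℕ => co n f * (x ^ n 0 * s ^ n 1))
      (g := fun n : Fin 2 →₀ ℕ => co n g * (x ^ n 0 * s ^ n 1))
      (summable_norm_ev hx hs f) (summable_norm_ev hx hs g)
  unfold ev
  rw [(summable_norm_ev hx hs f).of_norm.tsum_mul_tsum_eq_tsum_sum_antidiagonal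
    (summable_norm_ev hx hs g).of_norm h]
  refine tsum_congr fun n => ?_
  rw [co_mul, Finset.sum_mul]
  refine Finset.sum_congr rfl fun p hp => ?_
  rw [← Finset.HasAntidiagonal.mem_antidiagonal.1 hp, Finsupp.add_apply, Finsupp.add_apply,
    pow_add, pow_add]
  ring

lemma ev_add (f g : Wt) : ev x s (f + g) = ev x s f + ev x s g := by
  refine (hasSum_ev hx hs (f + g)).unique ?_
  simpa [add_mul] using (hasSum_ev hx hs f).add (hasSum_ev hx hs g)

end

lemma ev_smul (x s r : ℂ) (f : Wt) : ev x s (r • f) = r * ev x s f := by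
  simp [ev, mul_assoc, tsum_mul_left]

lemma ev_one (x s : ℂ) : ev x s 1 = 1 := by
  unfold ev
  rw [tsum_eq_single 0]
  · simp [co_one]
  · intro n hn
    simp [co_one, hn]

/-- Evaluation at a point of the polydisc, as an algebra homomorphism. -/
noncomputable def evHom {x s : ℂ} (hx : ‖x‖ ≤ 1 / 2) (hs : ‖s‖ ≤ 1 / 2) : Wt →ₐ[ℂ] ℂ where
  toFun := ev x s
  map_one' := ev_one x s
  map_mul' := ev_mul hx hs
  map_zero' := by simp [ev]
  map_add' := ev_add hx hs
  commutes' r := by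
    rw [Algebra.algebraMap_eq_smul_one, ev_smul, ev_one, mul_one, Algebra.algebraMap_self,
      RingHom.id_apply]

lemma continuous_evHom {x s : ℂ} (hx : ‖x‖ ≤ 1 / 2) (hs : ‖s‖ ≤ 1 / 2) :
    Continuous (evHom hx hs) :=
  AddMonoidHomClass.continuous_of_bound (evHom hx hs) 1 fun f => by
    rw [one_mul]
    exact norm_ev_le hx hs f

/-- The monomial `X ^ e`. -/
noncomputable def monom (e : Fin 2 →₀ ℕ) : Wt :=
  mk (Pi.single e 1) (summable_of_ne_finset_zero (s := {e}) fun n hn => by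
    simp [Pi.single_eq_of_ne (by simpa using hn : n ≠ e)])

lemma suppIn_monom (e : Fin 2 →₀ ℕ) : SuppIn {e} (monom e) := fun n hn => by
  by_contra h
  exact hn (Pi.single_eq_of_ne h _)

lemma norm_monom (e : Fin 2 →₀ ℕ) : ‖monom e‖ = weight e := by
  rw [monom, Wt.norm_mk, tsum_eq_single e]
  · simp
  · intro n hn
    simp [Pi.single_eq_of_ne hn]

lemma ev_monom (x s : ℂ) (e : Fin 2 →₀ ℕ) : ev x s (monom e) = x ^ e 0 * s ^ e 1 := by
  unfold ev monom
  simp only [co_mk]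
  rw [tsum_eq_single e]
  · simp
  · intro n hn
    simp [Pi.single_eq_of_ne hn]

/-- The sum of the double power series with coefficients `c`. -/
noncomputable def dser (c : ℕ × ℕ → ℂ) (p : ℂ × ℂ) : ℂ := ∑' n, c n * (p.1 ^ n.1 * p.2 ^ n.2)

/-- The exponent `(a, b)`. -/
noncomputable def pack (a b : ℕ) : Fin 2 →₀ ℕ := Finsupp.single 0 a + Finsupp.single 1 b

@[simp] lemma pack_zero (a b : ℕ) : pack a b 0 = a := by simp [pack]
@[simp] lemma pack_one (a b : ℕ) : pack a b 1 = b := by simp [pack]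

lemma exponent_ext {m n : Fin 2 →₀ ℕ} (h0 : m 0 = n 0) (h1 : m 1 = n 1) : m = n := by
  ext i
  fin_cases i
  · exact h0
  · exact h1

lemma pack_add (a b c d : ℕ) : pack a b + pack c d = pack (a + c) (b + d) :=
  exponent_ext (by simp) (by simp)

lemma monom_mul (d e : Fin 2 →₀ ℕ) : monom d * monom e = monom (d + e) := by
  classical
  have h : ∀ d : Fin 2 →₀ ℕ, (monom d).1 = MvPowerSeries.monomial d 1 := fun d => by
    refine MvPowerSeries.ext fun n => ?_
    rw [MvPowerSeries.coeff_monomial]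
    change (Pi.single d (1 : ℂ) : (Fin 2 →₀ ℕ) → ℂ) n = _
    rw [Pi.single_apply]
  refine Subtype.ext ?_
  change (monom d).1 * (monom e).1 = _
  rw [h, h, h, MvPowerSeries.monomial_mul_monomial, one_mul]

lemma monom_zero : monom 0 = 1 := co_ext fun n => by
  classical
  rw [co_one, monom, co_mk, Pi.single_apply]

lemma monom_pow_mul_monom_pow (i j : ℕ) :
    monom (pack 1 0) ^ i * monom (pack 0 1) ^ j = monom (pack i j) := by
  have h0 : ∀ i, monom (pack 1 0) ^ i = monom (pack i 0) := fun i => by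
    induction i with
    | zero => rw [pow_zero, ← monom_zero]; exact congrArg _ (exponent_ext (by simp) (by simp))
    | succ i ih => rw [pow_succ, ih, monom_mul, pack_add]
  have h1 : ∀ i, monom (pack 0 1) ^ i = monom (pack 0 i) := fun i => by
    induction i with
    | zero => rw [pow_zero, ← monom_zero]; exact congrArg _ (exponent_ext (by simp) (by simp))
    | succ i ih => rw [pow_succ, ih, monom_mul, pack_add]
  rw [h0, h1, monom_mul, pack_add, zero_add, add_zero]

lemma norm_monom_pack_one_zero : ‖monom (pack 1 0)‖ = 1 := by simp [norm_monom, weight]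
lemma norm_monom_pack_zero_one : ‖monom (pack 0 1)‖ = 1 := by simp [norm_monom, weight]

/-- The continuous linear functional with prescribed values on monomials. -/
lemma exists_functional {l : (Fin 2 →₀ ℕ) → ℂ} {C : ℝ} (hl : ∀ n, ‖l n‖ ≤ C * weight n) :
    ∃ L : Wt →L[ℂ] ℂ, ∀ n, L (monom n) = l n := by
  have hb : ∀ (f : Wt) n, ‖co n f * l n‖ ≤ C * (‖co n f‖ * weight n) := fun f n => by
    rw [norm_mul]
    calc _ ≤ ‖co n f‖ * (C * weight n) := mul_le_mul_of_nonneg_left (hl n) (norm_nonneg _)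
      _ = _ := by ring
  have hs : ∀ f : Wt, Summable fun n => ‖co n f * l n‖ := fun f =>
    (f.summable.mul_left C).of_nonneg_of_le (fun _ => norm_nonneg _) (hb f)
  let L : Wt →ₗ[ℂ] ℂ :=
    { toFun := fun f => ∑' n, co n f * l n
      map_add' := fun f g => by
        rw [← (hs f).of_norm.tsum_add (hs g).of_norm]
        simp [add_mul]
      map_smul' := fun r f => by
        simp [mul_assoc, tsum_mul_left] }
  refine ⟨L.mkContinuous C fun f => ?_, fun n => ?_⟩
  · rw [norm_def, ← tsum_mul_left]
    exact (norm_tsum_le_tsum_norm (hs f)).trans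
      ((hs f).tsum_le_tsum (hb f) (f.summable.mul_left C))
  · change ∑' m, co m (monom n) * l m = l n
    rw [tsum_eq_single n]
    · simp [monom, co_mk]
    · intro m hm
      simp [monom, co_mk, Pi.single_eq_of_ne hm]

lemma hasSum_resolvent {t : Wt} (ht : ‖t‖ < 1) :
    HasSum (fun n : ℕ => t ^ n) (Ring.inverse (1 - t)) :=
  hasSum_geom_series_inverse t ht

lemma analyticAt_resolvent {t : Wt} (ht : ‖t‖ < 1) :
    AnalyticAt ℂ (fun t : Wt => Ring.inverse (1 - t)) t := by
  have h := analyticAt_inverse (𝕜 := ℂ) (Units.oneSub t ht)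
  rw [Units.val_oneSub] at h
  exact h.comp (analyticAt_const.sub analyticAt_id)

lemma hasSum_monom {x y : ℂ} (hx : ‖x‖ < 1) (hy : ‖y‖ < 1) :
    HasSum (fun n : ℕ × ℕ => (x ^ n.1 * y ^ n.2) • monom (pack n.1 n.2))
      (Ring.inverse (1 - x • monom (pack 1 0)) * Ring.inverse (1 - y • monom (pack 0 1))) := by
  have h0 : ‖x • monom (pack 1 0)‖ < 1 := by
    rwa [norm_smul, norm_monom_pack_one_zero, mul_one]
  have h1 : ‖y • monom (pack 0 1)‖ < 1 := by
    rwa [norm_smul, norm_monom_pack_zero_one, mul_one]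
  have h := (hasSum_resolvent h0).mul (hasSum_resolvent h1)
    (summable_mul_of_summable_norm (summable_norm_geometric_of_norm_lt_one h0)
      (summable_norm_geometric_of_norm_lt_one h1))
  refine h.congr_fun fun n => ?_
  rw [smul_pow, smul_pow, smul_mul_smul_comm, monom_pow_mul_monom_pow]

lemma dser_analyticAt {c : ℕ × ℕ → ℂ} {C A : ℝ} (hA : 0 < A)
    (hc : ∀ n, ‖c n‖ ≤ C * A ^ (n.1 + n.2)) {p : ℂ × ℂ} (hp : ‖p‖ < (2 * A)⁻¹) :
    AnalyticAt ℂ (dser c) p := by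
  obtain ⟨L, hL⟩ := exists_functional (C := C)
    (l := fun n => c (n 0, n 1) * (2 * A : ℂ)⁻¹ ^ (n 0 + n 1)) fun n => by
      have h1 := inv_two_pow_le_weight n
      have hC : 0 ≤ C := by
        have := (norm_nonneg _).trans (hc (0, 0))
        simpa using this
      refine le_trans ?_ (mul_le_mul_of_nonneg_left h1 hC)
      rw [norm_mul, norm_pow, norm_inv, norm_mul, Complex.norm_real, Real.norm_of_nonneg hA.le,
        Complex.norm_ofNat]
      calc _ ≤ C * A ^ (n 0 + n 1) * (2 * A)⁻¹ ^ (n 0 + n 1) :=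
            mul_le_mul_of_nonneg_right (hc _) (by positivity)
        _ = C * (A * (2 * A)⁻¹) ^ (n 0 + n 1) := by rw [mul_pow]; ring
        _ = _ := by
          rw [← pow_add]
          congr 2
          field_simp
  have hA' : (2 * A : ℂ) ≠ 0 := by
    have : (A : ℂ) ≠ 0 := by exact_mod_cast hA.ne'
    simpa using this
  have hsmall : ∀ p : ℂ × ℂ, ‖p‖ < (2 * A)⁻¹ → ‖2 * A * p.1‖ < 1 ∧ ‖2 * A * p.2‖ < 1 := by
    intro p hp
    have e : ∀ z : ℂ, ‖z‖ ≤ ‖p‖ → ‖2 * A * z‖ < 1 := fun z hz => by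
      rw [norm_mul, norm_mul, Complex.norm_real, Real.norm_of_nonneg hA.le, Complex.norm_ofNat]
      calc 2 * A * ‖z‖ ≤ 2 * A * ‖p‖ := by gcongr
        _ < 2 * A * (2 * A)⁻¹ := by gcongr
        _ = 1 := by field_simp
    exact ⟨e _ (norm_fst_le p), e _ (norm_snd_le p)⟩
  have heq : ∀ p : ℂ × ℂ, ‖p‖ < (2 * A)⁻¹ →
      L (Ring.inverse (1 - (2 * A * p.1) • monom (pack 1 0)) *
        Ring.inverse (1 - (2 * A * p.2) • monom (pack 0 1))) = dser c p := by
    intro p hp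
    have h := (hasSum_monom (hsmall p hp).1 (hsmall p hp).2).mapL L
    rw [← h.tsum_eq]
    refine tsum_congr fun n => ?_
    rw [map_smul, hL, smul_eq_mul, pack_zero, pack_one, mul_pow (2 * (A : ℂ)) p.1,
      mul_pow (2 * (A : ℂ)) p.2, inv_pow, pow_add]
    field_simp
  have hev : (fun p : ℂ × ℂ => L (Ring.inverse (1 - (2 * A * p.1) • monom (pack 1 0)) *
        Ring.inverse (1 - (2 * A * p.2) • monom (pack 0 1)))) =ᶠ[nhds p] dser c := by
    filter_upwards [(isOpen_lt continuous_norm continuous_const).mem_nhds hp] with p hp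
    exact heq p hp
  refine AnalyticAt.congr ?_ hev
  have h0 : ‖(2 * A * p.1) • monom (pack 1 0)‖ < 1 := by
    rw [norm_smul, norm_monom_pack_one_zero, mul_one]
    exact (hsmall p hp).1
  have h1 : ‖(2 * A * p.2) • monom (pack 0 1)‖ < 1 := by
    rw [norm_smul, norm_monom_pack_zero_one, mul_one]
    exact (hsmall p hp).2
  refine (L.analyticAt _).comp (AnalyticAt.mul ?_ ?_)
  · exact (analyticAt_resolvent h0).comp_of_eq
      (f := fun p : ℂ × ℂ => (2 * A * p.1) • monom (pack 1 0))
      ((analyticAt_const.mul analyticAt_fst).smul analyticAt_const) rfl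
  · exact (analyticAt_resolvent h1).comp_of_eq
      (f := fun p : ℂ × ℂ => (2 * A * p.2) • monom (pack 0 1))
      ((analyticAt_const.mul analyticAt_snd).smul analyticAt_const) rfl

lemma dser_summable {c : ℕ × ℕ → ℂ} {C A : ℝ} (hA : 0 < A)
    (hc : ∀ n, ‖c n‖ ≤ C * A ^ (n.1 + n.2)) {p : ℂ × ℂ} (hp : ‖p‖ < A⁻¹) :
    Summable fun n : ℕ × ℕ => c n * (p.1 ^ n.1 * p.2 ^ n.2) := by
  have e : ∀ z : ℂ, ‖z‖ ≤ ‖p‖ → A * ‖z‖ < 1 := fun z hz => by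
    calc A * ‖z‖ ≤ A * ‖p‖ := by gcongr
      _ < A * A⁻¹ := by gcongr
      _ = 1 := by field_simp
  have h := (Summable.mul_of_nonneg
    (summable_geometric_of_lt_one (by positivity) (e _ (norm_fst_le p)))
    (summable_geometric_of_lt_one (by positivity) (e _ (norm_snd_le p)))
    (fun _ => by positivity) (fun _ => by positivity)).mul_left C
  refine Summable.of_norm (h.of_nonneg_of_le (fun _ => norm_nonneg _) fun n => ?_)
  rw [norm_mul, norm_mul, norm_pow, norm_pow]
  calc _ ≤ C * A ^ (n.1 + n.2) * (‖p.1‖ ^ n.1 * ‖p.2‖ ^ n.2) :=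
        mul_le_mul_of_nonneg_right (hc n) (by positivity)
    _ = _ := by rw [mul_pow, mul_pow, pow_add]; ring

/-- The coefficients, in the variables `(x, y)`, of a series in `(x / ε, y / (ε * x))`. -/
noncomputable def blowDown (ε : ℝ) (d0 d1 : ℕ) (f : Wt) (n : ℕ × ℕ) : ℂ :=
  co (pack (n.1 + n.2 + d0) (n.2 + d1)) f * (ε : ℂ)⁻¹ ^ (n.1 + 2 * n.2)

lemma ev_eq_dser {ε : ℝ} (hε : 0 < ε) {d0 d1 : ℕ} {f : Wt}
    (hf : SuppIn (Set.range fun n : ℕ × ℕ => pack (n.1 + n.2 + d0) (n.2 + d1)) f)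
    {x : ℂ} (hx : x ≠ 0) (y : ℂ) :
    ev (x / ε) (y / (ε * x)) f =
      (x / ε) ^ d0 * (y / (ε * x)) ^ d1 * dser (blowDown ε d0 d1 f) (x, y) := by
  have hε' : (ε : ℂ) ≠ 0 := by exact_mod_cast hε.ne'
  have hinj : Function.Injective fun n : ℕ × ℕ => pack (n.1 + n.2 + d0) (n.2 + d1) := by
    rintro ⟨a, b⟩ ⟨a', b'⟩ h
    have h0 := congrArg (fun n : Fin 2 →₀ ℕ => n 0) h
    have h1 := congrArg (fun n : Fin 2 →₀ ℕ => n 1) h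
    simp only [pack_zero, pack_one] at h0 h1
    ext <;> simp <;> omega
  unfold ev dser
  rw [← hinj.tsum_eq, ← tsum_mul_left]
  · refine tsum_congr fun n => ?_
    simp only [pack_zero, pack_one, blowDown]
    have : (x / ε) ^ (n.1 + n.2 + d0) * (y / (ε * x)) ^ (n.2 + d1) =
        (x / ε) ^ d0 * (y / (ε * x)) ^ d1 * ((ε : ℂ)⁻¹ ^ (n.1 + 2 * n.2) * (x ^ n.1 * y ^ n.2)) := by
      have e : ((x / ε) * (y / (ε * x))) = (ε : ℂ)⁻¹ ^ 2 * y := by field_simp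
      calc _ = (x / ε) ^ d0 * (y / (ε * x)) ^ d1 * ((x / ε) ^ n.1 *
            ((x / ε) * (y / (ε * x))) ^ n.2) := by rw [mul_pow, pow_add, pow_add, pow_add]; ring
        _ = _ := by rw [e, pow_add, pow_mul, mul_pow, div_eq_mul_inv, mul_pow]; ring
    rw [this]
    ring
  · intro n hn
    exact hf n fun h => hn (by simp [h])

lemma norm_blowDown_le {ε : ℝ} (hε : 0 < ε) (hε1 : ε ≤ 1) (d0 d1 : ℕ) (f : Wt) (n : ℕ × ℕ) :
    ‖blowDown ε d0 d1 f n‖ ≤ ‖f‖ * 2 ^ (d0 + d1) * ((2 / ε) ^ 2) ^ (n.1 + n.2) := by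
  set m := pack (n.1 + n.2 + d0) (n.2 + d1) with hm
  have h1 : ‖co m f‖ ≤ ‖f‖ * 2 ^ (m 0 + m 1) := by
    have h2 := (mul_le_mul_of_nonneg_left (inv_two_pow_le_weight m) (norm_nonneg (co m f))).trans
      (norm_co_le m f)
    rw [← pow_add, one_div, inv_pow] at h2
    rwa [← div_eq_mul_inv, div_le_iff₀ (by positivity)] at h2
  have h3 : m 0 + m 1 = d0 + d1 + (n.1 + 2 * n.2) := by simp [hm]; ring
  rw [blowDown, norm_mul, norm_pow, norm_inv, Complex.norm_real, Real.norm_of_nonneg hε.le]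
  calc _ ≤ ‖f‖ * 2 ^ (m 0 + m 1) * ε⁻¹ ^ (n.1 + 2 * n.2) := by gcongr
    _ = ‖f‖ * 2 ^ (d0 + d1) * (2 / ε) ^ (n.1 + 2 * n.2) := by
      rw [h3, pow_add, div_eq_mul_inv, mul_pow]; ring
    _ ≤ ‖f‖ * 2 ^ (d0 + d1) * (2 / ε) ^ (2 * (n.1 + n.2)) := by
      gcongr
      · rw [le_div_iff₀ hε]; linarith
      · omega
    _ = _ := by rw [pow_mul]

lemma exists_ball_blowDown {ε : ℝ} (hε : 0 < ε) (hε1 : ε ≤ 1) (d0 d1 : ℕ) (f : Wt) :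
    AnalyticOnNhd ℂ (dser (blowDown ε d0 d1 f)) (Metric.ball 0 (2 * (2 / ε) ^ 2)⁻¹) := by
  intro p hp
  exact dser_analyticAt (by positivity) (norm_blowDown_le hε hε1 d0 d1 f) (by simpa using hp)

/-- Termwise differentiation along a curve on which both coordinates are monomials. -/
lemma hasDerivAt_ev {U : Set ℂ} (hU : IsOpen U) {X S : ℂ → ℂ} {α β : ℂ} {f g : Wt}
    (hX : ∀ z ∈ U, ‖X z‖ ≤ 1 / 2) (hS : ∀ z ∈ U, ‖S z‖ ≤ 1 / 2)
    (hX' : ∀ z ∈ U, HasDerivAt X (α * X z / z) z) (hS' : ∀ z ∈ U, HasDerivAt S (β * S z / z) z)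
    (hfg : ∀ n, co n g = (α * n 0 + β * n 1) * co n f) {z : ℂ} (hz : z ∈ U) :
    HasDerivAt (fun z => ev (X z) (S z) f) (ev (X z) (S z) g / z) z := by
  have hpow : ∀ {Y : ℂ → ℂ} {γ w : ℂ} (k : ℕ), HasDerivAt Y (γ * Y w / w) w →
      HasDerivAt (fun z => Y z ^ k) (γ * k * Y w ^ k / w) w := by
    intro Y γ w k h
    refine (h.fun_pow k).congr_deriv ?_
    cases k with
    | zero => simp
    | succ k => rw [Nat.add_sub_cancel, pow_succ]; ring
  have hterm : ∀ n, ∀ w ∈ U, HasDerivAt (fun z => co n f * (X z ^ n 0 * S z ^ n 1))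
      (co n g * (X w ^ n 0 * S w ^ n 1) / w) w := fun n w hw => by
    refine (((hpow (n 0) (hX' w hw)).mul (hpow (n 1) (hS' w hw))).const_mul (co n f)).congr_deriv ?_
    rw [hfg]
    ring
  have hdiff : ∀ n, DifferentiableOn ℂ (fun z => co n f * (X z ^ n 0 * S z ^ n 1)) U :=
    fun n w hw => (hterm n w hw).differentiableAt.differentiableWithinAt
  have hle : ∀ n, ∀ w ∈ U, ‖co n f * (X w ^ n 0 * S w ^ n 1)‖ ≤ ‖co n f‖ * weight n :=
    fun n w hw => norm_co_mul_monomial_le (hX w hw) (hS w hw) f n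
  have hsum := Complex.hasSum_deriv_of_summable_norm f.summable hdiff hU hle hz
  have hd := (Complex.differentiableOn_tsum_of_summable_norm f.summable hdiff hU hle).differentiableAt
    (hU.mem_nhds hz)
  refine hd.hasDerivAt.congr_deriv (hsum.unique ?_)
  refine ((hasSum_ev (hX z hz) (hS z hz) g).div_const z).congr_fun fun n => ?_
  exact (hterm n z hz).deriv

lemma co_add_monom_mul (e n : Fin 2 →₀ ℕ) (f : Wt) : co (n + e) (monom e * f) = co n f := by
  rw [co_mul, Finset.sum_eq_single (e, n)]
  · simp [monom, co_mk]
  · rintro ⟨a, b⟩ hab hne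
    have hab' : a + b = n + e := Finset.HasAntidiagonal.mem_antidiagonal.1 hab
    by_cases ha : a = e
    · subst ha
      rw [add_comm n] at hab'
      exact absurd (congrArg (Prod.mk a) (add_left_cancel hab')) hne
    · simp [monom, co_mk, Pi.single_eq_of_ne ha]
  · intro h
    exact absurd (Finset.HasAntidiagonal.mem_antidiagonal.2 (add_comm e n)) h

lemma co_monom_mul_of_not_le {e m : Fin 2 →₀ ℕ} (h : ¬ e ≤ m) (f : Wt) :
    co m (monom e * f) = 0 := by
  by_contra hne
  have := (suppIn_monom e).mul (T := Set.univ) (U := {m | e ≤ m}) (g := f) (fun _ _ => trivial)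
    (fun a ha b _ => by 
      rw [Set.mem_singleton_iff.1 ha]
      exact le_self_add (a := e) (b := b)) m hne
  exact h this

/-- Integration with respect to `y`. -/
noncomputable def primY : Wt →ₗ[ℂ] Wt :=
  shiftOp (pack 1 1) (fun n => ((n 1 : ℂ) + 1)⁻¹) fun n => by
    have h1 : ‖((n 1 : ℂ) + 1)⁻¹‖ ≤ 1 := by
      rw [norm_inv]
      refine inv_le_one_of_one_le₀ ?_
      have : ‖((n 1 + 1 : ℕ) : ℂ)‖ = (n 1 + 1 : ℕ) := Complex.norm_natCast _
      push_cast at this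
      rw [this]
      have : (0 : ℝ) ≤ n 1 := Nat.cast_nonneg _
      linarith
    have h2 : weight (pack 1 1) ≤ 1 := by
      rw [weight]; norm_num
    calc _ ≤ 1 * (weight n * 1) :=
          mul_le_mul h1 ((weight_add_le _ _).trans
            (mul_le_mul_of_nonneg_left h2 (weight_pos _).le)) (weight_pos _).le zero_le_one
      _ = _ := by ring

/-- Integration with respect to `y` followed by the operator `x ∂/∂x`. -/
noncomputable def eulerPrimY : Wt →ₗ[ℂ] Wt :=
  shiftOp (pack 1 1) (fun n => ((n 0 : ℂ) - n 1) / ((n 1 : ℂ) + 1)) fun n => by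
    set k := n 0 with hk
    set j := n 1 with hj
    have h1 : ‖((k : ℂ) - j) / ((j : ℂ) + 1)‖ ≤ (k + j + 1) / (j + 1) := by
      rw [norm_div]
      have e : ‖((j + 1 : ℕ) : ℂ)‖ = (j + 1 : ℕ) := Complex.norm_natCast _
      push_cast at e
      rw [e]
      gcongr
      refine (norm_sub_le _ _).trans ?_
      rw [Complex.norm_natCast, Complex.norm_natCast]
      linarith
    have h2 : ((k : ℝ) + j + 1) / (j + 1) * (k + j).choose j ≤ (k + j + 2).choose (j + 1) := by
      have e1 := Nat.add_one_mul_choose_eq (k + j) j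
      have e2 : (k + j + 1).choose (j + 1) ≤ (k + j + 2).choose (j + 1) :=
        Nat.choose_le_choose _ (by omega)
      rw [div_mul_eq_mul_div, div_le_iff₀ (by positivity)]
      have e3 : (k + j + 1) * (k + j).choose j ≤ (k + j + 2).choose (j + 1) * (j + 1) := by
        calc _ = _ := e1
          _ ≤ _ := Nat.mul_le_mul_right _ e2
      exact_mod_cast e3
    have h3 : weight (n + pack 1 1) = ((k + j + 2).choose (j + 1) : ℝ)⁻¹ := by
      rw [weight]
      simp only [Finsupp.add_apply, pack_zero, pack_one]
      rw [← hk, ← hj]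
      congr 3
      ring
    rw [h3, weight, ← hk, ← hj]
    have p1 : (0 : ℝ) < (k + j).choose j := by
      exact_mod_cast Nat.choose_pos (Nat.le_add_left _ _)
    have p2 : (0 : ℝ) < (k + j + 2).choose (j + 1) := by
      exact_mod_cast Nat.choose_pos (by omega)
    rw [← div_eq_mul_inv, div_le_iff₀ p2, inv_mul_eq_div, le_div_iff₀ p1]
    exact (mul_le_mul_of_nonneg_right h1 p1.le).trans h2

/-- The projection onto the part of positive degree in `x`. -/
noncomputable def posPart : Wt →ₗ[ℂ] Wt :=
  shiftOp 0 (fun n => if n 1 + 1 ≤ n 0 then 1 else 0) fun n => by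
    rw [add_zero]
    split_ifs
    · simp
    · simpa using (weight_pos n).le

lemma co_posPart (n : Fin 2 →₀ ℕ) (f : Wt) :
    co n (posPart f) = (if n 1 + 1 ≤ n 0 then 1 else 0) * co n f := by
  have h : co (n + 0) (posPart f) = _ := co_add_shiftOp _ f n
  rwa [add_zero] at h

lemma suppIn_posPart (f : Wt) : SuppIn {n | n 1 + 1 ≤ n 0} (posPart f) := fun n hn => by
  by_contra h
  rw [co_posPart, if_neg (by exact h), zero_mul] at hn
  exact hn rfl

lemma suppIn_sub_posPart (f : Wt) : SuppIn {n | n 0 ≤ n 1} (f - posPart f) := fun n hn => by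
  by_contra h
  have h' : n 1 + 1 ≤ n 0 := by
    have h2 : ¬ n 0 ≤ n 1 := h
    omega
  rw [map_sub, co_posPart, if_pos h', one_mul, sub_self] at hn
  exact hn rfl

lemma posPart_eq_self {f : Wt} (hf : SuppIn {n | n 1 + 1 ≤ n 0} f) : posPart f = f :=
  co_ext fun n => by
    rw [co_posPart]
    split_ifs with h
    · rw [one_mul]
    · rw [zero_mul]
      by_contra h'
      exact h (hf n fun h0 => h' h0.symm)

lemma posPart_one : posPart 1 = 0 := co_ext fun n => by
  rw [co_posPart, co_one]
  split_ifs with h1 h2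
  · simp [h2] at h1
  · simp
  · simp
  · simp

lemma suppIn_primY {f : Wt} (hf : SuppIn {n | n 1 + 1 ≤ n 0} f) :
    SuppIn {n | n 1 + 1 ≤ n 0} (primY f) := fun n hn => by
  by_cases h : pack 1 1 ≤ n
  · obtain ⟨m, rfl⟩ : ∃ m, n = m + pack 1 1 := ⟨n - pack 1 1, (tsub_add_cancel_of_le h).symm⟩
    rw [primY, co_add_shiftOp] at hn
    have := hf m (right_ne_zero_of_mul hn)
    simpa using this
  · exact absurd (co_shiftOp_of_not_le _ f h) hn

lemma co_eulerPrimY (n : Fin 2 →₀ ℕ) (f : Wt) :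
    co n (eulerPrimY f) = (1 * n 0 + -1 * n 1) * co n (primY f) := by
  by_cases h : pack 1 1 ≤ n
  · obtain ⟨m, rfl⟩ : ∃ m, n = m + pack 1 1 := ⟨n - pack 1 1, (tsub_add_cancel_of_le h).symm⟩
    rw [primY, eulerPrimY, co_add_shiftOp, co_add_shiftOp]
    simp only [Finsupp.add_apply, pack_zero, pack_one]
    push_cast
    ring
  · rw [primY, eulerPrimY, co_shiftOp_of_not_le _ f h, co_shiftOp_of_not_le _ f h, mul_zero]

lemma co_monom_mul_eq_primY (n : Fin 2 →₀ ℕ) (f : Wt) :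
    co n (monom (pack 1 1) * f) = (0 * n 0 + 1 * n 1) * co n (primY f) := by
  by_cases h : pack 1 1 ≤ n
  · obtain ⟨m, rfl⟩ : ∃ m, n = m + pack 1 1 := ⟨n - pack 1 1, (tsub_add_cancel_of_le h).symm⟩
    rw [primY, co_add_shiftOp, co_add_monom_mul]
    simp only [Finsupp.add_apply, pack_one]
    have : (m 1 : ℂ) + 1 ≠ 0 := Nat.cast_add_one_ne_zero _
    push_cast
    field_simp
    ring
  · rw [primY, co_shiftOp_of_not_le _ f h, co_monom_mul_of_not_le h, mul_zero]

lemma norm_primY_le (f : Wt) : ‖primY f‖ ≤ ‖f‖ := norm_shiftOp_le _ f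
lemma norm_eulerPrimY_le (f : Wt) : ‖eulerPrimY f‖ ≤ ‖f‖ := norm_shiftOp_le _ f
lemma norm_posPart_le (f : Wt) : ‖posPart f‖ ≤ ‖f‖ := norm_shiftOp_le _ f

lemma suppIn_eulerPrimY {f : Wt} (hf : SuppIn {n | n 1 + 1 ≤ n 0} f) :
    SuppIn {n | n 1 + 1 ≤ n 0} (eulerPrimY f) := fun n hn => by
  rw [co_eulerPrimY] at hn
  exact suppIn_primY hf n (right_ne_zero_of_mul hn)

/-- Expansion of a holomorphic function of two variables as a sum of monomials. -/
lemma exists_expansion {f : ℂ × ℂ → ℂ} (hf : AnalyticAt ℂ f 0) :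
    ∃ (ι : Type) (c : ι → ℂ) (m n : ι → ℕ) (r : ℝ), 0 < r ∧ (∀ i, 1 ≤ m i + n i) ∧
      (Summable fun i => ‖c i‖ * r ^ (m i + n i)) ∧
      ∀ x y : ℂ, ‖x‖ ≤ r → ‖y‖ ≤ r →
        HasSum (fun i => c i * (x ^ m i * y ^ n i)) (f (x, y) - f 0) := by
  classical
  obtain ⟨p, R, hp⟩ := hf
  obtain ⟨R', hR'0, hR'⟩ := ENNReal.lt_iff_exists_nnreal_btwn.1 hp.r_pos
  have hR'0 : (0 : ℝ) < R' := by exact_mod_cast hR'0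
  let v : ∀ k, Finset (Fin k) → Fin k → ℂ × ℂ := fun k S i => if i ∈ S then (1, 0) else (0, 1)
  have hv : ∀ k S i, ‖v k S i‖ ≤ 1 := fun k S i => by
    simp only [v]
    split_ifs <;> simp [Prod.norm_def]
  let C : (Σ k : ℕ, Finset (Fin (k + 1))) → ℂ := fun i => p (i.1 + 1) (v _ i.2)
  have hC : ∀ i, ‖C i‖ ≤ ‖p (i.1 + 1)‖ := fun i => by
    refine ((p (i.1 + 1)).le_opNorm _).trans (mul_le_of_le_one_right (norm_nonneg _) ?_)
    exact Finset.prod_le_one (fun _ _ => norm_nonneg _) fun j _ => hv _ _ j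
  have hsum : Summable fun i => ‖C i‖ * (R' / 2 : ℝ) ^ (i.2.card + (i.2)ᶜ.card) := by
    have hg : Summable fun i : (Σ k : ℕ, Finset (Fin (k + 1))) =>
        ‖p (i.1 + 1)‖ * (R' / 2 : ℝ) ^ (i.1 + 1) := by
      refine (summable_sigma_of_nonneg fun i => by positivity).2 ⟨fun k => ?_, ?_⟩
      · exact Summable.of_finite
      · have h0 := (summable_nat_add_iff 1).2
          (p.summable_norm_mul_pow (hR'.trans_le hp.r_le))
        refine h0.congr fun k => ?_
        rw [tsum_fintype]
        change _ = ∑ _b : Finset (Fin (k + 1)), ‖p (k + 1)‖ * (R' / 2 : ℝ) ^ (k + 1)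
        rw [Finset.sum_const, Finset.card_univ, Fintype.card_finset, Fintype.card_fin,
          nsmul_eq_mul, div_pow]
        push_cast
        field_simp
    refine hg.of_nonneg_of_le (fun i => by positivity) fun i => ?_
    rw [Finset.card_add_card_compl, Fintype.card_fin]
    exact mul_le_mul_of_nonneg_right (hC i) (by positivity)
  refine ⟨_, C, fun i => i.2.card, fun i => (i.2)ᶜ.card, R' / 2, by positivity, fun i => ?_, hsum,
    fun x y hx hy => ?_⟩
  · rw [Finset.card_add_card_compl, Fintype.card_fin]
    omega
  have hxy : ((x, y) : ℂ × ℂ) ∈ Metric.eball (0 : ℂ × ℂ) R := by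
    refine Metric.eball_subset_eball hR'.le ?_
    rw [Metric.eball_coe, mem_ball_zero_iff, Prod.norm_def]
    exact max_lt (by simp only; linarith) (by simp only; linarith)
  have h1 := hp.hasSum hxy
  rw [zero_add, ← hasSum_nat_add_iff' 1] at h1
  rw [Finset.sum_range_one, hp.coeff_zero] at h1
  refine HasSum.sigma_of_hasSum h1 (fun k => ?_) ?_
  · have h2 : p (k + 1) (fun _ => (x, y)) = ∑ S : Finset (Fin (k + 1)),
        C ⟨k, S⟩ * (x ^ S.card * y ^ Sᶜ.card) := by
      have e1 : (fun _ : Fin (k + 1) => ((x, y) : ℂ × ℂ)) =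
          (fun _ => ((x, 0) : ℂ × ℂ)) + fun _ => ((0, y) : ℂ × ℂ) := by ext <;> simp
      rw [e1]
      refine ((p (k + 1)).toMultilinearMap.map_add_univ _ _).trans (Finset.sum_congr rfl fun S _ => ?_)
      have e2 : S.piecewise (fun _ : Fin (k + 1) => ((x, 0) : ℂ × ℂ)) (fun _ => ((0, y) : ℂ × ℂ)) =
          fun i => (if i ∈ S then x else y) • v _ S i := by
        funext i
        by_cases h : i ∈ S <;> simp [Finset.piecewise, v, h]
      rw [e2, MultilinearMap.map_smul_univ, Finset.prod_ite, Finset.prod_const, Finset.prod_const,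
        smul_eq_mul, mul_comm]
      congr 3
      · congr 1; ext; simp
      · congr 1; ext; simp
    rw [h2]
    exact hasSum_fintype _
  · refine Summable.of_norm (hsum.of_nonneg_of_le (fun _ => norm_nonneg _) fun i => ?_)
    rw [norm_mul, norm_mul, norm_pow, norm_pow, pow_add]
    gcongr

/-- Families of maps on the closed unit ball which are bounded and Lipschitz with constants
of order `ε`. -/
def Tame (A : ℝ → Wt → Wt) : Prop :=
  ∃ C : ℝ, 0 ≤ C ∧ ∀ᶠ ε in nhdsWithin (0 : ℝ) (Set.Ioi 0), ∀ q q' : Wt, ‖q‖ ≤ 1 → ‖q'‖ ≤ 1 →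
    ‖A ε q‖ ≤ C * ε ∧ ‖A ε q - A ε q'‖ ≤ C * ε * ‖q - q'‖

lemma eventually_pos_lt {δ : ℝ} (hδ : 0 < δ) :
    ∀ᶠ ε in nhdsWithin (0 : ℝ) (Set.Ioi 0), 0 < ε ∧ ε < δ :=
  Ioo_mem_nhdsGT hδ

lemma eventually_mul_lt (C : ℝ) {δ : ℝ} (hδ : 0 < δ) :
    ∀ᶠ ε in nhdsWithin (0 : ℝ) (Set.Ioi 0), C * ε < δ := by
  have h : Tendsto (fun ε : ℝ => C * ε) (nhdsWithin 0 (Set.Ioi 0)) (nhds (C * 0)) :=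
    ((continuous_const.mul continuous_id).tendsto 0).mono_left nhdsWithin_le_nhds
  rw [mul_zero] at h
  exact h.eventually_lt_const hδ

namespace Tame
variable {A B : ℝ → Wt → Wt}

lemma add (hA : Tame A) (hB : Tame B) : Tame fun ε q => A ε q + B ε q := by
  obtain ⟨C, hC, hA⟩ := hA
  obtain ⟨D, hD, hB⟩ := hB
  refine ⟨C + D, add_nonneg hC hD, ?_⟩
  filter_upwards [hA, hB] with ε hA hB q q' hq hq'
  obtain ⟨a1, a2⟩ := hA q q' hq hq'
  obtain ⟨b1, b2⟩ := hB q q' hq hq'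
  constructor
  · exact (norm_add_le _ _).trans (by linarith)
  · rw [add_sub_add_comm]
    exact (norm_add_le _ _).trans (by linarith)

lemma mul (hA : Tame A) (hB : Tame B) : Tame fun ε q => A ε q * B ε q := by
  obtain ⟨C, hC, hA⟩ := hA
  obtain ⟨D, hD, hB⟩ := hB
  refine ⟨2 * (C * D), by positivity, ?_⟩
  filter_upwards [hA, hB, eventually_pos_lt one_pos] with ε hA hB hε q q' hq hq'
  obtain ⟨a1, a2⟩ := hA q q' hq hq'
  obtain ⟨b1, b2⟩ := hB q q' hq hq'
  obtain ⟨b1', -⟩ := hB q' q' hq' hq'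
  have hε0 := hε.1
  have hε1 : ε * ε ≤ ε := by nlinarith [hε.1, hε.2]
  have hCD : 0 ≤ C * D := mul_nonneg hC hD
  constructor
  · calc ‖A ε q * B ε q‖ ≤ ‖A ε q‖ * ‖B ε q‖ := norm_mul_le _ _
      _ ≤ (C * ε) * (D * ε) := by gcongr
      _ = C * D * (ε * ε) := by ring
      _ ≤ C * D * ε := by gcongr
      _ ≤ 2 * (C * D) * ε := by nlinarith [mul_nonneg hCD hε0.le]
  · have e : A ε q * B ε q - A ε q' * B ε q' =
        A ε q * (B ε q - B ε q') + (A ε q - A ε q') * B ε q' := by ring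
    rw [e]
    calc _ ≤ ‖A ε q‖ * ‖B ε q - B ε q'‖ + ‖A ε q - A ε q'‖ * ‖B ε q'‖ :=
          (norm_add_le _ _).trans <| add_le_add (norm_mul_le _ _) (norm_mul_le _ _)
      _ ≤ (C * ε) * (D * ε * ‖q - q'‖) + (C * ε * ‖q - q'‖) * (D * ε) := by gcongr
      _ = 2 * (C * D) * ‖q - q'‖ * (ε * ε) := by ring
      _ ≤ 2 * (C * D) * ‖q - q'‖ * ε := by gcongr
      _ = _ := by ring

lemma linear (hA : Tame A) {L : Wt →ₗ[ℂ] Wt} (hL : ∀ f, ‖L f‖ ≤ ‖f‖) :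
    Tame fun ε q => L (A ε q) := by
  obtain ⟨C, hC, hA⟩ := hA
  refine ⟨C, hC, ?_⟩
  filter_upwards [hA] with ε hA q q' hq hq'
  obtain ⟨a1, a2⟩ := hA q q' hq hq'
  rw [← map_sub]
  exact ⟨(hL _).trans a1, (hL _).trans a2⟩

lemma comp_linear (hA : Tame A) {L : Wt →ₗ[ℂ] Wt} (hL : ∀ f, ‖L f‖ ≤ ‖f‖) :
    Tame fun ε q => A ε (L q) := by
  obtain ⟨C, hC, hA⟩ := hA
  refine ⟨C, hC, ?_⟩
  filter_upwards [hA, eventually_pos_lt one_pos] with ε hA hε q q' hq hq'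
  obtain ⟨a1, a2⟩ := hA (L q) (L q') ((hL _).trans hq) ((hL _).trans hq')
  refine ⟨a1, a2.trans ?_⟩
  rw [← map_sub]
  have := hε.1
  gcongr
  exact hL _

lemma smul_linear {L : Wt →ₗ[ℂ] Wt} (hL : ∀ f, ‖L f‖ ≤ ‖f‖) :
    Tame fun ε q => (ε : ℂ) ^ 2 • L q := by
  refine ⟨1, zero_le_one, ?_⟩
  filter_upwards [eventually_pos_lt one_pos] with ε hε q q' hq hq'
  have hε0 := hε.1
  have hε1 : ε ^ 2 ≤ ε := by nlinarith [hε.1, hε.2]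
  have hn : ∀ f, ‖(ε : ℂ) ^ 2 • L f‖ ≤ ε * ‖f‖ := fun f => by
    rw [norm_smul, norm_pow, Complex.norm_real, Real.norm_of_nonneg hε0.le]
    exact mul_le_mul hε1 (hL f) (norm_nonneg _) hε0.le
  refine ⟨(hn q).trans ?_, ?_⟩
  · rw [one_mul]
    exact mul_le_of_le_one_right hε0.le hq
  · rw [← smul_sub, ← map_sub, one_mul]
    exact hn _

lemma of_norm_le {w : ℝ → Wt} {C : ℝ} (hC : 0 ≤ C)
    (hw : ∀ᶠ ε in nhdsWithin (0 : ℝ) (Set.Ioi 0), ‖w ε‖ ≤ C * ε) : Tame fun ε _ => w ε := by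
  refine ⟨C, hC, ?_⟩
  filter_upwards [hw, eventually_pos_lt one_pos] with ε h hε q q' _ _
  refine ⟨h, ?_⟩
  have := hε.1
  rw [sub_self, norm_zero]
  positivity

lemma eventually_norm_le (hA : Tame A) {r : ℝ} (hr : 0 < r) :
    ∀ᶠ ε in nhdsWithin (0 : ℝ) (Set.Ioi 0), ∀ q : Wt, ‖q‖ ≤ 1 → ‖A ε q‖ ≤ r := by
  obtain ⟨C, hC, hA⟩ := hA
  filter_upwards [hA, eventually_mul_lt C hr] with ε hA h q hq
  exact (hA q q hq hq).1.trans h.le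

end Tame

lemma isUnit_one_add {a : Wt} (ha : ‖a‖ ≤ 1 / 2) : IsUnit (1 + a) := by
  have := isUnit_one_sub_of_norm_lt_one (x := -a) (by rw [norm_neg]; linarith)
  rwa [sub_neg_eq_add] at this

lemma norm_inverse_one_add_le {a : Wt} (ha : ‖a‖ ≤ 1 / 2) : ‖Ring.inverse (1 + a)‖ ≤ 2 := by
  have h := Ring.mul_inverse_cancel _ (isUnit_one_add ha)
  set b := Ring.inverse (1 + a)
  have e : b = 1 - a * b := by rw [← h]; ring
  have h1 : ‖b‖ ≤ 1 + ‖a‖ * ‖b‖ := by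
    calc ‖b‖ = ‖1 - a * b‖ := by rw [← e]
      _ ≤ ‖(1 : Wt)‖ + ‖a * b‖ := norm_sub_le _ _
      _ ≤ _ := by rw [norm_one]; gcongr; exact norm_mul_le _ _
  nlinarith [norm_nonneg b]

/-- Families of the form `1 + A` with `A` tame. -/
def Near (A : ℝ → Wt → Wt) : Prop := Tame fun ε q => A ε q - 1

namespace Near
variable {A B : ℝ → Wt → Wt}

lemma one_add (hA : Tame A) : Near fun ε q => 1 + A ε q := by
  unfold Near
  simpa only [add_sub_cancel_left] using hA

lemma mul (hA : Near A) (hB : Near B) : Near fun ε q => A ε q * B ε q := by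
  have := (Tame.mul hA hB).add (Tame.add hA hB)
  unfold Near
  convert this using 3
  ring

lemma add_tame (hA : Near A) (hB : Tame B) : Near fun ε q => A ε q + B ε q := by
  have := Tame.add hA hB
  unfold Near
  convert this using 3
  ring

lemma mul_tame (hA : Near A) (hB : Tame B) : Tame fun ε q => A ε q * B ε q := by
  have := (Tame.mul hA hB).add hB
  convert this using 3
  ring

lemma eventually_isUnit (hA : Near A) :
    ∀ᶠ ε in nhdsWithin (0 : ℝ) (Set.Ioi 0), ∀ q : Wt, ‖q‖ ≤ 1 → IsUnit (A ε q) := by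
  filter_upwards [Tame.eventually_norm_le hA (by norm_num : (0 : ℝ) < 1 / 2)] with ε h q hq
  have := isUnit_one_add (h q hq)
  rwa [add_sub_cancel] at this

lemma inverse (hA : Near A) : Near fun ε q => Ring.inverse (A ε q) := by
  have hA' := hA
  obtain ⟨C, hC, hA⟩ := hA
  refine ⟨4 * C, by positivity, ?_⟩
  filter_upwards [hA, hA'.eventually_isUnit, Tame.eventually_norm_le hA' (by norm_num : (0 : ℝ) < 1 / 2),
    eventually_pos_lt one_pos] with ε hA hu hb hε q q' hq hq'
  have hε0 := hε.1
  obtain ⟨a1, a2⟩ := hA q q' hq hq'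
  have n1 := norm_inverse_one_add_le (hb q hq)
  have n2 := norm_inverse_one_add_le (hb q' hq')
  rw [add_sub_cancel] at n1 n2
  have u1 := Ring.mul_inverse_cancel _ (hu q hq)
  have u2 := Ring.mul_inverse_cancel _ (hu q' hq')
  rw [sub_sub_sub_cancel_right] at a2 ⊢
  set a := A ε q
  set a' := A ε q'
  set b := Ring.inverse a
  set b' := Ring.inverse a'
  constructor
  · have e : b - 1 = -((a - 1) * b) := by linear_combination u1
    rw [e, norm_neg]
    calc _ ≤ ‖a - 1‖ * ‖b‖ := norm_mul_le _ _
      _ ≤ C * ε * 2 := by gcongr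
      _ ≤ 4 * C * ε := by nlinarith [mul_nonneg hC hε0.le]
  · have e : b - b' = -(b * b' * (a - a')) := by linear_combination b' * u1 - b * u2
    rw [e, norm_neg]
    calc _ ≤ ‖b‖ * ‖b'‖ * ‖a - a'‖ := (norm_mul_le _ _).trans (by gcongr; exact norm_mul_le _ _)
      _ ≤ 2 * 2 * (C * ε * ‖q - q'‖) := by gcongr
      _ = _ := by ring

end Near

lemma norm_pow_mul_pow_le {a b : Wt} {ρ : ℝ} (ha : ‖a‖ ≤ ρ) (hb : ‖b‖ ≤ ρ) (m n : ℕ) :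
    ‖a ^ m * b ^ n‖ ≤ ρ ^ (m + n) := by
  have hρ := (norm_nonneg _).trans ha
  rw [pow_add]
  refine (norm_mul_le _ _).trans ?_
  gcongr
  · exact (norm_pow_le _ _).trans (by gcongr)
  · exact (norm_pow_le _ _).trans (by gcongr)

lemma norm_pow_sub_pow_le {a a' : Wt} {ρ δ : ℝ} (ha : ‖a‖ ≤ ρ) (ha' : ‖a'‖ ≤ ρ)
    (hδ : ‖a - a'‖ ≤ δ) (m : ℕ) : ρ * ‖a ^ m - a' ^ m‖ ≤ m * ρ ^ m * δ := by
  have hρ := (norm_nonneg _).trans ha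
  have hδ0 := (norm_nonneg _).trans hδ
  induction m with
  | zero => simp
  | succ m ih =>
    have e : a ^ (m + 1) - a' ^ (m + 1) = a ^ m * (a - a') + (a ^ m - a' ^ m) * a' := by ring
    rw [e]
    calc _ ≤ ρ * (‖a ^ m‖ * ‖a - a'‖ + ‖a ^ m - a' ^ m‖ * ‖a'‖) := by
          gcongr
          exact (norm_add_le _ _).trans <| add_le_add (norm_mul_le _ _) (norm_mul_le _ _)
      _ ≤ ρ * (ρ ^ m * δ + ‖a ^ m - a' ^ m‖ * ρ) := by
          gcongr
          exact (norm_pow_le _ _).trans (by gcongr)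
      _ = ρ ^ (m + 1) * δ + (ρ * ‖a ^ m - a' ^ m‖) * ρ := by ring
      _ ≤ ρ ^ (m + 1) * δ + (m * ρ ^ m * δ) * ρ := by gcongr
      _ = _ := by push_cast; ring

lemma norm_pow_mul_pow_sub_le {a a' b b' : Wt} {ρ δ : ℝ} (ha : ‖a‖ ≤ ρ) (ha' : ‖a'‖ ≤ ρ)
    (hb : ‖b‖ ≤ ρ) (hb' : ‖b'‖ ≤ ρ) (hδ : ‖a - a'‖ ≤ δ) (hδ' : ‖b - b'‖ ≤ δ) (m n : ℕ) :
    ρ * ‖a ^ m * b ^ n - a' ^ m * b' ^ n‖ ≤ (m + n : ℕ) * ρ ^ (m + n) * δ := by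
  have hρ := (norm_nonneg _).trans ha
  have h1 := norm_pow_sub_pow_le ha ha' hδ m
  have h2 := norm_pow_sub_pow_le hb hb' hδ' n
  have e : a ^ m * b ^ n - a' ^ m * b' ^ n =
    a ^ m * (b ^ n - b' ^ n) + (a ^ m - a' ^ m) * b' ^ n := by ring
  rw [e]
  calc _ ≤ ρ * (‖a ^ m‖ * ‖b ^ n - b' ^ n‖ + ‖a ^ m - a' ^ m‖ * ‖b' ^ n‖) := by
        gcongr
        exact (norm_add_le _ _).trans <| add_le_add (norm_mul_le _ _) (norm_mul_le _ _)
    _ ≤ ρ * (ρ ^ m * ‖b ^ n - b' ^ n‖ + ‖a ^ m - a' ^ m‖ * ρ ^ n) := by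
        gcongr
        · exact (norm_pow_le _ _).trans (by gcongr)
        · exact (norm_pow_le _ _).trans (by gcongr)
    _ = ρ ^ m * (ρ * ‖b ^ n - b' ^ n‖) + ρ * ‖a ^ m - a' ^ m‖ * ρ ^ n := by ring
    _ ≤ ρ ^ m * (n * ρ ^ n * δ) + m * ρ ^ m * δ * ρ ^ n := by gcongr
    _ = _ := by push_cast; ring

section
variable {ι : Type} {c : ι → ℂ} {m n : ι → ℕ} {r : ℝ}

lemma summable_norm_subst (hs : Summable fun i => ‖c i‖ * r ^ (m i + n i)) {a b : Wt}
    (ha : ‖a‖ ≤ r) (hb : ‖b‖ ≤ r) : Summable fun i => ‖c i • (a ^ m i * b ^ n i)‖ := by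
  refine hs.of_nonneg_of_le (fun _ => norm_nonneg _) fun i => ?_
  rw [norm_smul]
  exact mul_le_mul_of_nonneg_left (norm_pow_mul_pow_le ha hb _ _) (norm_nonneg _)

lemma Tame.subst {A B : ℝ → Wt → Wt} (hA : Tame A) (hB : Tame B) (hr : 0 < r)
    (hmn : ∀ i, 1 ≤ m i + n i) (hs : Summable fun i => ‖c i‖ * r ^ (m i + n i)) :
    Tame fun ε q => ∑' i, c i • (A ε q ^ m i * B ε q ^ n i) := by
  have hA' := hA
  have hB' := hB
  obtain ⟨C, hC, hA⟩ := hA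
  obtain ⟨D, hD, hB⟩ := hB
  set K := ∑' i, ‖c i‖ * r ^ (m i + n i) with hK
  have hK0 : 0 ≤ K := tsum_nonneg fun i => by positivity
  refine ⟨K * (2 / r) * (C + D), by positivity, ?_⟩
  have hr2 : 0 < r / 2 := by positivity
  filter_upwards [hA, hB, hA'.eventually_norm_le hr2, hB'.eventually_norm_le hr2,
    eventually_pos_lt one_pos, eventually_mul_lt (C + D) hr2] with ε hA hB hAr hBr hε hsm q q' hq hq'
  have hε0 := hε.1
  obtain ⟨a1, a2⟩ := hA q q' hq hq'
  obtain ⟨b1, b2⟩ := hB q q' hq hq'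
  have ha := hAr q hq
  have ha' := hAr q' hq'
  have hb := hBr q hq
  have hb' := hBr q' hq'
  have s1 := summable_norm_subst hs (ha.trans (by linarith)) (hb.trans (by linarith))
  have s2 := summable_norm_subst hs (ha'.trans (by linarith)) (hb'.trans (by linarith))
  have hCε : 0 ≤ C * ε := by positivity
  have hDε : 0 ≤ D * ε := by positivity
  constructor
  · have hle : ∀ i, ‖c i • (A ε q ^ m i * B ε q ^ n i)‖ ≤
        ‖c i‖ * r ^ (m i + n i) * ((2 / r) * ((C + D) * ε)) := fun i => by
      rw [norm_smul, mul_assoc]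
      gcongr
      have h1 := norm_pow_mul_pow_le (a1.trans (by linarith : C * ε ≤ (C + D) * ε))
        (b1.trans (by linarith : D * ε ≤ (C + D) * ε)) (m i) (n i)
      refine h1.trans ?_
      obtain ⟨k, hk⟩ := Nat.exists_eq_add_of_le (hmn i)
      rw [hk, add_comm 1 k, pow_succ, pow_succ]
      have h2 : ((C + D) * ε) ^ k ≤ r ^ k := by
        gcongr
        linarith
      have h3 : 0 ≤ (C + D) * ε := by positivity
      calc _ ≤ r ^ k * ((C + D) * ε) := by gcongr
        _ ≤ 2 * (r ^ k * ((C + D) * ε)) := by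
          have : 0 ≤ r ^ k * ((C + D) * ε) := by positivity
          linarith
        _ = _ := by field_simp
    refine (norm_tsum_le_tsum_norm s1).trans ((s1.tsum_le_tsum hle (hs.mul_right _)).trans ?_)
    rw [tsum_mul_right]
    exact (by ring : K * ((2 / r) * ((C + D) * ε)) = K * (2 / r) * (C + D) * ε).le
  · rw [← s1.of_norm.tsum_sub s2.of_norm]
    set δ := (C + D) * ε * ‖q - q'‖
    have hδ0 : 0 ≤ δ := by positivity
    have hle : ∀ i, ‖c i • (A ε q ^ m i * B ε q ^ n i) - c i • (A ε q' ^ m i * B ε q' ^ n i)‖ ≤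
        ‖c i‖ * r ^ (m i + n i) * ((2 / r) * δ) := fun i => by
      rw [← smul_sub, norm_smul, mul_assoc]
      gcongr
      have h1 := norm_pow_mul_pow_sub_le ha ha' hb hb' (δ := δ)
        (a2.trans (by simp only [δ]; gcongr; linarith))
        (b2.trans (by simp only [δ]; gcongr; linarith)) (m i) (n i)
      have h2 : ((m i + n i : ℕ) : ℝ) * (r / 2) ^ (m i + n i) ≤ r ^ (m i + n i) := by
        rw [div_pow, mul_div_assoc', div_le_iff₀ (by positivity), mul_comm]
        gcongr
        exact_mod_cast (Nat.lt_two_pow_self (n := m i + n i)).le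
      have h3 : r / 2 * ‖A ε q ^ m i * B ε q ^ n i - A ε q' ^ m i * B ε q' ^ n i‖ ≤
          r ^ (m i + n i) * δ := h1.trans (by gcongr)
      calc _ = (2 / r) * (r / 2 * ‖A ε q ^ m i * B ε q ^ n i - A ε q' ^ m i * B ε q' ^ n i‖) := by
            field_simp
        _ ≤ (2 / r) * (r ^ (m i + n i) * δ) := by gcongr
        _ = _ := by ring
    have s3 : Summable fun i =>
        ‖c i • (A ε q ^ m i * B ε q ^ n i) - c i • (A ε q' ^ m i * B ε q' ^ n i)‖ :=
      (hs.mul_right _).of_nonneg_of_le (fun _ => norm_nonneg _) hle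
    refine (norm_tsum_le_tsum_norm s3).trans ((s3.tsum_le_tsum hle (hs.mul_right _)).trans ?_)
    rw [tsum_mul_right]
    exact (by simp only [δ]; ring :
      K * ((2 / r) * δ) = K * (2 / r) * (C + D) * ε * ‖q - q'‖).le

end

lemma Tame.eventually_exists_fixedPoint {A : ℝ → Wt → Wt} (hA : Tame A) :
    ∀ᶠ ε in nhdsWithin (0 : ℝ) (Set.Ioi 0), ∃ q : Wt, ‖q‖ ≤ 1 ∧ A ε q = q := by
  have hA' := hA
  obtain ⟨C, hC, hA⟩ := hA
  filter_upwards [hA, hA'.eventually_norm_le one_pos,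
    eventually_mul_lt C (by norm_num : (0 : ℝ) < 1 / 2)] with ε hA h1 hsm
  have hmaps : Set.MapsTo (A ε) (Metric.closedBall 0 1) (Metric.closedBall 0 1) := fun q hq => by
    rw [mem_closedBall_zero_iff] at hq ⊢
    exact h1 q hq
  have hc : ContractingWith (1 / 2) (hmaps.restrict (A ε) _ _) := by
    refine ⟨by rw [← NNReal.coe_lt_coe]; norm_num, LipschitzWith.of_dist_le_mul fun q q' => ?_⟩
    have hq := mem_closedBall_zero_iff.1 q.2
    have hq' := mem_closedBall_zero_iff.1 q'.2
    rw [Subtype.dist_eq, Subtype.dist_eq, dist_eq_norm, dist_eq_norm]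
    refine ((hA q q' hq hq').2).trans ?_
    simp only [NNReal.coe_div, NNReal.coe_one, NNReal.coe_ofNat]
    gcongr
  obtain ⟨q, hq, hfix, -⟩ := ContractingWith.exists_fixedPoint' (x := (0 : Wt))
    Metric.isClosed_closedBall.isComplete hmaps hc (by simp) (edist_ne_top _ _)
  exact ⟨q, mem_closedBall_zero_iff.1 hq, hfix⟩

/-- The series `∫ q dy`. -/
noncomputable def hSer (ε : ℝ) (q : Wt) : Wt := (ε : ℂ) ^ 2 • primY q

/-- The series of `∂/∂x (x * (1 + ∫ q dy))`. -/
noncomputable def tSer (ε : ℝ) (q : Wt) : Wt := 1 + (hSer ε q + (ε : ℂ) ^ 2 • eulerPrimY q)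

/-- The series of `x * (1 + ∫ q dy)`. -/
noncomputable def thetaSer (ε : ℝ) (q : Wt) : Wt := (1 + hSer ε q) * ((ε : ℂ) • monom (pack 1 0))

/-- The series of `y`. -/
noncomputable def ySer (ε : ℝ) : Wt := (ε : ℂ) ^ 2 • monom (pack 1 1)

section
variable {ι : Type} (c : ι → ℂ) (m n : ι → ℕ)

/-- The series of `f (θ, y)`. -/
noncomputable def fSer (ε : ℝ) (q : Wt) : Wt :=
  1 + ∑' i, c i • (thetaSer ε q ^ m i * ySer ε ^ n i)

/-- The series of `(y + θ * f (θ, y)) / x`. -/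
noncomputable def kSer (ε : ℝ) (q : Wt) : Wt :=
  (1 + hSer ε q) * fSer c m n ε q + (ε : ℂ) • monom (pack 0 1)

/-- The map whose fixed point solves the normalization problem. -/
noncomputable def stepSer (ε : ℝ) (q : Wt) : Wt :=
  tSer ε q * posPart ((1 + hSer ε q) * (1 + hSer ε q) * Ring.inverse (kSer c m n ε q * tSer ε q))

end

lemma tame_hSer : Tame hSer := Tame.smul_linear norm_primY_le

lemma near_one_add_hSer : Near fun ε q => 1 + hSer ε q := Near.one_add tame_hSer

lemma near_tSer : Near tSer :=
  Near.one_add (tame_hSer.add (Tame.smul_linear norm_eulerPrimY_le))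

lemma tame_smul_monom {e : Fin 2 →₀ ℕ} (he : ‖monom e‖ = 1) :
    Tame fun ε _ => (ε : ℂ) • monom e :=
  Tame.of_norm_le zero_le_one (by
    filter_upwards [eventually_pos_lt one_pos] with ε hε
    rw [norm_smul, Complex.norm_real, Real.norm_of_nonneg hε.1.le, he, mul_one, one_mul])

lemma tame_thetaSer : Tame thetaSer :=
  near_one_add_hSer.mul_tame (tame_smul_monom norm_monom_pack_one_zero)

lemma tame_ySer : Tame fun ε _ => ySer ε := by
  have h := (tame_smul_monom norm_monom_pack_one_zero).mul (tame_smul_monom norm_monom_pack_zero_one)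
  convert h using 3 with ε q
  rw [smul_mul_smul_comm, monom_mul, pack_add, ySer, ← sq]

section
variable {ι : Type} {c : ι → ℂ} {m n : ι → ℕ} {r : ℝ} (hr : 0 < r)
    (hmn : ∀ i, 1 ≤ m i + n i) (hs : Summable fun i => ‖c i‖ * r ^ (m i + n i))
include hr hmn hs

lemma near_fSer : Near (fSer c m n) :=
  Near.one_add (tame_thetaSer.subst tame_ySer hr hmn hs)

lemma near_kSer : Near (kSer c m n) :=
  (near_one_add_hSer.mul (near_fSer hr hmn hs)).add_tame (tame_smul_monom norm_monom_pack_zero_one)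

lemma tame_stepSer : Tame (stepSer c m n) := by
  refine near_tSer.mul_tame ?_
  have h := (near_one_add_hSer.mul near_one_add_hSer).mul
    ((near_kSer hr hmn hs).mul near_tSer).inverse
  have := Tame.linear h norm_posPart_le
  convert this using 3 with ε q
  rw [map_sub, posPart_one, sub_zero]

end

lemma suppIn_hSer (ε : ℝ) {q : Wt} (hq : SuppIn {n | n 1 + 1 ≤ n 0} q) :
    SuppIn {n | n 1 + 1 ≤ n 0} (hSer ε q) := (suppIn_primY hq).smul _

lemma suppIn_one_add_hSer (ε : ℝ) {q : Wt} (hq : SuppIn {n | n 1 + 1 ≤ n 0} q) :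
    SuppIn {n | n 1 ≤ n 0} (1 + hSer ε q) :=
  (SuppIn.one (by simp)).add ((suppIn_hSer ε hq).mono fun n (hn : n 1 + 1 ≤ n 0) =>
    (Nat.le_succ _).trans hn)

lemma suppIn_tSer (ε : ℝ) {q : Wt} (hq : SuppIn {n | n 1 + 1 ≤ n 0} q) :
    SuppIn {n | n 1 ≤ n 0} (tSer ε q) :=
  (SuppIn.one (by simp)).add (((suppIn_hSer ε hq).add ((suppIn_eulerPrimY hq).smul _)).mono
    fun n (hn : n 1 + 1 ≤ n 0) => (Nat.le_succ _).trans hn)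

lemma suppIn_mul_of_le {f g : Wt} (hf : SuppIn {n | n 1 ≤ n 0} f) (hg : SuppIn {n | n 1 ≤ n 0} g) :
    SuppIn {n | n 1 ≤ n 0} (f * g) :=
  hf.mul hg fun _ ha _ hb => add_le_add (Set.mem_ofPred.1 ha) (Set.mem_ofPred.1 hb)

lemma suppIn_thetaSer (ε : ℝ) {q : Wt} (hq : SuppIn {n | n 1 + 1 ≤ n 0} q) :
    SuppIn {n | n 1 ≤ n 0} (thetaSer ε q) :=
  suppIn_mul_of_le (suppIn_one_add_hSer ε hq) (((suppIn_monom _).smul _).mono (by simp))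

lemma suppIn_kSer {ι : Type} {c : ι → ℂ} {m n : ι → ℕ} {ε : ℝ} {q : Wt}
    (hq : SuppIn {n | n 1 + 1 ≤ n 0} q)
    (hsum : Summable fun i => c i • (thetaSer ε q ^ m i * ySer ε ^ n i)) :
    SuppIn {n | n 1 ≤ n 0 + 1} (kSer c m n ε q) := by
  have hle : ∀ a ∈ {n : Fin 2 →₀ ℕ | n 1 ≤ n 0}, ∀ b ∈ {n : Fin 2 →₀ ℕ | n 1 ≤ n 0},
      a + b ∈ {n : Fin 2 →₀ ℕ | n 1 ≤ n 0} :=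
    fun a ha b hb => add_le_add (Set.mem_ofPred.1 ha) (Set.mem_ofPred.1 hb)
  have h0 : (0 : Fin 2 →₀ ℕ) ∈ {n : Fin 2 →₀ ℕ | n 1 ≤ n 0} := le_refl 0
  have hy : SuppIn {n | n 1 ≤ n 0} (ySer ε) := ((suppIn_monom _).smul _).mono (by simp)
  have hf : SuppIn {n | n 1 ≤ n 0} (fSer c m n ε q) :=
    (SuppIn.one h0).add (SuppIn.tsum hsum fun i => ((suppIn_mul_of_le
      ((suppIn_thetaSer ε hq).pow h0 hle _) (hy.pow h0 hle _)).smul _))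
  exact ((suppIn_mul_of_le (suppIn_one_add_hSer ε hq) hf).mono fun n (hn : n 1 ≤ n 0) =>
    hn.trans (Nat.le_succ _)).add (((suppIn_monom _).smul _).mono fun n hn => by
      rw [Set.mem_singleton_iff.1 hn]
      change pack 0 1 1 ≤ pack 0 1 0 + 1
      simp)

lemma exists_series_solution {ι : Type} {c : ι → ℂ} {m n : ι → ℕ} {r : ℝ} (hr : 0 < r)
    (hmn : ∀ i, 1 ≤ m i + n i) (hs : Summable fun i => ‖c i‖ * r ^ (m i + n i)) :
    ∃ (ε : ℝ) (q M : Wt), 0 < ε ∧ ε ≤ 1 ∧ SuppIn {n | n 1 + 1 ≤ n 0} q ∧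
      ‖thetaSer ε q‖ ≤ r ∧ ‖ySer ε‖ ≤ r ∧ SuppIn {n | n 0 ≤ n 1 ∧ n 1 ≤ n 0 + 1} M ∧
      M * ((1 + hSer ε q) * (1 + hSer ε q) - q * kSer c m n ε q) =
        tSer ε q * kSer c m n ε q := by
  have hstep := tame_stepSer hr hmn hs
  have hden : Near fun ε q => (1 + hSer ε q) * (1 + hSer ε q) -
      stepSer c m n ε q * kSer c m n ε q := by
    have h1 := (near_kSer hr hmn hs).mul_tame hstep
    have h2 : Tame fun ε q => -(kSer c m n ε q * stepSer c m n ε q) := by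
      have := h1.linear (L := -LinearMap.id) fun f => by simp
      simpa using this
    convert (near_one_add_hSer.mul near_one_add_hSer).add_tame h2 using 3
    ring
  obtain ⟨ε, ⟨q, hq1, hfix⟩, hθ, hy, hkt, hD, hε⟩ :=
    ((hstep.comp_linear norm_posPart_le).eventually_exists_fixedPoint.and
      ((tame_thetaSer.eventually_norm_le hr).and ((tame_ySer.eventually_norm_le hr).and
        (((near_kSer hr hmn hs).mul near_tSer).eventually_isUnit.and
          (hden.eventually_isUnit.and (eventually_pos_lt one_pos)))))).exists
  have hsuppP := suppIn_posPart q
  have hq : SuppIn {n | n 1 + 1 ≤ n 0} q := by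
    rw [← hfix]
    exact (suppIn_tSer ε hsuppP).mul (suppIn_posPart _) fun a ha b hb => by
      have ha : a 1 ≤ a 0 := ha
      have hb : b 1 + 1 ≤ b 0 := hb
      change a 1 + b 1 + 1 ≤ a 0 + b 0
      omega
  rw [posPart_eq_self hq] at hfix
  have hθ := hθ q hq1
  have hy := hy q hq1
  have hkt := Ring.mul_inverse_cancel _ (hkt q hq1)
  have hD := hD q hq1
  simp only [hfix] at hD
  have hsum := (summable_norm_subst hs hθ hy).of_norm
  have hk := suppIn_kSer hq hsum
  have hh := suppIn_one_add_hSer ε hq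
  have ht := suppIn_tSer ε hq
  have hDi := Ring.mul_inverse_cancel _ hD
  rw [stepSer] at hfix
  set h := 1 + hSer ε q
  set k := kSer c m n ε q
  set t := tSer ε q
  set w := h * h * Ring.inverse (k * t)
  set D := h * h - q * k
  set E := Ring.inverse D
  have hNk : (w - posPart w) * (k * t) = D := by
    have : w * (k * t) = h * h := by
      simp only [w]
      linear_combination (h * h) * hkt
    simp only [D]
    linear_combination this - k * hfix
  have hNM : (w - posPart w) * (t * k * E) = 1 := by
    linear_combination E * hNk + hDi
  have hDsupp : SuppIn {n | n 1 ≤ n 0} D :=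
    (suppIn_mul_of_le hh hh).sub (hq.mul hk fun a ha b hb => by
      have ha : a 1 + 1 ≤ a 0 := ha
      have hb : b 1 ≤ b 0 + 1 := hb
      change a 1 + b 1 ≤ a 0 + b 0
      omega)
  have hE : SuppIn {n | n 1 ≤ n 0} E := hDsupp.of_mul_eq_one
    (fun a ha b hb => add_le_add (Set.mem_ofPred.1 ha) (Set.mem_ofPred.1 hb)) (le_refl 0) hDi
  have hM1 : SuppIn {n | n 0 ≤ n 1} (t * k * E) := (suppIn_sub_posPart w).of_mul_eq_one
    (fun a ha b hb => add_le_add (Set.mem_ofPred.1 ha) (Set.mem_ofPred.1 hb)) (le_refl 0) hNM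
  have hM2 : SuppIn {n | n 1 ≤ n 0 + 1} (t * k * E) := by
    rw [mul_right_comm]
    exact (suppIn_mul_of_le ht hE).mul hk fun a ha b hb => by
      have ha : a 1 ≤ a 0 := ha
      have hb : b 1 ≤ b 0 + 1 := hb
      change a 1 + b 1 ≤ a 0 + b 0 + 1
      omega
  refine ⟨ε, q, t * k * E, hε.1, hε.2.le, hq, hθ, hy, fun n hn => ⟨hM1 n hn, hM2 n hn⟩, ?_⟩
  linear_combination t * k * hDi

lemma analyticAt_tsum_pow {d : ℕ → ℂ} {C A : ℝ} (hA : 0 < A) (hd : ∀ j, ‖d j‖ ≤ C * A ^ j) :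
    AnalyticAt ℂ (fun y : ℂ => ∑' j, d j * y ^ j) 0 := by
  have hC : 0 ≤ C := by simpa using (norm_nonneg _).trans (hd 0)
  let e : ℕ × ℕ → ℂ := fun n => if n.1 = 0 then d n.2 else 0
  have he : ∀ n, ‖e n‖ ≤ C * A ^ (n.1 + n.2) := by
    rintro ⟨i, j⟩
    by_cases hi : i = 0
    · subst hi
      simpa [e] using hd j
    · simp only [e, hi, if_false, norm_zero]
      positivity
  have h := dser_analyticAt hA he (p := 0) (by rw [norm_zero]; positivity)
  have h2 : AnalyticAt ℂ (fun y : ℂ => dser e (0, y)) 0 :=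
    h.comp_of_eq (f := fun y : ℂ => ((0 : ℂ), y)) (analyticAt_const.prod analyticAt_id) rfl
  refine h2.congr (Eventually.of_forall fun y => ?_)
  have hinj : Function.Injective fun j : ℕ => ((0 : ℕ), j) := fun _ _ h => (Prod.ext_iff.1 h).2
  simp only [dser]
  rw [← hinj.tsum_eq]
  · simp [e]
  · rintro ⟨i, j⟩ hij
    by_cases hi : i = 0
    · exact ⟨j, by simp [hi]⟩
    · exact absurd (by simp [e, hi]) hij

lemma dser_eq_add {c : ℕ × ℕ → ℂ} {C A : ℝ} (hA : 0 < A)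
    (hc : ∀ n, ‖c n‖ ≤ C * A ^ (n.1 + n.2)) (h2 : ∀ n : ℕ × ℕ, 2 ≤ n.1 → c n = 0) {p : ℂ × ℂ}
    (hp : ‖p‖ < A⁻¹) :
    dser c p = ∑' j, c (0, j) * p.2 ^ j + (∑' j, c (1, j) * p.2 ^ j) * p.1 := by
  have hs := dser_summable hA hc hp
  rw [dser, hs.tsum_prod, tsum_eq_sum (s := Finset.range 2)]
  · rw [Finset.sum_range_succ, Finset.sum_range_one, ← tsum_mul_right]
    congr 1
    · simp
    · refine tsum_congr fun j => ?_
      simp only [pow_one]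
      ring
  · intro i hi
    have hi : 2 ≤ i := not_lt.1 fun h => hi (Finset.mem_range.2 h)
    simp [h2 (i, _) hi]

/-- Points `(x, y)` at which the variables `x / ε` and `y / (ε * x)` are small and nonzero. -/
def sector (ε : ℝ) : Set (ℂ × ℂ) :=
  {p | p.1 ≠ 0 ∧ p.2 ≠ 0 ∧ ‖p.1‖ < ε / 2 ∧ ‖p.2‖ < ε / 2 * ‖p.1‖}

lemma isOpen_sector (ε : ℝ) : IsOpen (sector ε) :=
  (isOpen_ne_fun continuous_fst continuous_const).inter
    ((isOpen_ne_fun continuous_snd continuous_const).inter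
      ((isOpen_lt continuous_fst.norm continuous_const).inter
        (isOpen_lt continuous_snd.norm (continuous_const.mul continuous_fst.norm))))

lemma norm_fst_div_le {ε : ℝ} (hε : 0 < ε) {p : ℂ × ℂ} (hp : p ∈ sector ε) :
    ‖p.1 / ε‖ ≤ 1 / 2 := by
  rw [norm_div, Complex.norm_real, Real.norm_of_nonneg hε.le, div_le_iff₀ hε]
  linarith [hp.2.2.1]

lemma norm_snd_div_le {ε : ℝ} (hε : 0 < ε) {p : ℂ × ℂ} (hp : p ∈ sector ε) :
    ‖p.2 / (ε * p.1)‖ ≤ 1 / 2 := by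
  have h1 : 0 < ‖p.1‖ := norm_pos_iff.2 hp.1
  rw [norm_div, norm_mul, Complex.norm_real, Real.norm_of_nonneg hε.le,
    div_le_iff₀ (by positivity)]
  linarith [hp.2.2.2]

lemma hasDerivAt_ev_snd {ε : ℝ} (hε : 0 < ε) (q : Wt) {x y : ℂ} (hp : (x, y) ∈ sector ε) :
    HasDerivAt (fun y => ev (x / ε) (y / (ε * x)) (hSer ε q)) (ev (x / ε) (y / (ε * x)) q) y := by
  have hε' : (ε : ℂ) ≠ 0 := by exact_mod_cast hε.ne'
  have hU : IsOpen {y : ℂ | (x, y) ∈ sector ε} :=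
    (isOpen_sector ε).preimage (continuous_const.prodMk continuous_id)
  have h := hasDerivAt_ev hU (X := fun _ => x / ε) (S := fun y => y / (ε * x)) (α := 0) (β := 1)
    (f := hSer ε q) (g := ySer ε * q) (fun y hy => norm_fst_div_le hε hy)
    (fun y hy => norm_snd_div_le hε hy)
    (fun y _ => (hasDerivAt_const y (x / (ε : ℂ))).congr_deriv (by simp))
    (fun y hy => ((hasDerivAt_id y).div_const _).congr_deriv (by
      have h2 : y ≠ 0 := hy.2.1
      have h1 : x ≠ 0 := hy.1
      field_simp))
    (fun n => by
      rw [ySer, smul_mul_assoc, map_smul, co_monom_mul_eq_primY, hSer, map_smul, smul_eq_mul,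
        smul_eq_mul]
      ring) hp
  refine h.congr_deriv ?_
  have h1 : x ≠ 0 := hp.1
  have h2 : y ≠ 0 := hp.2.1
  rw [ev_mul (norm_fst_div_le hε hp) (norm_snd_div_le hε hp), ySer, ev_smul, ev_monom, pack_zero,
    pack_one]
  field_simp

lemma hasDerivAt_ev_fst {ε : ℝ} (hε : 0 < ε) (q : Wt) {x y : ℂ} (hp : (x, y) ∈ sector ε) :
    HasDerivAt (fun x => ev (x / ε) (y / (ε * x)) (hSer ε q))
      (ev (x / ε) (y / (ε * x)) ((ε : ℂ) ^ 2 • eulerPrimY q) / x) x := by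
  have hε' : (ε : ℂ) ≠ 0 := by exact_mod_cast hε.ne'
  have hU : IsOpen {x : ℂ | (x, y) ∈ sector ε} :=
    (isOpen_sector ε).preimage (continuous_id.prodMk continuous_const)
  exact hasDerivAt_ev hU (X := fun x => x / ε) (S := fun x => y / (ε * x)) (α := 1) (β := -1)
    (f := hSer ε q) (g := (ε : ℂ) ^ 2 • eulerPrimY q) (fun x hx => norm_fst_div_le hε hx)
    (fun x hx => norm_snd_div_le hε hx)
    (fun x hx => ((hasDerivAt_id x).div_const _).congr_deriv (by
      have h1 : x ≠ 0 := hx.1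
      field_simp))
    (fun x hx => by
      have h1 : x ≠ 0 := hx.1
      refine (((hasDerivAt_id x).const_mul (ε : ℂ)).fun_inv (by
        simpa using ⟨hε.ne', h1⟩) |>.const_mul y).congr_deriv ?_
      simp only [id]
      field_simp)
    (fun n => by
      rw [map_smul, co_eulerPrimY, hSer, map_smul, smul_eq_mul, smul_eq_mul]
      ring) hp

lemma exists_mem_sector {ε δ : ℝ} (hε : 0 < ε) (hδ : 0 < δ) :
    ∃ p ∈ sector ε, p ∈ Metric.ball (0 : ℂ × ℂ) δ := by
  set a := min (min (ε / 4) (δ / 2)) 1 with ha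
  have ha0 : 0 < a := by positivity
  have ha1 : a ≤ ε / 4 := (min_le_left _ _).trans (min_le_left _ _)
  have ha2 : a ≤ δ / 2 := (min_le_left _ _).trans (min_le_right _ _)
  have ha3 : a ≤ 1 := min_le_right _ _
  have hb : a * a ≤ a := by nlinarith
  have n1 : ‖(a : ℂ)‖ = a := by rw [Complex.norm_real, Real.norm_of_nonneg ha0.le]
  have n2 : ‖((a * a : ℝ) : ℂ)‖ = a * a := by
    rw [Complex.norm_real, Real.norm_of_nonneg (by positivity)]
  refine ⟨((a : ℂ), ((a * a : ℝ) : ℂ)), ⟨?_, ?_, ?_, ?_⟩, ?_⟩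
  · exact Complex.ofReal_ne_zero.2 ha0.ne'
  · exact Complex.ofReal_ne_zero.2 (mul_pos ha0 ha0).ne'
  · simp only [n1]; linarith
  · simp only [n1, n2]; nlinarith
  · rw [mem_ball_zero_iff, Prod.norm_def]
    simp only [n1, n2]
    exact max_lt (by linarith) (by linarith)

/-- The normalization of the vector field, before integrating the `y`-component. -/
theorem exists_reduction {f : ℂ × ℂ → ℂ} (hf : AnalyticAt ℂ f 0) (hf1 : f 0 = 1) :
    ∃ (h : ℂ × ℂ → ℂ) (a b : ℂ → ℂ), AnalyticAt ℂ h 0 ∧ AnalyticAt ℂ a 0 ∧ AnalyticAt ℂ b 0 ∧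
      ∀ᶠ p : ℂ × ℂ in nhds 0,
        (1 + 2 * p.1 * h p + p.1 ^ 2 * fderiv ℂ h p (1, 0)) *
            (p.2 + (p.1 + p.1 ^ 2 * h p) * f (p.1 + p.1 ^ 2 * h p, p.2)) =
          (a p.2 + b p.2 * p.1) * ((1 + p.1 * h p) ^ 2 - fderiv ℂ h p (0, 1) *
            (p.2 + (p.1 + p.1 ^ 2 * h p) * f (p.1 + p.1 ^ 2 * h p, p.2))) := by
  obtain ⟨ι, c, m, n, r, hr, hmn, hs, hexp⟩ := exists_expansion hf
  obtain ⟨ε, q, M, hε, hε1, hq, hθr, hyr, hM, hmain⟩ := exists_series_solution hr hmn hs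
  have hε' : (ε : ℂ) ≠ 0 := by exact_mod_cast hε.ne'
  set h : ℂ × ℂ → ℂ := fun p => (ε : ℂ)⁻¹ * dser (blowDown ε 1 0 (hSer ε q)) p with hh
  set XM : Wt := ((ε : ℂ) • monom (pack 1 0)) * M with hXM
  set cM := blowDown ε 0 0 XM with hcM
  set R : ℝ := (2 * (2 / ε) ^ 2)⁻¹ with hR
  have hR0 : 0 < R := by positivity
  have hA : 0 < (2 / ε) ^ 2 := by positivity
  have hcMle : ∀ n, ‖cM n‖ ≤ ‖XM‖ * 2 ^ (0 + 0) * ((2 / ε) ^ 2) ^ (n.1 + n.2) :=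
    norm_blowDown_le hε hε1 0 0 XM
  have hhan : AnalyticOnNhd ℂ h (Metric.ball 0 R) :=
    analyticOnNhd_const.mul (exists_ball_blowDown hε hε1 1 0 (hSer ε q))
  have hevh : ∀ x y : ℂ, x ≠ 0 → ev (x / ε) (y / (ε * x)) (hSer ε q) = x * h (x, y) := by
    intro x y hx
    rw [ev_eq_dser hε (d0 := 1) (d1 := 0) _ hx, hh]
    · simp only [pow_one, pow_zero]
      ring
    · refine (suppIn_hSer ε hq).mono fun k (hk : k 1 + 1 ≤ k 0) =>
        ⟨(k 0 - (k 1 + 1), k 1), exponent_ext ?_ ?_⟩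
      · simp only [pack_zero]; omega
      · simp
  have hXMsupp : SuppIn {k | k 1 ≤ k 0 ∧ k 0 ≤ k 1 + 1} XM :=
    ((suppIn_monom _).smul _).mul hM fun a ha b hb => by
      rw [Set.mem_singleton_iff.1 ha]
      have hb : b 0 ≤ b 1 ∧ b 1 ≤ b 0 + 1 := hb
      change pack 1 0 1 + b 1 ≤ pack 1 0 0 + b 0 ∧ pack 1 0 0 + b 0 ≤ pack 1 0 1 + b 1 + 1
      rw [pack_zero, pack_one]
      omega
  have hcM2 : ∀ k : ℕ × ℕ, 2 ≤ k.1 → cM k = 0 := by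
    intro k hk
    rw [hcM, blowDown]
    by_contra hne
    have h1 := hXMsupp _ (left_ne_zero_of_mul hne)
    have h1 : pack (k.1 + k.2 + 0) (k.2 + 0) 1 ≤ pack (k.1 + k.2 + 0) (k.2 + 0) 0 ∧
      pack (k.1 + k.2 + 0) (k.2 + 0) 0 ≤ pack (k.1 + k.2 + 0) (k.2 + 0) 1 + 1 := h1
    rw [pack_zero, pack_one] at h1
    omega
  have hXMev : ∀ x y : ℂ, x ≠ 0 → ev (x / ε) (y / (ε * x)) XM = dser cM (x, y) := by
    intro x y hx
    rw [ev_eq_dser hε (d0 := 0) (d1 := 0) _ hx]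
    · simp [hcM]
    · refine hXMsupp.mono fun k hk => ⟨(k 0 - k 1, k 1), exponent_ext ?_ ?_⟩
      · have hk : k 1 ≤ k 0 ∧ k 0 ≤ k 1 + 1 := hk
        simp only [pack_zero]; omega
      · simp
  set a : ℂ → ℂ := fun y => ∑' j, cM (0, j) * y ^ j with ha
  set b : ℂ → ℂ := fun y => ∑' j, cM (1, j) * y ^ j with hb
  have haan : AnalyticAt ℂ a 0 := analyticAt_tsum_pow hA fun j => by
    simpa using hcMle (0, j)
  have hban : AnalyticAt ℂ b 0 :=
    analyticAt_tsum_pow (C := ‖XM‖ * (2 / ε) ^ 2) hA fun j => (hcMle (1, j)).trans_eq (by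
      simp only [add_zero, pow_zero, mul_one, pow_add, pow_one]; ring)
  have hh0 : AnalyticAt ℂ h 0 := hhan 0 (Metric.mem_ball_self hR0)
  refine ⟨h, a, b, hh0, haan, hban, ?_⟩
  have hsector : ∀ p ∈ sector ε ∩ Metric.ball 0 R,
      (1 + 2 * p.1 * h p + p.1 ^ 2 * fderiv ℂ h p (1, 0)) *
            (p.2 + (p.1 + p.1 ^ 2 * h p) * f (p.1 + p.1 ^ 2 * h p, p.2)) =
          (a p.2 + b p.2 * p.1) * ((1 + p.1 * h p) ^ 2 - fderiv ℂ h p (0, 1) *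
            (p.2 + (p.1 + p.1 ^ 2 * h p) * f (p.1 + p.1 ^ 2 * h p, p.2))) := by
    rintro ⟨x, y⟩ ⟨hp, hpR⟩
    have hx : x ≠ 0 := hp.1
    have hdh : HasFDerivAt h (fderiv ℂ h (x, y)) (x, y) := (hhan _ hpR).differentiableAt.hasFDerivAt
    have hd1 : HasDerivAt (fun x => h (x, y)) (fderiv ℂ h (x, y) (1, 0)) x :=
      HasFDerivAt.comp_hasDerivAt (l := h) (f := fun x => (x, y)) x hdh ((hasDerivAt_id x).prodMk (hasDerivAt_const x y))
    have hd2 : HasDerivAt (fun y => h (x, y)) (fderiv ℂ h (x, y) (0, 1)) y :=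
      HasFDerivAt.comp_hasDerivAt (l := h) (f := fun y => (x, y)) y hdh ((hasDerivAt_const y x).prodMk (hasDerivAt_id y))
    have hx1 := norm_fst_div_le hε hp
    have hs1 := norm_snd_div_le hε hp
    simp only at hx1 hs1
    have eq1 : ev (x / ε) (y / (ε * x)) q = x * fderiv ℂ h (x, y) (0, 1) := by
      refine (hasDerivAt_ev_snd hε q hp).unique ?_
      simp_rw [hevh x _ hx]
      exact hd2.const_mul x
    have eq2 : ev (x / ε) (y / (ε * x)) ((ε : ℂ) ^ 2 • eulerPrimY q) =
        x * h (x, y) + x ^ 2 * fderiv ℂ h (x, y) (1, 0) := by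
      have h1 := (hasDerivAt_ev_fst hε q hp).unique
        (((hasDerivAt_id x).mul hd1).congr_of_eventuallyEq (by
          filter_upwards [isOpen_ne.mem_nhds hx] with z hz
          exact hevh z y hz))
      rw [div_eq_iff hx] at h1
      rw [h1]
      simp only [id]
      ring
    have eq3 : ev (x / ε) (y / (ε * x)) XM = a y + b y * x := by
      rw [hXMev x y hx, dser_eq_add hA hcMle hcM2]
      have : ‖((x, y) : ℂ × ℂ)‖ < R := by simpa using hpR
      refine this.trans_le ?_
      rw [hR]
      exact inv_anti₀ hA (by linarith)
    let Ev := evHom hx1 hs1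
    have e1 : Ev (hSer ε q) = x * h (x, y) := hevh x y hx
    have et : Ev (tSer ε q) = 1 + 2 * x * h (x, y) + x ^ 2 * fderiv ℂ h (x, y) (1, 0) := by
      rw [tSer, map_add, map_add, map_one, e1]
      have : Ev ((ε : ℂ) ^ 2 • eulerPrimY q) = _ := eq2
      rw [this]
      ring
    have emx : Ev ((ε : ℂ) • monom (pack 1 0)) = x := by
      change ev _ _ _ = _
      rw [ev_smul, ev_monom, pack_zero, pack_one]
      field_simp
    have ems : Ev ((ε : ℂ) • monom (pack 0 1)) = y / x := by
      change ev _ _ _ = _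
      rw [ev_smul, ev_monom, pack_zero, pack_one]
      field_simp
    have eθ : Ev (thetaSer ε q) = x + x ^ 2 * h (x, y) := by
      rw [thetaSer, map_mul, map_add, map_one, e1, emx]
      ring
    have ey : Ev (ySer ε) = y := by
      change ev _ _ _ = _
      rw [ySer, ev_smul, ev_monom, pack_zero, pack_one]
      field_simp
    have ef : Ev (fSer c m n ε q) = f (x + x ^ 2 * h (x, y), y) := by
      have h1 : HasSum (fun i => c i * ((x + x ^ 2 * h (x, y)) ^ m i * y ^ n i))
          (Ev (∑' i, c i • (thetaSer ε q ^ m i * ySer ε ^ n i))) := by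
        have := (summable_norm_subst hs hθr hyr).of_norm.hasSum.map Ev (continuous_evHom hx1 hs1)
        refine this.congr_fun fun i => ?_
        simp only [Function.comp_apply, map_smul, map_mul, map_pow, eθ, ey, smul_eq_mul]
      have h2 := hexp (x + x ^ 2 * h (x, y)) y (by
        rw [← eθ]; exact (norm_ev_le hx1 hs1 _).trans hθr) (by
        rw [← ey]; exact (norm_ev_le hx1 hs1 _).trans hyr)
      rw [fSer, map_add, map_one, h1.unique h2, hf1]
      ring
    have ek : x * Ev (kSer c m n ε q) =
        y + (x + x ^ 2 * h (x, y)) * f (x + x ^ 2 * h (x, y), y) := by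
      rw [kSer, map_add, map_mul, map_add, map_one, e1, ef, ems]
      field_simp
      ring
    have eM : x * Ev M = a y + b y * x := by
      have : Ev XM = _ := eq3
      rw [← this, hXM, map_mul, emx]
    have eq : Ev q = x * fderiv ℂ h (x, y) (0, 1) := eq1
    have key := congrArg Ev hmain
    rw [map_mul, map_mul, map_sub, map_mul, map_mul, map_add, map_one, e1, eq, et] at key
    simp only
    rw [← ek, ← eM]
    linear_combination -x * key
  have hθan : AnalyticAt ℂ (fun p : ℂ × ℂ => p.1 + p.1 ^ 2 * h p) 0 :=
    analyticAt_fst.add ((analyticAt_fst.pow 2).mul hh0)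
  have hℓ : AnalyticAt ℂ (fun p : ℂ × ℂ =>
      p.2 + (p.1 + p.1 ^ 2 * h p) * f (p.1 + p.1 ^ 2 * h p, p.2)) 0 :=
    analyticAt_snd.add (hθan.mul (hf.comp_of_eq (hθan.prod analyticAt_snd) (by simp)))
  have ha2 : AnalyticAt ℂ (fun p : ℂ × ℂ => a p.2) 0 := haan.comp_of_eq analyticAt_snd rfl
  have hb2 : AnalyticAt ℂ (fun p : ℂ × ℂ => b p.2) 0 := hban.comp_of_eq analyticAt_snd rfl
  have hfd : ∀ v, AnalyticAt ℂ (fun p : ℂ × ℂ => fderiv ℂ h p v) 0 := fun v =>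
    ((ContinuousLinearMap.apply ℂ ℂ v).analyticAt _).comp hh0.fderiv
  have hL := (((analyticAt_const (v := (1 : ℂ))).add
    (((analyticAt_const (v := (2 : ℂ))).mul analyticAt_fst).mul hh0)).add
      ((analyticAt_fst.pow 2).mul (hfd (1, 0)))).mul hℓ
  have hRR := (ha2.add (hb2.mul analyticAt_fst)).mul
    ((((analyticAt_const (v := (1 : ℂ))).add (analyticAt_fst.mul hh0)).pow 2).sub
      ((hfd (0, 1)).mul hℓ))
  obtain ⟨δ1, hδ1, hL⟩ := hL.exists_ball_analyticOnNhd
  obtain ⟨δ2, hδ2, hRR⟩ := hRR.exists_ball_analyticOnNhd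
  set δ := min (min δ1 δ2) R with hδ
  have hδ0 : 0 < δ := by positivity
  obtain ⟨p0, hp0, hp0δ⟩ := exists_mem_sector hε hδ0
  have hev := AnalyticOnNhd.eqOn_of_preconnected_of_eventuallyEq
    (hL.mono (Metric.ball_subset_ball ((min_le_left _ _).trans (min_le_left _ _))))
    (hRR.mono (Metric.ball_subset_ball ((min_le_left _ _).trans (min_le_right _ _))))
    (convex_ball (0 : ℂ × ℂ) δ).isPreconnected hp0δ (by
      filter_upwards [(isOpen_sector ε).mem_nhds hp0, Metric.isOpen_ball.mem_nhds hp0δ] with p h1 h2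
      exact hsector p ⟨h1, Metric.ball_subset_ball (min_le_right _ _) h2⟩)
  filter_upwards [Metric.ball_mem_nhds _ hδ0] with p hp
  exact hev hp

lemma foliationEquiv_symm {X X' : ℂ × ℂ → ℂ × ℂ} (h : FoliationEquiv X X') :
    FoliationEquiv X' X := by
  obtain ⟨Φ, u, hΦ, h0, hdet, hu, hu0, heq⟩ := h
  let i := (fderiv ℂ Φ 0).toContinuousLinearEquivOfDetNeZero hdet
  have hi : (i : ℂ × ℂ →L[ℂ] ℂ × ℂ) = fderiv ℂ Φ 0 :=
    ContinuousLinearMap.coe_toContinuousLinearEquivOfDetNeZero _ _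
  have hs : HasStrictFDerivAt Φ (i : ℂ × ℂ →L[ℂ] ℂ × ℂ) 0 := hi ▸ hΦ.hasStrictFDerivAt
  let R := hs.toOpenPartialHomeomorph Φ
  have hR : (0 : ℂ × ℂ) ∈ R.source := hs.mem_toOpenPartialHomeomorph_source
  have hΨ : AnalyticAt ℂ R.symm (R 0) := R.analyticAt_symm' (i := i) hR hΦ hi.symm
  have hR0 : R 0 = 0 := h0
  have hleft : ∀ᶠ p in nhds 0, R.symm (Φ p) = p := R.eventually_left_inverse hR
  have hright : ∀ᶠ q in nhds 0, Φ (R.symm q) = q := by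
    have := R.eventually_right_inverse (R.map_source hR)
    rwa [hR0] at this
  rw [hR0] at hΨ
  have hΨ0 : R.symm 0 = 0 := by
    have := hleft.self_of_nhds
    rwa [h0] at this
  have htΦ : Tendsto Φ (nhds 0) (nhds 0) := by
    have := hΦ.continuousAt.tendsto
    rwa [h0] at this
  have htΨ : Tendsto R.symm (nhds 0) (nhds 0) := by
    have := hΨ.continuousAt.tendsto
    rwa [hΨ0] at this
  have hchain : ∀ᶠ p in nhds 0, (fderiv ℂ R.symm (Φ p)).comp (fderiv ℂ Φ p) = .id ℂ (ℂ × ℂ) := by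
    filter_upwards [hleft.eventually_nhds, hΦ.eventually_analyticAt,
      htΦ.eventually hΨ.eventually_analyticAt] with p hp h1 h2
    rw [← fderiv_comp p h2.differentiableAt h1.differentiableAt, ← fderiv_id (x := p)]
    exact EventuallyEq.fderiv_eq hp
  refine ⟨R.symm, fun q => (u (R.symm q))⁻¹, hΨ, hΨ0, ?_, ?_, ?_, ?_⟩
  · have h1 := congrArg (fun A : ℂ × ℂ →L[ℂ] ℂ × ℂ => LinearMap.det A.toLinearMap)
      hchain.self_of_nhds
    simp only [h0, ContinuousLinearMap.toLinearMap_comp, LinearMap.det_comp,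
      ContinuousLinearMap.coe_id, LinearMap.det_id] at h1
    exact left_ne_zero_of_mul_eq_one h1
  · exact AnalyticAt.inv (hu.comp_of_eq hΨ hΨ0) (by rwa [hΨ0])
  · simpa [hΨ0] using hu0
  · filter_upwards [htΨ.eventually hchain, htΨ.eventually heq, hright,
      htΨ.eventually (hu.continuousAt.eventually_ne hu0)] with q h1 h2 h3 h4
    have h5 := congrArg (fderiv ℂ R.symm q) h2
    rw [h3] at h1 h5
    rw [← ContinuousLinearMap.comp_apply, h1, map_smul] at h5
    rw [eq_inv_smul_iff₀ h4, ← h5]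
    rfl

lemma foliationEquiv_trans {X X' X'' : ℂ × ℂ → ℂ × ℂ} (h : FoliationEquiv X X')
    (h' : FoliationEquiv X' X'') : FoliationEquiv X X'' := by
  obtain ⟨Φ, u, hΦ, h0, hdet, hu, hu0, heq⟩ := h
  obtain ⟨Ψ, v, hΨ, h0', hdet', hv, hv0, heq'⟩ := h'
  have htΦ : Tendsto Φ (nhds 0) (nhds 0) := by
    have := hΦ.continuousAt.tendsto
    rwa [h0] at this
  have hΨ' : AnalyticAt ℂ Ψ (Φ 0) := by rwa [h0]
  refine ⟨Ψ ∘ Φ, fun p => u p * v (Φ p), hΨ.comp_of_eq hΦ h0, by simp [h0, h0'], ?_,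
    hu.mul (hv.comp_of_eq hΦ h0), by simp [h0, hu0, hv0], ?_⟩
  · rw [fderiv_comp 0 hΨ'.differentiableAt hΦ.differentiableAt, h0,
      ContinuousLinearMap.toLinearMap_comp, LinearMap.det_comp]
    exact mul_ne_zero hdet' hdet
  · filter_upwards [heq, htΦ.eventually heq', hΦ.eventually_analyticAt,
      htΦ.eventually hΨ.eventually_analyticAt] with p h1 h2 h3 h4
    rw [fderiv_comp p h4.differentiableAt h3.differentiableAt, ContinuousLinearMap.comp_apply, h1,
      map_smul, h2, smul_smul]
    rfl

lemma det_ne_zero_of_apply {A : ℂ × ℂ →L[ℂ] ℂ × ℂ} {s t c : ℂ} (hs : s ≠ 0) (ht : t ≠ 0)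
    (h1 : A (1, 0) = (s, c)) (h2 : A (0, 1) = (0, t)) : LinearMap.det A.toLinearMap ≠ 0 := by
  intro h
  obtain ⟨v, hv, hv0⟩ := Submodule.exists_mem_ne_zero_of_ne_bot
    (LinearMap.bot_lt_ker_of_det_eq_zero h).ne'
  have hv' : A v = 0 := hv
  have hvs : v = v.1 • (1, 0) + v.2 • (0, 1) := by ext <;> simp
  rw [hvs, map_add, map_smul, map_smul, h1, h2] at hv'
  have e1 : v.1 = 0 := by simpa [hs] using congrArg Prod.fst hv'
  have e2 : v.2 = 0 := by simpa [ht, e1] using congrArg Prod.snd hv'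
  exact hv0 (Prod.ext e1 e2)

lemma foliationEquiv_shear (f : ℂ × ℂ → ℂ) (c : ℂ) :
    FoliationEquiv (fun p => (p.1 ^ 2, p.2 + p.1 * f p))
      (fun p => (p.1 ^ 2, p.2 + p.1 * (f (p.1, p.2 - c * p.1) + c * p.1 - c))) := by
  let A : ℂ × ℂ →L[ℂ] ℂ × ℂ := (ContinuousLinearMap.fst ℂ ℂ ℂ).prod
    (ContinuousLinearMap.snd ℂ ℂ ℂ + c • ContinuousLinearMap.fst ℂ ℂ ℂ)
  have hA : ∀ p, A p = (p.1, p.2 + c * p.1) := fun p => rfl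
  refine ⟨A, fun _ => 1, A.analyticAt 0, map_zero A, ?_, analyticAt_const, one_ne_zero, ?_⟩
  · rw [A.fderiv]
    exact det_ne_zero_of_apply (s := 1) (t := 1) (c := c) one_ne_zero one_ne_zero (by simp [hA])
      (by simp [hA])
  · refine Eventually.of_forall fun p => ?_
    rw [A.fderiv, one_smul]
    simp only [hA, add_sub_cancel_right]
    ext
    · rfl
    · simp only []
      ring

lemma analyticAt_dslope {φ : ℂ → ℂ} (hφ : AnalyticAt ℂ φ 0) : AnalyticAt ℂ (dslope φ 0) 0 := by
  rw [Complex.analyticAt_iff_eventually_differentiableAt]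
  obtain ⟨t, hts, ht, h0t⟩ := mem_nhds_iff.1 hφ.eventually_analyticAt
  have hD := (Complex.differentiableOn_dslope (ht.mem_nhds h0t)).2
    fun z hz => (hts hz : AnalyticAt ℂ φ z).differentiableAt.differentiableWithinAt
  filter_upwards [ht.mem_nhds h0t] with z hz
  exact hD.differentiableAt (ht.mem_nhds hz)

lemma exists_linearization {a : ℂ → ℂ} (ha : AnalyticAt ℂ a 0) (ha0 : a 0 = 0)
    (ha1 : deriv a 0 = 1) : ∃ η : ℂ → ℂ, AnalyticAt ℂ η 0 ∧ η 0 = 0 ∧ deriv η 0 ≠ 0 ∧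
      ∀ᶠ y in nhds 0, deriv η y * a y = η y := by
  have hα := analyticAt_dslope ha
  have hα0 : dslope a 0 0 = 1 := by rw [dslope_same, ha1]
  have hα' : dslope a 0 0 ≠ 0 := by rw [hα0]; exact one_ne_zero
  have hγ := analyticAt_dslope ((hα.inv hα').sub (analyticAt_const (v := (1 : ℂ))))
  set β : ℂ → ℂ := (dslope a 0)⁻¹ - fun _ => 1 with hβ
  have hβ0 : β 0 = 0 := by rw [hβ, Pi.sub_apply, Pi.inv_apply, hα0, inv_one, sub_self]
  obtain ⟨r, hr, hr'⟩ := Metric.eventually_nhds_iff_ball.1 hγ.eventually_analyticAt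
  obtain ⟨k, hk⟩ := DifferentiableOn.isExactOn_ball (c := 0) (r := r) (f := dslope β 0)
    fun z hz => (hr' z hz).differentiableAt.differentiableWithinAt
  have hball : Metric.ball (0 : ℂ) r ∈ nhds 0 := Metric.ball_mem_nhds 0 hr
  have hη : ∀ᶠ y in nhds 0, HasDerivAt (fun y => y * Complex.exp (k y))
      (Complex.exp (k y) * (1 + β y)) y := by
    filter_upwards [hball] with y hy
    refine ((hasDerivAt_id y).mul (hk y hy).cexp).congr_deriv ?_
    have := sub_smul_dslope β 0 y
    rw [sub_zero, hβ0, sub_zero, smul_eq_mul] at this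
    rw [← this]
    simp only [id]
    ring
  refine ⟨fun y => y * Complex.exp (k y), ?_, by simp, ?_, ?_⟩
  · rw [Complex.analyticAt_iff_eventually_differentiableAt]
    filter_upwards [hη] with y hy using hy.differentiableAt
  · rw [hη.self_of_nhds.deriv, hβ0, add_zero, mul_one]
    exact Complex.exp_ne_zero _
  · filter_upwards [hη, hα.continuousAt.eventually_ne hα'] with y hy hy'
    have := sub_smul_dslope a 0 y
    rw [sub_zero, ha0, sub_zero, smul_eq_mul] at this
    rw [hy.deriv, ← this]
    simp only [hβ, Pi.sub_apply, Pi.inv_apply]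
    field_simp
    ring

lemma foliationEquiv_normalize {a b : ℂ → ℂ} (ha : AnalyticAt ℂ a 0) (hb : AnalyticAt ℂ b 0)
    (ha0 : a 0 = 0) (ha1 : deriv a 0 = 1) (hb0 : b 0 ≠ 0) :
    ∃ g : ℂ → ℂ, AnalyticAt ℂ g 0 ∧ g 0 ≠ 0 ∧
      FoliationEquiv (fun p => (p.1 ^ 2, a p.2 + b p.2 * p.1))
        (fun p => (p.1 ^ 2, p.2 + p.1 * g p.2)) := by
  obtain ⟨η, hη, hη0, hη1, hlin⟩ := exists_linearization ha ha0 ha1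
  let ξ := hη.hasStrictDerivAt.localInverse _ _ _ hη1
  have hξ : AnalyticAt ℂ ξ (η 0) := hη.analyticAt_localInverse hη1
  have hinv : ∀ᶠ y in nhds 0, ξ (η y) = y :=
    hη.hasStrictDerivAt.eventually_left_inverse hη1
  have hξ0 : ξ 0 = 0 := by simpa [hη0] using hinv.self_of_nhds
  rw [hη0] at hξ
  have hΦ : ∀ y : ℂ, AnalyticAt ℂ η y → ∀ x : ℂ,
      HasFDerivAt (fun p : ℂ × ℂ => (p.1, η p.2)) ((ContinuousLinearMap.fst ℂ ℂ ℂ).prod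
        (deriv η y • ContinuousLinearMap.snd ℂ ℂ ℂ)) (x, y) := fun y hy x =>
    hasFDerivAt_fst.prodMk
      (hy.differentiableAt.hasDerivAt.comp_hasFDerivAt (x, y) hasFDerivAt_snd)
  have hsnd : Tendsto (Prod.snd : ℂ × ℂ → ℂ) (nhds 0) (nhds 0) := continuous_snd.tendsto 0
  refine ⟨fun y => deriv η (ξ y) * b (ξ y), ?_, ?_, fun p => (p.1, η p.2), fun _ => 1, ?_, ?_, ?_,
    analyticAt_const, one_ne_zero, ?_⟩
  · exact (hη.deriv.comp_of_eq hξ hξ0).mul (hb.comp_of_eq hξ hξ0)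
  · simpa [hξ0] using ⟨hη1, hb0⟩
  · exact analyticAt_fst.prod (hη.comp_of_eq analyticAt_snd rfl)
  · simp [hη0]
  · rw [show (0 : ℂ × ℂ) = (0, 0) from rfl, (hΦ 0 hη 0).fderiv]
    exact det_ne_zero_of_apply (s := 1) (c := 0) one_ne_zero hη1 (by simp) (by simp)
  · filter_upwards [hsnd.eventually hη.eventually_analyticAt, hsnd.eventually hlin,
      hsnd.eventually hinv] with p h1 h2 h3
    rw [(hΦ p.2 h1 p.1).fderiv, one_smul]
    simp only [h3]
    ext
    · rfl
    · simp [mul_add, h2]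
      ring

lemma eq_of_id_mul_eq {L M : ℂ → ℂ} (hL : DifferentiableAt ℂ L 0) (hM : DifferentiableAt ℂ M 0)
    (h : ∀ᶠ x in nhds 0, x * L x = x * M x) : L 0 = M 0 := by
  have h1 := (hasDerivAt_id (0 : ℂ)).mul hL.hasDerivAt
  have h2 := (hasDerivAt_id (0 : ℂ)).mul hM.hasDerivAt
  simpa using h1.unique (h2.congr_of_eventuallyEq h)

lemma exists_foliationEquiv_affine {f : ℂ × ℂ → ℂ} (hf : AnalyticAt ℂ f 0) (hf1 : f 0 = 1) :
    ∃ a b : ℂ → ℂ, AnalyticAt ℂ a 0 ∧ AnalyticAt ℂ b 0 ∧ a 0 = 0 ∧ deriv a 0 = 1 ∧ b 0 ≠ 0 ∧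
      FoliationEquiv (fun p => (p.1 ^ 2, a p.2 + b p.2 * p.1))
        (fun p => (p.1 ^ 2, p.2 + p.1 * f p)) := by
  obtain ⟨h, a, b, hh, ha, hb, key⟩ := exists_reduction hf hf1
  have hx : AnalyticAt ℂ (fun p => fderiv ℂ h p (1, 0)) 0 :=
    ((ContinuousLinearMap.apply ℂ ℂ ((1, 0) : ℂ × ℂ)).analyticAt _).comp hh.fderiv
  have hy : AnalyticAt ℂ (fun p => fderiv ℂ h p (0, 1)) 0 :=
    ((ContinuousLinearMap.apply ℂ ℂ ((0, 1) : ℂ × ℂ)).analyticAt _).comp hh.fderiv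
  have hθ : AnalyticAt ℂ (fun p : ℂ × ℂ => p.1 + p.1 ^ 2 * h p) 0 :=
    analyticAt_fst.add ((analyticAt_fst.pow 2).mul hh)
  have hΦ : AnalyticAt ℂ (fun p : ℂ × ℂ => (p.1 + p.1 ^ 2 * h p, p.2)) 0 := hθ.prod analyticAt_snd
  have hF : AnalyticAt ℂ (fun p : ℂ × ℂ => f (p.1 + p.1 ^ 2 * h p, p.2)) 0 :=
    hf.comp_of_eq hΦ (by simp)
  have hl : AnalyticAt ℂ (fun p : ℂ × ℂ =>
      p.2 + (p.1 + p.1 ^ 2 * h p) * f (p.1 + p.1 ^ 2 * h p, p.2)) 0 :=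
    analyticAt_snd.add (hθ.mul hF)
  have hθx : AnalyticAt ℂ (fun p : ℂ × ℂ =>
      1 + 2 * p.1 * h p + p.1 ^ 2 * fderiv ℂ h p (1, 0)) 0 :=
    (analyticAt_const.add ((analyticAt_const.mul analyticAt_fst).mul hh)).add
      ((analyticAt_fst.pow 2).mul hx)
  have hden : AnalyticAt ℂ (fun p : ℂ × ℂ => (1 + p.1 * h p) ^ 2 - fderiv ℂ h p (0, 1) *
      (p.2 + (p.1 + p.1 ^ 2 * h p) * f (p.1 + p.1 ^ 2 * h p, p.2))) 0 :=
    ((analyticAt_const.add (analyticAt_fst.mul hh)).pow 2).sub (hy.mul hl)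
  have ix : AnalyticAt ℂ (fun x : ℂ => (x, (0 : ℂ))) 0 := analyticAt_id.prod analyticAt_const
  have iy : AnalyticAt ℂ (fun y : ℂ => ((0 : ℂ), y)) 0 := analyticAt_const.prod analyticAt_id
  have ix0 : Tendsto (fun x : ℂ => (x, (0 : ℂ))) (nhds 0) (nhds 0) := ix.continuousAt.tendsto
  have iy0 : Tendsto (fun y : ℂ => ((0 : ℂ), y)) (nhds 0) (nhds 0) := iy.continuousAt.tendsto
  have ha0 : a 0 = 0 := by simpa using key.self_of_nhds.symm
  have ha1 : deriv a 0 = 1 := by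
    have h1 := eq_of_id_mul_eq (L := fun _ => 1)
      (M := fun y => dslope a 0 y * (1 - fderiv ℂ h (0, y) (0, 1) * y))
      (differentiableAt_const _) ?_ ?_
    · simpa [dslope_same] using h1.symm
    · exact ((analyticAt_dslope ha).mul (analyticAt_const.sub
        ((hy.comp_of_eq iy rfl).mul analyticAt_id))).differentiableAt
    · filter_upwards [iy0.eventually key] with y hk
      have := sub_smul_dslope a 0 y
      rw [sub_zero, ha0, sub_zero, smul_eq_mul] at this
      rw [← mul_assoc, this]
      simpa using hk
  have hb1 : b 0 = 1 := by
    have h1 := eq_of_id_mul_eq (L := fun x => (1 + 2 * x * h (x, 0) +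
        x ^ 2 * fderiv ℂ h (x, 0) (1, 0)) * ((1 + x * h (x, 0)) * f (x + x ^ 2 * h (x, 0), 0)))
      (M := fun x => b 0 * ((1 + x * h (x, 0)) ^ 2 - fderiv ℂ h (x, 0) (0, 1) *
        (0 + (x + x ^ 2 * h (x, 0)) * f (x + x ^ 2 * h (x, 0), 0)))) ?_ ?_ ?_
    · have hf1' : f (0, 0) = 1 := hf1
      simpa [hf1'] using h1.symm
    · exact ((hθx.comp_of_eq ix rfl).mul ((analyticAt_const.add (analyticAt_id.mul
        (hh.comp_of_eq ix rfl))).mul (hF.comp_of_eq ix rfl))).differentiableAt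
    · exact (analyticAt_const.mul (hden.comp_of_eq ix rfl)).differentiableAt
    · filter_upwards [ix0.eventually key] with x hk
      simp only [ha0] at hk
      linear_combination hk
  have hden0 : (fun p : ℂ × ℂ => (1 + p.1 * h p) ^ 2 - fderiv ℂ h p (0, 1) *
      (p.2 + (p.1 + p.1 ^ 2 * h p) * f (p.1 + p.1 ^ 2 * h p, p.2))) 0 ≠ 0 := by simp
  have hD : ∀ p, AnalyticAt ℂ h p → HasFDerivAt (fun p : ℂ × ℂ => (p.1 + p.1 ^ 2 * h p, p.2))
      ((ContinuousLinearMap.fst ℂ ℂ ℂ + (p.1 ^ 2 • fderiv ℂ h p +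
        h p • ((2 * p.1) • ContinuousLinearMap.fst ℂ ℂ ℂ))).prod
          (ContinuousLinearMap.snd ℂ ℂ ℂ)) p := by
    intro p hp
    have h2 : HasFDerivAt (fun p : ℂ × ℂ => p.1 ^ 2)
        ((2 * p.1) • ContinuousLinearMap.fst ℂ ℂ ℂ) p := by
      simpa using (hasFDerivAt_fst (𝕜 := ℂ) (p := p)).pow 2
    exact (hasFDerivAt_fst.add (h2.mul hp.differentiableAt.hasFDerivAt)).prodMk hasFDerivAt_snd
  refine ⟨a, b, ha, hb, ha0, ha1, by simp [hb1], _, _, hΦ, by simp, ?_, hθx.div hden hden0, by simp,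
    ?_⟩
  · rw [(hD 0 hh).fderiv]
    exact det_ne_zero_of_apply (s := 1) (t := 1) (c := 0) one_ne_zero one_ne_zero (by simp)
      (by simp)
  · filter_upwards [key, hh.eventually_analyticAt, hden.continuousAt.eventually_ne hden0]
      with p hk h1 h2
    rw [(hD p h1).fderiv]
    set v := a p.2 + b p.2 * p.1
    have hv : fderiv ℂ h p (p.1 ^ 2, v) =
        p.1 ^ 2 * fderiv ℂ h p (1, 0) + v * fderiv ℂ h p (0, 1) := by
      rw [← smul_eq_mul, ← smul_eq_mul, ← map_smul, ← map_smul, ← map_add]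
      simp
    ext
    · simp only [ContinuousLinearMap.prod_apply, add_apply, hv,
        smul_apply, ContinuousLinearMap.coe_fst', Pi.div_apply, smul_eq_mul,
        Prod.smul_fst]
      rw [div_mul_eq_mul_div, eq_div_iff h2]
      linear_combination -(p.1 ^ 2 * fderiv ℂ h p (0, 1) * hk)
    · simp only [ContinuousLinearMap.prod_apply, ContinuousLinearMap.coe_snd', Pi.div_apply,
        smul_eq_mul, Prod.smul_snd]
      rw [div_mul_eq_mul_div, eq_div_iff h2]
      exact hk.symm

end SaddleNode

/-- **Theorem (versal normal form for saddle-nodes, k = 1).**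
Any saddle-node germ `X₀ = x²∂x + (y + x f(x,y))∂y` in Dulac prenormal form with
formal invariant `k = 1` is analytically equivalent, as a singular foliation, to
`X_g = x²∂x + (y + x g(y))∂y` for some one-variable holomorphic `g` with `g 0 ≠ 0`. -/
theorem saddleNode_versal_normal_form (f : ℂ × ℂ → ℂ) (hf : AnalyticAt ℂ f 0) :
    ∃ g : ℂ → ℂ, AnalyticAt ℂ g 0 ∧ g 0 ≠ 0 ∧
      FoliationEquiv (fun p => (p.1 ^ 2, p.2 + p.1 * f p))
        (fun p => (p.1 ^ 2, p.2 + p.1 * g p.2)) := by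
  have hf1 : AnalyticAt ℂ (fun p : ℂ × ℂ => f (p.1, p.2 - (f 0 - 1) * p.1) +
      (f 0 - 1) * p.1 - (f 0 - 1)) 0 :=
    ((hf.comp_of_eq (analyticAt_fst.prod (analyticAt_snd.sub
      (analyticAt_const.mul analyticAt_fst))) (by simp)).add
        (analyticAt_const.mul analyticAt_fst)).sub analyticAt_const
  obtain ⟨a, b, ha, hb, ha0, ha1, hb0, hab⟩ :=
    SaddleNode.exists_foliationEquiv_affine hf1 (by simp [← Prod.zero_eq_mk])
  obtain ⟨g, hg, hg0, hag⟩ := SaddleNode.foliationEquiv_normalize ha hb ha0 ha1 hb0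
  exact ⟨g, hg, hg0, SaddleNode.foliationEquiv_trans (SaddleNode.foliationEquiv_trans
    (SaddleNode.foliationEquiv_shear f (f 0 - 1)) (SaddleNode.foliationEquiv_symm hab)) hag⟩
end

section
/- Let a be a function holomorphic in a neighborhood of 0 in ℂ², set μ := a(0,0), and assume μ is not a nonpositive real number (i.e. μ ∉ ℝ or μ > 0). Let X = x²∂x + (y + x·y·a(x,y))∂y (a saddle-node germ with formal invariant k = 1 whose central manifold is the axis {y = 0}). Then X is analytically equivalent as a singular foliation to a vector field of the form X_h = x²∂x + (y + x·y·h(y))∂y, where h is a function of one variable holomorphic near 0 ∈ ℂ with h(0) = μ. -/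
open Filter

/-- Multi-exponents `d` of monomials `x ^ d 0 * y ^ d 1`. -/
abbrev BiExp := Fin 2 →₀ ℕ

/-- Absolute summability of a family of coefficients. -/
def AbsSummable (c : BiExp → ℂ) : Prop := Summable fun d => ‖c d‖

lemma AbsSummable.mul {f g : MvPowerSeries (Fin 2) ℂ}
    (hf : AbsSummable fun d => MvPowerSeries.coeff d f)
    (hg : AbsSummable fun d => MvPowerSeries.coeff d g) :
    AbsSummable fun d => MvPowerSeries.coeff d (f * g) := by
  have h := summable_sum_mul_antidiagonal_of_summable_mul
    (Summable.mul_of_nonneg hf hg (fun _ => norm_nonneg _) (fun _ => norm_nonneg _))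
  refine Summable.of_nonneg_of_le (fun _ => norm_nonneg _) (fun d => ?_) h
  simp only [MvPowerSeries.coeff_mul]
  exact (norm_sum_le _ _).trans (Finset.sum_le_sum fun _ _ => norm_mul_le _ _)

lemma AbsSummable.add {f g : MvPowerSeries (Fin 2) ℂ}
    (hf : AbsSummable fun d => MvPowerSeries.coeff d f)
    (hg : AbsSummable fun d => MvPowerSeries.coeff d g) :
    AbsSummable fun d => MvPowerSeries.coeff d (f + g) := by
  refine Summable.of_nonneg_of_le (fun _ => norm_nonneg _) (fun d => ?_) (Summable.add hf hg)
  simp only [map_add]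
  exact norm_add_le _ _

lemma absSummable_algebraMap (c : ℂ) :
    AbsSummable fun d => MvPowerSeries.coeff d (algebraMap ℂ (MvPowerSeries (Fin 2) ℂ) c) := by
  classical
  refine summable_of_ne_finset_zero (s := {0}) fun d hd => ?_
  simp only [MvPowerSeries.algebraMap_apply, MvPowerSeries.coeff_C]
  rw [if_neg (by simpa using hd), norm_zero]

/-- The formal power series in two variables with absolutely summable coefficients. -/
def wienerSubalgebra : Subalgebra ℂ (MvPowerSeries (Fin 2) ℂ) where
  carrier := {f | AbsSummable fun d => MvPowerSeries.coeff d f}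
  mul_mem' := AbsSummable.mul
  add_mem' := AbsSummable.add
  algebraMap_mem' := absSummable_algebraMap

/-- The Wiener algebra of the closed unit bidisc: power series in two variables with absolutely
summable coefficients. -/
abbrev Wiener := ↥wienerSubalgebra

namespace Wiener

noncomputable section

/-- The coefficient of `f` at the exponent `d`. -/
def coeff (d : BiExp) : Wiener →ₗ[ℂ] ℂ :=
  (MvPowerSeries.coeff d).comp wienerSubalgebra.val.toLinearMap

lemma summable_norm_coeff (f : Wiener) : Summable fun d => ‖coeff d f‖ := f.2

@[ext]
lemma ext {f g : Wiener} (h : ∀ d, coeff d f = coeff d g) : f = g :=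
  Subtype.ext (MvPowerSeries.ext h)

/-- The element with prescribed absolutely summable coefficients. -/
def mk (c : BiExp → ℂ) (hc : Summable fun d => ‖c d‖) : Wiener := ⟨c, hc⟩

@[simp]
lemma coeff_mk (c : BiExp → ℂ) (hc : Summable fun d => ‖c d‖) (d : BiExp) :
    coeff d (mk c hc) = c d := rfl

lemma coeff_mul (d : BiExp) (f g : Wiener) :
    coeff d (f * g) = ∑ e ∈ Finset.HasAntidiagonal.antidiagonal d, coeff e.1 f * coeff e.2 g :=
  MvPowerSeries.coeff_mul _ _ _

open Classical in
lemma coeff_one (d : BiExp) : coeff d (1 : Wiener) = if d = 0 then 1 else 0 :=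
  MvPowerSeries.coeff_one _

/-- The coefficient family, as an element of `ℓ¹`. -/
def toLp : Wiener ≃ₗ[ℂ] lp (fun _ : BiExp => ℂ) 1 where
  toFun f := ⟨fun d => coeff d f, memℓp_gen (by simpa using f.summable_norm_coeff)⟩
  invFun u := mk u (by simpa using (lp.memℓp u).summable (by simp))
  map_add' f g := by ext d; simp; rfl
  map_smul' c f := by ext d; simp
  left_inv f := by ext d; simp
  right_inv u := by ext d; simp

instance : NormedAddCommGroup Wiener :=
  NormedAddCommGroup.induced Wiener (lp (fun _ : BiExp => ℂ) 1) toLp.toLinearMap toLp.injective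

lemma norm_eq_tsum (f : Wiener) : ‖f‖ = ∑' d, ‖coeff d f‖ := by
  change ‖toLp f‖ = _
  rw [lp.norm_eq_tsum_rpow (by simp)]
  simp [toLp]

instance : NormedSpace ℂ Wiener where
  norm_smul_le c f := by
    rw [norm_eq_tsum, norm_eq_tsum, ← tsum_mul_left]
    simp

instance : CompleteSpace Wiener := by
  have h : Isometry toLp := fun _ _ => rfl
  exact (IsometryEquiv.mk toLp.toEquiv h).completeSpace

lemma tsum_le_of_antidiagonal {A : Type*} [AddCommMonoid A] [Finset.HasAntidiagonal A]
    {u v w : A → ℝ} (hu : Summable u) (hv : Summable v) (hw : Summable w)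
    (hu0 : 0 ≤ u) (hv0 : 0 ≤ v)
    (h : ∀ d, w d ≤ ∑ e ∈ Finset.HasAntidiagonal.antidiagonal d, u e.1 * v e.2) :
    ∑' d, w d ≤ (∑' d, u d) * ∑' d, v d := by
  have huv := hu.mul_of_nonneg hv hu0 hv0
  rw [hu.tsum_mul_tsum_eq_tsum_sum_antidiagonal hv huv]
  exact hw.tsum_le_tsum h (summable_sum_mul_antidiagonal_of_summable_mul huv)

lemma norm_coeff_mul_le (f g : Wiener) (d : BiExp) : ‖coeff d (f * g)‖ ≤
    ∑ e ∈ Finset.HasAntidiagonal.antidiagonal d, ‖coeff e.1 f‖ * ‖coeff e.2 g‖ := by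
  rw [coeff_mul]
  exact (norm_sum_le _ _).trans (Finset.sum_le_sum fun _ _ => norm_mul_le _ _)

lemma norm_mul_le' (f g : Wiener) : ‖f * g‖ ≤ ‖f‖ * ‖g‖ := by
  rw [norm_eq_tsum (f * g), norm_eq_tsum f, norm_eq_tsum g]
  exact tsum_le_of_antidiagonal f.summable_norm_coeff g.summable_norm_coeff
    (f * g).summable_norm_coeff (fun _ => norm_nonneg _) (fun _ => norm_nonneg _)
    (norm_coeff_mul_le f g)

instance : NormedCommRing Wiener :=
  { (inferInstance : NormedAddCommGroup Wiener), (inferInstance : CommRing Wiener) with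
    norm_mul_le := norm_mul_le' }

instance : NormedAlgebra ℂ Wiener where
  norm_smul_le := norm_smul_le

instance : NormOneClass Wiener where
  norm_one := by
    classical
    rw [norm_eq_tsum, tsum_eq_single 0 (by intro d hd; simp [coeff_one, hd])]
    simp [coeff_one]

lemma norm_mul_coeff_le {m : BiExp → ℂ} {C : ℝ} (hm : ∀ d, ‖m d‖ ≤ C) (f : Wiener)
    (d e : BiExp) : ‖m d * coeff e f‖ ≤ C * ‖coeff e f‖ := by
  rw [norm_mul]
  exact mul_le_mul_of_nonneg_right (hm d) (norm_nonneg _)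

/-- The linear operator `f ↦ (m d * f (φ d))_d`, for a bounded weight `m` and an injective
substitution of exponents `φ`. -/
def weightedCompLinear (m : BiExp → ℂ) (φ : BiExp → BiExp) (hφ : φ.Injective) (C : ℝ)
    (hm : ∀ d, ‖m d‖ ≤ C) : Wiener →ₗ[ℂ] Wiener where
  toFun f := mk (fun d => m d * coeff (φ d) f)
    (Summable.of_nonneg_of_le (fun _ => norm_nonneg _) (fun d => norm_mul_coeff_le hm f d (φ d))
      ((f.summable_norm_coeff.comp_injective hφ).mul_left C))
  map_add' f g := by ext d; simp [mul_add]
  map_smul' c f := by ext d; simp [mul_left_comm]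

lemma norm_weightedCompLinear_le (m : BiExp → ℂ) (φ : BiExp → BiExp) (hφ : φ.Injective) (C : ℝ)
    (hm : ∀ d, ‖m d‖ ≤ C) (f : Wiener) : ‖weightedCompLinear m φ hφ C hm f‖ ≤ C * ‖f‖ := by
  have hC : 0 ≤ C := (norm_nonneg _).trans (hm 0)
  have hs := (f.summable_norm_coeff.comp_injective hφ).mul_left C
  rw [norm_eq_tsum, norm_eq_tsum f]
  refine (Summable.tsum_le_tsum (fun d => norm_mul_coeff_le hm f d (φ d))
    (weightedCompLinear m φ hφ C hm f).summable_norm_coeff hs).trans ?_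
  rw [tsum_mul_left]
  exact mul_le_mul_of_nonneg_left
    (tsum_comp_le_tsum_of_inj f.summable_norm_coeff (fun _ => norm_nonneg _) hφ) hC

/-- The operator `weightedCompLinear` as a bounded operator. -/
def weightedComp (m : BiExp → ℂ) (φ : BiExp → BiExp) (hφ : φ.Injective) (C : ℝ)
    (hm : ∀ d, ‖m d‖ ≤ C) : Wiener →L[ℂ] Wiener :=
  (weightedCompLinear m φ hφ C hm).mkContinuous C (norm_weightedCompLinear_le m φ hφ C hm)

@[simp]
lemma coeff_weightedComp (m : BiExp → ℂ) (φ : BiExp → BiExp) (hφ : φ.Injective) (C : ℝ)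
    (hm : ∀ d, ‖m d‖ ≤ C) (f : Wiener) (d : BiExp) :
    coeff d (weightedComp m φ hφ C hm f) = m d * coeff (φ d) f := rfl

lemma norm_weightedComp_le (m : BiExp → ℂ) (φ : BiExp → BiExp) (hφ : φ.Injective) (C : ℝ)
    (hm : ∀ d, ‖m d‖ ≤ C) (f : Wiener) : ‖weightedComp m φ hφ C hm f‖ ≤ C * ‖f‖ :=
  norm_weightedCompLinear_le m φ hφ C hm f

end

end Wiener

/-- The monomial function `p ↦ p.1 ^ d 0 * p.2 ^ d 1`. -/
def monom (d : BiExp) (p : ℂ × ℂ) : ℂ := p.1 ^ d 0 * p.2 ^ d 1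

@[simp]
lemma monom_zero_exp (p : ℂ × ℂ) : monom 0 p = 1 := by simp [monom]

lemma monom_add (d e : BiExp) (p : ℂ × ℂ) : monom (d + e) p = monom d p * monom e p := by
  simp only [monom, Finsupp.add_apply, pow_add]
  ring

lemma norm_monom_le_one (d : BiExp) {p : ℂ × ℂ} (hp : ‖p‖ ≤ 1) : ‖monom d p‖ ≤ 1 := by
  rw [monom, norm_mul, norm_pow, norm_pow]
  exact mul_le_one₀ (pow_le_one₀ (norm_nonneg _) ((norm_fst_le p).trans hp)) (by positivity)
    (pow_le_one₀ (norm_nonneg _) ((norm_snd_le p).trans hp))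

/-- The sum of the double power series with coefficients `c`. -/
noncomputable def evalSeries (c : BiExp → ℂ) (p : ℂ × ℂ) : ℂ := ∑' d, c d * monom d p

lemma evalSeries_zero (c : BiExp → ℂ) : evalSeries c 0 = c 0 := by
  rw [evalSeries, tsum_eq_single 0]
  · simp
  · intro d hd
    have : d 0 ≠ 0 ∨ d 1 ≠ 0 := by
      by_contra! h
      exact hd (by ext i; fin_cases i <;> simp [h.1, h.2])
    rcases this with h | h <;> simp [monom, h]

lemma norm_mul_monom_le (c : ℂ) (d : BiExp) {p : ℂ × ℂ} (hp : ‖p‖ ≤ 1) :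
    ‖c * monom d p‖ ≤ ‖c‖ := by
  rw [norm_mul]
  exact mul_le_of_le_one_right (norm_nonneg _) (norm_monom_le_one d hp)

lemma AbsSummable.summable_mul_monom {c : BiExp → ℂ} (hc : AbsSummable c) {p : ℂ × ℂ}
    (hp : ‖p‖ ≤ 1) : Summable fun d => c d * monom d p :=
  Summable.of_norm_bounded hc fun d => norm_mul_monom_le _ d hp

namespace Wiener

noncomputable section

lemma summable_coeff_mul_monom (f : Wiener) {p : ℂ × ℂ} (hp : ‖p‖ ≤ 1) :
    Summable fun d => coeff d f * monom d p :=
  AbsSummable.summable_mul_monom f.summable_norm_coeff hp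

lemma evalSeries_mul (f g : Wiener) {p : ℂ × ℂ} (hp : ‖p‖ ≤ 1) :
    evalSeries (fun d => coeff d (f * g)) p =
      evalSeries (fun d => coeff d f) p * evalSeries (fun d => coeff d g) p := by
  have hf := f.summable_coeff_mul_monom hp
  have hg := g.summable_coeff_mul_monom hp
  have hfg := summable_mul_of_summable_norm hf.norm hg.norm
  simp only [evalSeries]
  rw [hf.tsum_mul_tsum_eq_tsum_sum_antidiagonal hg hfg]
  refine tsum_congr fun d => ?_
  rw [coeff_mul, Finset.sum_mul]
  refine Finset.sum_congr rfl fun e he => ?_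
  rw [← Finset.HasAntidiagonal.mem_antidiagonal.mp he, monom_add]
  ring

/-- Evaluation at a point of the closed unit bidisc. -/
def eval (p : ℂ × ℂ) (hp : ‖p‖ ≤ 1) : Wiener →ₐ[ℂ] ℂ where
  toFun f := evalSeries (fun d => coeff d f) p
  map_one' := by
    classical
    rw [evalSeries, tsum_eq_single 0 (by intro d hd; simp [coeff_one, hd])]
    simp [coeff_one]
  map_mul' f g := evalSeries_mul f g hp
  map_zero' := by simp [evalSeries]
  map_add' f g := by
    simp only [evalSeries, map_add, add_mul]
    exact (f.summable_coeff_mul_monom hp).tsum_add (g.summable_coeff_mul_monom hp)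
  commutes' c := by
    classical
    have h (d : BiExp) : coeff d (algebraMap ℂ Wiener c) = if d = 0 then c else 0 := by
      rw [Algebra.algebraMap_eq_smul_one, map_smul, coeff_one]
      simp
    rw [evalSeries, tsum_eq_single 0 (by intro d hd; simp [h, hd])]
    simp [h]

lemma eval_apply (p : ℂ × ℂ) (hp : ‖p‖ ≤ 1) (f : Wiener) :
    eval p hp f = evalSeries (fun d => coeff d f) p := rfl

lemma continuous_eval (p : ℂ × ℂ) (hp : ‖p‖ ≤ 1) : Continuous (eval p hp) := by
  refine AddMonoidHomClass.continuous_of_bound (eval p hp) 1 fun f => ?_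
  rw [eval_apply, one_mul, norm_eq_tsum]
  exact tsum_of_norm_bounded f.summable_norm_coeff.hasSum fun d => norm_mul_monom_le _ d hp

open Classical in
/-- The monomial with exponent `d`. -/
def monomial (d : BiExp) : Wiener :=
  mk (Pi.single d 1) (summable_of_ne_finset_zero (s := {d}) fun e he => by
    simp [Finset.notMem_singleton.mp he])

open Classical in
lemma coeff_monomial (d e : BiExp) : coeff e (monomial d) = if e = d then 1 else 0 := by
  simp [monomial, Pi.single_apply]

lemma norm_monomial (d : BiExp) : ‖monomial d‖ = 1 := by
  rw [norm_eq_tsum, tsum_eq_single d (by intro e he; simp [coeff_monomial, he])]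
  simp [coeff_monomial]

lemma eval_monomial (p : ℂ × ℂ) (hp : ‖p‖ ≤ 1) (d : BiExp) :
    eval p hp (monomial d) = monom d p := by
  rw [eval_apply, evalSeries, tsum_eq_single d (by intro e he; simp [coeff_monomial, he])]
  simp [coeff_monomial]

end

end Wiener

section Derivative

/-- The differential of `monom d`. -/
noncomputable def monomDeriv (d : BiExp) (p : ℂ × ℂ) : ℂ × ℂ →L[ℂ] ℂ :=
  (p.1 ^ d 0) • ((d 1 * p.2 ^ (d 1 - 1)) • ContinuousLinearMap.snd ℂ ℂ ℂ) +
    (p.2 ^ d 1) • ((d 0 * p.1 ^ (d 0 - 1)) • ContinuousLinearMap.fst ℂ ℂ ℂ)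

lemma hasFDerivAt_monom (d : BiExp) (p : ℂ × ℂ) :
    HasFDerivAt (monom d) (monomDeriv d p) p := by
  have h1 := (hasDerivAt_pow (d 0) p.1).comp_hasFDerivAt p (hasFDerivAt_fst (𝕜 := ℂ) (p := p))
  have h2 := (hasDerivAt_pow (d 1) p.2).comp_hasFDerivAt p (hasFDerivAt_snd (𝕜 := ℂ) (p := p))
  exact h1.mul h2

lemma monomDeriv_apply (d : BiExp) (p : ℂ × ℂ) (w₁ w₂ : ℂ) :
    monomDeriv d p (p.1 * w₁, p.2 * w₂) = (d 0 * w₁ + d 1 * w₂) * monom d p := by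
  have h (n : ℕ) (z : ℂ) : (n : ℂ) * z ^ (n - 1) * z = n * z ^ n := by
    rcases n with _ | n
    · simp
    · rw [Nat.add_sub_cancel, pow_succ]; ring
  simp only [monomDeriv, monom, add_apply, smul_apply,
    ContinuousLinearMap.coe_fst', ContinuousLinearMap.coe_snd', smul_eq_mul]
  linear_combination p.1 ^ d 0 * w₂ * h (d 1) p.2 + p.2 ^ d 1 * w₁ * h (d 0) p.1

lemma natCast_mul_pow_pred_le {s : ℝ} (hs : 0 ≤ s) (hs1 : s < 1) (n : ℕ) :
    n * s ^ (n - 1) ≤ (1 - s)⁻¹ := by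
  rw [← tsum_geometric_of_lt_one hs hs1]
  refine le_trans ?_ ((summable_geometric_of_lt_one hs hs1).sum_le_tsum (Finset.range n)
    fun _ _ => by positivity)
  rw [← nsmul_eq_mul]
  nth_rewrite 1 [← Finset.card_range n]
  refine Finset.card_nsmul_le_sum _ _ _ fun i hi => ?_
  exact pow_le_pow_of_le_one hs hs1.le (by have := Finset.mem_range.mp hi; omega)

lemma norm_monomDeriv_le {s : ℝ} (hs1 : s < 1) (d : BiExp) {p : ℂ × ℂ}
    (hp : ‖p‖ ≤ s) : ‖monomDeriv d p‖ ≤ (1 - s)⁻¹ + (1 - s)⁻¹ := by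
  have hs : 0 ≤ s := (norm_nonneg p).trans hp
  have key (z w : ℂ) (hz : ‖z‖ ≤ s) (hw : ‖w‖ ≤ s) (m n : ℕ) (L : ℂ × ℂ →L[ℂ] ℂ)
      (hL : ‖L‖ ≤ 1) : ‖z ^ m • ((n * w ^ (n - 1)) • L)‖ ≤ (1 - s)⁻¹ := by
    rw [norm_smul, norm_smul, norm_mul, norm_pow, norm_pow, Complex.norm_natCast]
    have h1 : ‖z‖ ^ m ≤ 1 := pow_le_one₀ (norm_nonneg _) (hz.trans hs1.le)
    have h2 : n * ‖w‖ ^ (n - 1) ≤ (1 - s)⁻¹ :=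
      le_trans (by gcongr) (natCast_mul_pow_pred_le hs hs1 n)
    calc ‖z‖ ^ m * (n * ‖w‖ ^ (n - 1) * ‖L‖) ≤ 1 * ((1 - s)⁻¹ * 1) := by gcongr
      _ = (1 - s)⁻¹ := by ring
  refine (norm_add_le _ _).trans (add_le_add ?_ ?_)
  · exact key _ _ ((norm_fst_le p).trans hp) ((norm_snd_le p).trans hp) _ _ _
      (ContinuousLinearMap.norm_snd_le ..)
  · exact key _ _ ((norm_snd_le p).trans hp) ((norm_fst_le p).trans hp) _ _ _
      (ContinuousLinearMap.norm_fst_le ..)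

/-- An absolutely summable double power series may be differentiated termwise in the open unit
bidisc. -/
lemma AbsSummable.hasFDerivAt_evalSeries {c : BiExp → ℂ} (hc : AbsSummable c) {p : ℂ × ℂ}
    (hp : ‖p‖ < 1) :
    HasFDerivAt (evalSeries c) (∑' d, c d • monomDeriv d p) p ∧
      Summable fun d => c d • monomDeriv d p := by
  obtain ⟨s, hps, hs1⟩ := exists_between hp
  set K := (1 - s)⁻¹ + (1 - s)⁻¹
  have hu : Summable fun d => ‖c d‖ * K := Summable.mul_right K hc
  have hb (d : BiExp) (q : ℂ × ℂ) (hq : q ∈ Metric.ball (0 : ℂ × ℂ) s) :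
      ‖c d • monomDeriv d q‖ ≤ ‖c d‖ * K := by
    rw [norm_smul]
    exact mul_le_mul_of_nonneg_left (norm_monomDeriv_le hs1 d (mem_ball_zero_iff.mp hq).le)
      (norm_nonneg _)
  have hmem : p ∈ Metric.ball (0 : ℂ × ℂ) s := mem_ball_zero_iff.mpr hps
  refine ⟨?_, Summable.of_norm_bounded hu fun d => hb d p hmem⟩
  exact hasFDerivAt_tsum_of_isPreconnected hu Metric.isOpen_ball
    (convex_ball (0 : ℂ × ℂ) s).isPreconnected
    (fun d q _ => (hasFDerivAt_monom d q).const_mul (c d)) hb hmem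
    (hc.summable_mul_monom hp.le) hmem

lemma AbsSummable.fderiv_evalSeries_apply {c : BiExp → ℂ} (hc : AbsSummable c) {p : ℂ × ℂ}
    (hp : ‖p‖ < 1) (w₁ w₂ : ℂ) :
    HasSum (fun d => c d * ((d 0 * w₁ + d 1 * w₂) * monom d p))
      (fderiv ℂ (evalSeries c) p (p.1 * w₁, p.2 * w₂)) := by
  obtain ⟨h, hs⟩ := hc.hasFDerivAt_evalSeries hp
  rw [h.fderiv]
  have := (ContinuousLinearMap.apply ℂ ℂ (p.1 * w₁, p.2 * w₂)).hasSum hs.hasSum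
  simpa only [ContinuousLinearMap.apply_apply, smul_apply, monomDeriv_apply,
    smul_eq_mul] using this

end Derivative

section Analytic

/-- Exponents as pairs of natural numbers. -/
noncomputable def biExpEquiv : BiExp ≃ ℕ × ℕ := Finsupp.equivFunOnFinite.trans (finTwoArrowEquiv ℕ)

@[simp]
lemma biExpEquiv_symm_zero (e : ℕ × ℕ) : biExpEquiv.symm e 0 = e.1 := rfl

@[simp]
lemma biExpEquiv_symm_one (e : ℕ × ℕ) : biExpEquiv.symm e 1 = e.2 := rfl

/-- The multilinear form `(v₁, …, vₖ) ↦ v₁.1 ⋯ vᵢ.1 * vᵢ₊₁.2 ⋯ vₖ.2`. -/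
noncomputable def monomForm (i k : ℕ) : (ℂ × ℂ) [×k]→L[ℂ] ℂ :=
  (ContinuousMultilinearMap.mkPiAlgebra ℂ (Fin k) ℂ).compContinuousLinearMap fun j =>
    if (j : ℕ) < i then ContinuousLinearMap.fst ℂ ℂ ℂ else ContinuousLinearMap.snd ℂ ℂ ℂ

lemma norm_monomForm_le (i k : ℕ) : ‖monomForm i k‖ ≤ 1 := by
  refine (ContinuousMultilinearMap.norm_compContinuousLinearMap_le _ _).trans ?_
  rw [ContinuousMultilinearMap.norm_mkPiAlgebra, one_mul]
  refine Finset.prod_le_one (fun _ _ => norm_nonneg _) fun j _ => ?_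
  split_ifs
  exacts [ContinuousLinearMap.norm_fst_le .., ContinuousLinearMap.norm_snd_le ..]

lemma monomForm_apply {e : ℕ × ℕ} {k : ℕ} (he : e.1 + e.2 = k) (p : ℂ × ℂ) :
    monomForm e.1 k (fun _ => p) = monom (biExpEquiv.symm e) p := by
  subst he
  have h (j : Fin (e.1 + e.2)) : (if (j : ℕ) < e.1 then ContinuousLinearMap.fst ℂ ℂ ℂ
      else ContinuousLinearMap.snd ℂ ℂ ℂ) p = if (j : ℕ) < e.1 then p.1 else p.2 := by
    split_ifs <;> rfl
  simp only [monomForm, ContinuousMultilinearMap.compContinuousLinearMap_apply, h,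
    ContinuousMultilinearMap.mkPiAlgebra_apply]
  rw [Fin.prod_univ_add]
  simp [monom]

/-- The formal multilinear series of a double power series. -/
noncomputable def multilinearSeries (c : BiExp → ℂ) : FormalMultilinearSeries ℂ (ℂ × ℂ) ℂ :=
  fun k => ∑ e ∈ Finset.HasAntidiagonal.antidiagonal k, c (biExpEquiv.symm e) • monomForm e.1 k

lemma multilinearSeries_apply (c : BiExp → ℂ) (k : ℕ) (y : ℂ × ℂ) :
    multilinearSeries c k (fun _ => y) = ∑ e ∈ Finset.HasAntidiagonal.antidiagonal k,
      c (biExpEquiv.symm e) * monom (biExpEquiv.symm e) y := by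
  change (∑ e ∈ Finset.HasAntidiagonal.antidiagonal k,
    c (biExpEquiv.symm e) • monomForm e.1 k : (ℂ × ℂ) [×k]→L[ℂ] ℂ) (fun _ => y) = _
  rw [sum_apply]
  refine Finset.sum_congr rfl fun e he => ?_
  rw [smul_apply, monomForm_apply (Finset.HasAntidiagonal.mem_antidiagonal.mp he), smul_eq_mul]

lemma AbsSummable.hasFPowerSeriesOnBall {c : BiExp → ℂ} (hc : AbsSummable c) :
    HasFPowerSeriesOnBall (evalSeries c) (multilinearSeries c) 0 1 where
  r_le := by
    have := (multilinearSeries c).le_radius_of_bound (r := 1) (∑' d, ‖c d‖) fun k => by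
      have h1 : ‖multilinearSeries c k‖ ≤
          ∑ e ∈ Finset.HasAntidiagonal.antidiagonal k, ‖c (biExpEquiv.symm e)‖ := by
        refine (norm_sum_le _ _).trans (Finset.sum_le_sum fun e _ => ?_)
        rw [norm_smul]
        exact mul_le_of_le_one_right (norm_nonneg _) (norm_monomForm_le _ _)
      rw [NNReal.coe_one, one_pow, mul_one]
      refine h1.trans ?_
      rw [← biExpEquiv.symm.tsum_eq]
      exact (biExpEquiv.symm.summable_iff.mpr hc).sum_le_tsum _ fun _ _ => norm_nonneg _
    simpa using this
  r_pos := one_pos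
  hasSum := by
    intro y hy
    have hy1 : ‖y‖ ≤ 1 := by
      have : ‖y‖ₑ < 1 := by simpa using hy
      rw [← ofReal_norm, ENNReal.ofReal_lt_one] at this
      exact this.le
    have h := (hc.summable_mul_monom hy1).hasSum
    rw [← (Finset.HasAntidiagonal.sigmaAntidiagonalEquivProd.trans biExpEquiv.symm).hasSum_iff] at h
    have h2 := h.sigma fun k => hasSum_fintype _
    rw [zero_add]
    refine (funext fun k => ?_ : (fun k => multilinearSeries c k fun _ => y) = _) ▸ h2
    rw [multilinearSeries_apply, ← Finset.sum_coe_sort]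
    rfl

lemma AbsSummable.analyticAt_evalSeries {c : BiExp → ℂ} (hc : AbsSummable c) :
    AnalyticAt ℂ (evalSeries c) 0 :=
  hc.hasFPowerSeriesOnBall.analyticAt

end Analytic

section Coefficients

open Classical in
lemma multilinear_apply_eq_sum {k : ℕ} (q : (ℂ × ℂ) [×k]→L[ℂ] ℂ) (p : ℂ × ℂ) :
    q (fun _ => p) = ∑ s : Finset (Fin k),
      monom (biExpEquiv.symm (s.card, k - s.card)) p * q (s.piecewise (fun _ => (1, 0))
        (fun _ => (0, 1))) := by
  have hp : (fun _ : Fin k => p) = (fun _ => p.1 • ((1, 0) : ℂ × ℂ)) +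
      fun _ => p.2 • ((0, 1) : ℂ × ℂ) := by
    ext <;> simp
  rw [hp, q.map_add_univ]
  refine Finset.sum_congr rfl fun s _ => ?_
  have hs : s.piecewise (fun _ => p.1 • ((1, 0) : ℂ × ℂ)) (fun _ => p.2 • ((0, 1) : ℂ × ℂ)) =
      fun i => (if i ∈ s then p.1 else p.2) •
        s.piecewise (fun _ => ((1, 0) : ℂ × ℂ)) (fun _ => (0, 1)) i := by
    funext i
    by_cases hi : i ∈ s <;> simp [hi]
  rw [hs, q.map_smul_univ, Finset.prod_ite, smul_eq_mul]
  simp [monom, Finset.filter_not, Finset.card_sdiff]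

open Classical in
lemma norm_multilinear_piecewise_le {k : ℕ} (q : (ℂ × ℂ) [×k]→L[ℂ] ℂ) (s : Finset (Fin k)) :
    ‖q (s.piecewise (fun _ => (1, 0)) (fun _ => (0, 1)))‖ ≤ ‖q‖ := by
  refine (q.le_opNorm _).trans (mul_le_of_le_one_right (norm_nonneg _) ?_)
  refine Finset.prod_le_one (fun _ _ => norm_nonneg _) fun i _ => ?_
  by_cases hi : i ∈ s <;> simp [hi, Prod.norm_def]

/-- An analytic germ is, up to a homothety, the germ of an element of the Wiener algebra. -/
lemma AnalyticAt.exists_wiener {a : ℂ × ℂ → ℂ} (ha : AnalyticAt ℂ a 0) :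
    ∃ t : ℝ, 0 < t ∧ ∃ f : Wiener, ∀ᶠ p in nhds (0 : ℂ × ℂ),
      a ((t : ℂ) • p) = evalSeries (fun d => Wiener.coeff d f) p := by
  classical
  obtain ⟨q, R, hq⟩ := ha
  obtain ⟨ρ, hρ0, hρR⟩ := ENNReal.lt_iff_exists_nnreal_btwn.mp hq.r_pos
  have hρ : 0 < ρ := by exact_mod_cast hρ0
  obtain ⟨C, hC, hqC⟩ := q.norm_mul_pow_le_of_lt_radius (hρR.trans_le hq.r_le)
  set t : ℝ := ρ / 4 with ht
  have ht0 : 0 < t := by positivity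
  let g (k : ℕ) : Wiener := ∑ s : Finset (Fin k), ((t : ℂ) ^ k * q k (s.piecewise
    (fun _ => (1, 0)) (fun _ => (0, 1)))) • Wiener.monomial (biExpEquiv.symm (s.card, k - s.card))
  have hg (k : ℕ) : ‖g k‖ ≤ C * (1 / 2 : ℝ) ^ k := by
    have h1 : ‖g k‖ ≤ ∑ s : Finset (Fin k), t ^ k * ‖q k‖ := by
      refine (norm_sum_le _ _).trans (Finset.sum_le_sum fun s _ => ?_)
      rw [norm_smul, Wiener.norm_monomial, mul_one, norm_mul, norm_pow, Complex.norm_real,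
        Real.norm_of_nonneg ht0.le]
      exact mul_le_mul_of_nonneg_left (norm_multilinear_piecewise_le _ s) (by positivity)
    refine h1.trans ?_
    rw [Finset.sum_const, Finset.card_univ, Fintype.card_finset, Fintype.card_fin, nsmul_eq_mul]
    have h2 : ((2 ^ k : ℕ) : ℝ) * (t ^ k * ‖q k‖) = ‖q k‖ * ρ ^ k * (1 / 2 : ℝ) ^ k := by
      have : t = ρ * (1 / 2) * (1 / 2) := by rw [ht]; ring
      rw [this, mul_pow, mul_pow]
      push_cast
      have h3 : (2 : ℝ) ^ k * (1 / 2) ^ k = 1 := by rw [← mul_pow]; norm_num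
      linear_combination (ρ ^ k * (1 / 2) ^ k * ‖q k‖) * h3
    rw [h2]
    exact mul_le_mul_of_nonneg_right (hqC k) (by positivity)
  have hgs : Summable g := Summable.of_norm_bounded
    ((summable_geometric_of_lt_one (by norm_num) (by norm_num)).mul_left C) hg
  refine ⟨t, ht0, ∑' k, g k, ?_⟩
  filter_upwards [Metric.closedBall_mem_nhds (0 : ℂ × ℂ) one_pos] with p hp
  have hp1 : ‖p‖ ≤ 1 := mem_closedBall_zero_iff.mp hp
  have h1 : HasSum (Wiener.eval p hp1 ∘ g)
      (evalSeries (fun d => Wiener.coeff d (∑' k, g k)) p) :=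
    hgs.hasSum.map (Wiener.eval p hp1) (Wiener.continuous_eval p hp1)
  have h2 : HasSum (fun k => q k fun _ => (t : ℂ) • p) (a (0 + (t : ℂ) • p)) := by
    refine hq.hasSum ?_
    refine Metric.eball_subset_eball hρR.le ?_
    rw [mem_eball_zero_iff, ← ofReal_norm, norm_smul, Complex.norm_real,
      Real.norm_of_nonneg ht0.le, ← ENNReal.ofReal_coe_nnreal,
      ENNReal.ofReal_lt_ofReal_iff (by positivity)]
    have : (0 : ℝ) < ρ := hρ
    nlinarith
  rw [zero_add] at h2
  refine h2.unique ?_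
  convert h1 using 1
  ext k
  simp only [Function.comp_apply, g, map_sum, map_smul, Wiener.eval_monomial, smul_eq_mul]
  rw [(q k).map_smul_univ (fun _ => (t : ℂ)) (fun _ => p), multilinear_apply_eq_sum, smul_eq_mul,
    Finset.mul_sum]
  refine Finset.sum_congr rfl fun s _ => ?_
  simp only [Finset.prod_const, Finset.card_univ, Fintype.card_fin]
  ring

end Coefficients

section FixedPoint

variable {E : Type*} [NormedCommRing E] [NormedAlgebra ℂ E] [CompleteSpace E]

lemma norm_mul_sub_mul_le {R : Type*} [NormedCommRing R] (a b a' b' : R) :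
    ‖a * b - a' * b'‖ ≤ ‖a - a'‖ * ‖b‖ + ‖a'‖ * ‖b - b'‖ := by
  have : a * b - a' * b' = (a - a') * b + a' * (b - b') := by ring
  rw [this]
  exact (norm_add_le _ _).trans (add_le_add (norm_mul_le _ _) (norm_mul_le _ _))

lemma exists_eq_nonlinear_sub_mul (N : E → E) (P Q Θ T : E →L[ℂ] E) {L : ℝ} (hL : 1 ≤ L)
    (hP : ∀ c, ‖P c‖ ≤ L * ‖c‖) (hQ : ∀ c, ‖Q c‖ ≤ ‖c‖) (hΘ : ∀ c, ‖Θ c‖ ≤ L * ‖c‖)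
    (hT : ∀ c, ‖T c‖ ≤ 1 / 2 * ‖c‖)
    (hN : ∀ u v, ‖u‖ ≤ 1 → ‖v‖ ≤ 1 → ‖N u - N v‖ ≤ (128 * L)⁻¹ * ‖u - v‖)
    (hN0 : ‖N 0‖ ≤ (128 * L)⁻¹) :
    ∃ c, ‖P c‖ ≤ 1 ∧ c = N (P c) - Q c * P c - Q c * Θ c - T c := by
  set η := (32 * L)⁻¹ with hη
  have hLη : L * η = 1 / 32 := by rw [hη]; field_simp
  have hη0 : 0 < η := by positivity
  set G : E → E := fun c => N (P c) - Q c * P c - Q c * Θ c - T c with hG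
  have hlip (c c' : E) (hc : ‖c‖ ≤ η) (hc' : ‖c'‖ ≤ η) : ‖G c - G c'‖ ≤ 3 / 4 * ‖c - c'‖ := by
    have hsmall (M : E →L[ℂ] E) (hM : ∀ c, ‖M c‖ ≤ L * ‖c‖) (c : E) (hc : ‖c‖ ≤ η) :
        ‖M c‖ ≤ 1 / 32 := by
      rw [← hLη]
      exact (hM c).trans (by gcongr)
    have hprod (M : E →L[ℂ] E) (hM : ∀ c, ‖M c‖ ≤ L * ‖c‖) :
        ‖Q c * M c - Q c' * M c'‖ ≤ 1 / 16 * ‖c - c'‖ := by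
      refine (norm_mul_sub_mul_le _ _ _ _).trans ?_
      rw [← map_sub, ← map_sub]
      have h1 : ‖Q (c - c')‖ * ‖M c‖ ≤ ‖c - c'‖ * (1 / 32) :=
        mul_le_mul (hQ _) (hsmall M hM c hc) (norm_nonneg _) (norm_nonneg _)
      have h2 : ‖Q c'‖ * ‖M (c - c')‖ ≤ η * (L * ‖c - c'‖) :=
        mul_le_mul ((hQ _).trans hc') (hM _) (norm_nonneg _) hη0.le
      have h3 : η * (L * ‖c - c'‖) = 1 / 32 * ‖c - c'‖ := by rw [← hLη]; ring
      linarith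
    have h1 : ‖N (P c) - N (P c')‖ ≤ 1 / 128 * ‖c - c'‖ := by
      refine (hN _ _ ((hsmall P hP c hc).trans (by norm_num))
        ((hsmall P hP c' hc').trans (by norm_num))).trans ?_
      rw [← map_sub]
      calc (128 * L)⁻¹ * ‖P (c - c')‖ ≤ (128 * L)⁻¹ * (L * ‖c - c'‖) := by gcongr; exact hP _
        _ = 1 / 128 * ‖c - c'‖ := by field_simp
    have h2 := hprod P hP
    have h3 := hprod Θ hΘ
    have h4 : ‖T c - T c'‖ ≤ 1 / 2 * ‖c - c'‖ := by rw [← map_sub]; exact hT _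
    have h5 : G c - G c' = (N (P c) - N (P c')) - (Q c * P c - Q c' * P c') -
        (Q c * Θ c - Q c' * Θ c') - (T c - T c') := by simp only [hG]; ring
    rw [h5]
    refine (norm_sub_le _ _).trans ?_
    have h6 := norm_sub_le (N (P c) - N (P c') - (Q c * P c - Q c' * P c'))
      (Q c * Θ c - Q c' * Θ c')
    have h7 := norm_sub_le (N (P c) - N (P c')) (Q c * P c - Q c' * P c')
    have := norm_nonneg (c - c')
    linarith
  have hG0 : ‖G 0‖ ≤ η / 4 := by
    have : η / 4 = (128 * L)⁻¹ := by rw [hη]; field_simp; norm_num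
    rw [this]
    simpa [hG] using hN0
  have hmaps : Set.MapsTo G (Metric.closedBall 0 η) (Metric.closedBall 0 η) := by
    intro c hc
    rw [mem_closedBall_zero_iff] at hc ⊢
    have h1 := hlip c 0 hc (by simpa using hη0.le)
    rw [sub_zero] at h1
    have h2 := norm_sub_norm_le (G c) (G 0)
    linarith
  have hcontr : ContractingWith (3 / 4 : NNReal) (hmaps.restrict G _ _) := by
    refine ⟨by rw [← NNReal.coe_lt_coe]; norm_num, LipschitzWith.of_dist_le_mul fun c c' => ?_⟩
    have h := hlip c c' (mem_closedBall_zero_iff.mp c.2) (mem_closedBall_zero_iff.mp c'.2)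
    rw [Subtype.dist_eq, Subtype.dist_eq, dist_eq_norm, dist_eq_norm]
    simpa using h
  obtain ⟨c, hcη, hc, -⟩ := hcontr.exists_fixedPoint' (Metric.isClosed_closedBall.isComplete) hmaps
    (Metric.mem_closedBall_self hη0.le) (edist_ne_top _ _)
  refine ⟨c, (hP c).trans ?_, hc.symm⟩
  have := mul_le_mul_of_nonneg_left (mem_closedBall_zero_iff.mp hcη) (zero_le_one.trans hL)
  linarith

end FixedPoint

lemma norm_pow_sub_pow_le {R : Type*} [NormedCommRing R] [NormOneClass R] {u v : R} {C : ℝ}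
    (hu : ‖u‖ ≤ C) (hv : ‖v‖ ≤ C) (n : ℕ) :
    ‖u ^ (n + 1) - v ^ (n + 1)‖ ≤ (n + 1) * C ^ n * ‖u - v‖ := by
  have hC : 0 ≤ C := (norm_nonneg u).trans hu
  induction n with
  | zero => simp
  | succ n ih =>
    rw [pow_succ, pow_succ v]
    refine (norm_mul_sub_mul_le _ _ _ _).trans ?_
    have h1 : ‖v ^ (n + 1)‖ ≤ C ^ (n + 1) := (norm_pow_le _ _).trans (by gcongr)
    have h2 := mul_le_mul ih hu (norm_nonneg _) (by positivity)
    have h3 := mul_le_mul_of_nonneg_right h1 (norm_nonneg (u - v))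
    push_cast
    calc _ ≤ _ := add_le_add h2 h3
      _ = _ := by ring

lemma succ_mul_two_pow_le (n : ℕ) : ((n : ℝ) + 1) * 2 ^ n ≤ 4 ^ n := by
  have h : n + 1 ≤ 2 ^ n := Nat.lt_two_pow_self
  have h' : ((n : ℝ) + 1) ≤ 2 ^ n := by exact_mod_cast h
  calc ((n : ℝ) + 1) * 2 ^ n ≤ 2 ^ n * 2 ^ n := by gcongr
    _ = 4 ^ n := by rw [← mul_pow]; norm_num

namespace Wiener

noncomputable section

/-- The substitution `u ↦ (1 + u) * A(x, y * (1 + u))`. -/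
def substSeries (A : BiExp → ℂ) (u : Wiener) : Wiener :=
  ∑' d, A d • (monomial d * (1 + u) ^ (d 1 + 1))

variable {A : BiExp → ℂ}

lemma norm_monomial_mul_le (d : BiExp) (u : Wiener) : ‖monomial d * u‖ ≤ ‖u‖ :=
  (norm_mul_le _ _).trans (by rw [norm_monomial, one_mul])

lemma norm_one_add_le {u : Wiener} (hu : ‖u‖ ≤ 1) : ‖1 + u‖ ≤ 2 :=
  (norm_add_le _ _).trans (by rw [norm_one]; linarith)

lemma summable_substSeries (hA : Summable fun d => ‖A d‖ * 4 ^ d 1) {u : Wiener} (hu : ‖u‖ ≤ 1) :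
    Summable fun d => A d • (monomial d * (1 + u) ^ (d 1 + 1)) := by
  refine Summable.of_norm_bounded (hA.mul_left 2) fun d => ?_
  rw [norm_smul]
  have h1 : ‖(1 + u) ^ (d 1 + 1)‖ ≤ 2 ^ (d 1 + 1) :=
    (norm_pow_le _ _).trans (by gcongr; exact norm_one_add_le hu)
  have h2 : (2 : ℝ) ^ (d 1 + 1) ≤ 2 * 4 ^ d 1 := by
    rw [pow_succ, mul_comm]
    gcongr
    norm_num
  calc ‖A d‖ * ‖monomial d * (1 + u) ^ (d 1 + 1)‖ ≤ ‖A d‖ * (2 * 4 ^ d 1) := by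
        gcongr
        exact (norm_monomial_mul_le _ _).trans (h1.trans h2)
    _ = 2 * (‖A d‖ * 4 ^ d 1) := by ring

lemma norm_substSeries_sub_le (hA : Summable fun d => ‖A d‖ * 4 ^ d 1) {u v : Wiener}
    (hu : ‖u‖ ≤ 1) (hv : ‖v‖ ≤ 1) :
    ‖substSeries A u - substSeries A v‖ ≤ (∑' d, ‖A d‖ * 4 ^ d 1) * ‖u - v‖ := by
  rw [substSeries, substSeries,
    ← (summable_substSeries hA hu).tsum_sub (summable_substSeries hA hv), ← tsum_mul_right]
  refine tsum_of_norm_bounded (hA.mul_right _).hasSum fun d => ?_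
  rw [← smul_sub, ← mul_sub, norm_smul, mul_assoc]
  refine mul_le_mul_of_nonneg_left ?_ (norm_nonneg _)
  refine (norm_monomial_mul_le _ _).trans ?_
  refine (norm_pow_sub_pow_le (norm_one_add_le hu) (norm_one_add_le hv) (d 1)).trans ?_
  rw [add_sub_add_left_eq_sub]
  exact mul_le_mul_of_nonneg_right (succ_mul_two_pow_le _) (norm_nonneg _)

lemma norm_substSeries_zero_le (hA : Summable fun d => ‖A d‖ * 4 ^ d 1) :
    ‖substSeries A 0‖ ≤ ∑' d, ‖A d‖ * 4 ^ d 1 := by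
  refine tsum_of_norm_bounded hA.hasSum fun d => ?_
  rw [norm_smul, add_zero, one_pow, mul_one, norm_monomial]
  exact mul_le_mul_of_nonneg_left (one_le_pow₀ (by norm_num)) (norm_nonneg _)

lemma eval_substSeries (hA : Summable fun d => ‖A d‖ * 4 ^ d 1) {u : Wiener} (hu : ‖u‖ ≤ 1)
    (p : ℂ × ℂ) (hp : ‖p‖ ≤ 1) :
    eval p hp (substSeries A u) =
      (1 + eval p hp u) * evalSeries A (p.1, p.2 * (1 + eval p hp u)) := by
  have h := (summable_substSeries hA hu).hasSum.map (eval p hp) (continuous_eval p hp)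
  rw [substSeries, ← h.tsum_eq, evalSeries, ← tsum_mul_left]
  refine tsum_congr fun d => ?_
  simp only [Function.comp_apply, map_smul, map_mul, map_pow, map_add, map_one, eval_monomial,
    smul_eq_mul, monom, mul_pow]
  ring

end

end Wiener

section Homological

/-- A bound on the small divisors `n * μ + j` outside the sector `j ≤ κ * n`. -/
def DivisorBound (μ : ℂ) (r : ℝ) (κ : ℕ) : Prop :=
  ∀ j n : ℕ, 1 ≤ n → κ * n < j → 2 * n ≤ r * ‖(n : ℂ) * μ + j‖

/-- The inverse of the divisor `n * μ + j` outside the sector `j ≤ κ * n`, and zero inside. -/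
noncomputable def divisorInv (μ : ℂ) (κ : ℕ) (d : BiExp) : ℂ :=
  if κ * d 1 < d 0 then ((d 1 : ℂ) * μ + d 0)⁻¹ else 0

/-- The indicator of the sector `j ≤ κ * n`. -/
def sectorInd (κ : ℕ) (d : BiExp) : ℂ := if κ * d 1 < d 0 then 0 else 1

lemma norm_sectorInd_le (κ : ℕ) (d : BiExp) : ‖sectorInd κ d‖ ≤ 1 := by
  rw [sectorInd]
  split_ifs <;> simp

variable {μ : ℂ} {r : ℝ} {κ : ℕ}

lemma norm_mul_divisorInv_le (hr : 0 < r) (h : DivisorBound μ r κ) (d : BiExp) :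
    ‖(d 1 : ℂ) * divisorInv μ κ d‖ ≤ r / 2 := by
  rw [divisorInv]
  split_ifs with hd
  · rcases Nat.eq_zero_or_pos (d 1) with h1 | h1
    · simp only [h1, Nat.cast_zero, zero_mul, norm_zero]
      positivity
    · have h2 := h _ _ h1 hd
      have h3 : (1 : ℝ) ≤ d 1 := by exact_mod_cast h1
      have h4 : 0 < ‖(d 1 : ℂ) * μ + d 0‖ := by
        by_contra! h5
        nlinarith
      rw [norm_mul, norm_inv, Complex.norm_natCast, ← div_eq_mul_inv, div_le_iff₀ h4]
      linarith
  · rw [mul_zero, norm_zero]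
    positivity

lemma norm_divisorInv_le (hr : 0 < r) (h : DivisorBound μ r κ) (d : BiExp) :
    ‖divisorInv μ κ d‖ ≤ 1 + r := by
  rcases Nat.eq_zero_or_pos (d 1) with h1 | h1
  · rw [divisorInv]
    split_ifs with hd
    · have h2 : (1 : ℝ) ≤ d 0 := by exact_mod_cast (by omega : 1 ≤ d 0)
      rw [h1, Nat.cast_zero, zero_mul, zero_add, norm_inv, Complex.norm_natCast]
      linarith [inv_le_one_of_one_le₀ h2]
    · simp; linarith
  · have h2 := norm_mul_divisorInv_le hr h d
    rw [norm_mul, Complex.norm_natCast] at h2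
    have h3 : (1 : ℝ) ≤ d 1 := by exact_mod_cast h1
    have := norm_nonneg (divisorInv μ κ d)
    nlinarith

lemma divisor_mul_divisorInv (h : DivisorBound μ r κ) (d : BiExp) :
    ((d 1 : ℂ) * μ + d 0) * divisorInv μ κ d = 1 - sectorInd κ d := by
  rw [divisorInv, sectorInd]
  split_ifs with hd
  · rw [sub_zero]
    refine mul_inv_cancel₀ ?_
    rcases Nat.eq_zero_or_pos (d 1) with h1 | h1
    · rw [h1, Nat.cast_zero, zero_mul, zero_add]
      exact_mod_cast (by omega : d 0 ≠ 0)
    · intro h0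
      have h2 := h _ _ h1 hd
      rw [h0, norm_zero, mul_zero] at h2
      have h3 : (1 : ℝ) ≤ d 1 := by exact_mod_cast h1
      linarith
  · ring

lemma evalSeries_of_fst_zero {f : BiExp → ℂ} (hf : ∀ d, d 0 = 0 → f d = 0) (p : ℂ × ℂ) :
    evalSeries f p = p.1 * evalSeries (fun d => f (d + Finsupp.single 0 1)) p := by
  rw [evalSeries, evalSeries, ← tsum_mul_left,
    ← (add_left_injective (Finsupp.single (0 : Fin 2) 1)).tsum_eq]
  · refine tsum_congr fun d => ?_
    rw [monom_add]
    simp [monom]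
    ring
  · intro d hd
    have h0 : d 0 ≠ 0 := fun h => hd (by simp [hf d h])
    refine ⟨d - Finsupp.single 0 1, tsub_add_cancel_of_le ?_⟩
    rw [Finsupp.single_le_iff]
    omega

/-- Solution of the homological equation: the germ of coordinate change
`(x, y) ↦ (x, y * (1 + U))` and the remaining term `α`, supported in a sector of exponents. -/
lemma exists_homological_solution (hr : 0 < r) (h : DivisorBound μ r κ) {A : BiExp → ℂ}
    (hA0 : A 0 = 0) (hA : Summable fun d => ‖A d‖ * 4 ^ d 1)
    (hAε : ∑' d, ‖A d‖ * 4 ^ d 1 ≤ (128 * (1 + r))⁻¹) :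
    ∃ U α : BiExp → ℂ, AbsSummable U ∧ AbsSummable α ∧ U 0 = 0 ∧ α 0 = 0 ∧
      (∀ d, κ * d 1 < d 0 → α d = 0) ∧
      ∀ p : ℂ × ℂ, ‖p‖ < 1 → fderiv ℂ (evalSeries U) p
        (p.1 * (r * p.1), p.2 * (1 + r * p.1 * (μ + evalSeries α p))) =
        r * p.1 * (1 + evalSeries U p) *
          (evalSeries A (p.1, p.2 * (1 + evalSeries U p)) - evalSeries α p) := by
  have hr' : (r : ℂ) ≠ 0 := by exact_mod_cast hr.ne'
  have hid := Function.injective_id (α := BiExp)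
  have hsh := add_left_injective (Finsupp.single (0 : Fin 2) 1 : BiExp)
  let P := Wiener.weightedComp (divisorInv μ κ) id hid (1 + r) (norm_divisorInv_le hr h)
  let Q := Wiener.weightedComp (sectorInd κ) id hid 1 (norm_sectorInd_le κ)
  let Θ := Wiener.weightedComp _ id hid (r / 2) (norm_mul_divisorInv_le hr h)
  have hTb (d : BiExp) : ‖(r : ℂ)⁻¹ * (((d + Finsupp.single 0 1 : BiExp) 1 : ℂ) *
      divisorInv μ κ (d + Finsupp.single 0 1))‖ ≤ 1 / 2 := by
    rw [norm_mul, norm_inv, Complex.norm_real, Real.norm_of_nonneg hr.le, inv_mul_le_iff₀ hr]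
    linarith [norm_mul_divisorInv_le hr h (d + Finsupp.single 0 1)]
  let T := Wiener.weightedComp _ (fun d : BiExp => d + Finsupp.single 0 1) hsh (1 / 2) hTb
  obtain ⟨c, hPc, hc⟩ := exists_eq_nonlinear_sub_mul (Wiener.substSeries A) P Q Θ T
    (L := 1 + r) (by linarith) (Wiener.norm_weightedComp_le _ _ _ _ _)
    (fun c => (Wiener.norm_weightedComp_le _ _ _ _ _ c).trans (by rw [one_mul]))
    (fun c => (Wiener.norm_weightedComp_le _ _ _ _ _ c).trans (by gcongr; linarith))
    (Wiener.norm_weightedComp_le _ _ _ _ _)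
    (fun u v hu hv => (Wiener.norm_substSeries_sub_le hA hu hv).trans (by gcongr))
    ((Wiener.norm_substSeries_zero_le hA).trans hAε)
  have hev (p : ℂ × ℂ) (hp : ‖p‖ ≤ 1) := congrArg (Wiener.eval p hp) hc
  simp only [map_sub, map_mul, Wiener.eval_substSeries hA hPc] at hev
  have hΘT (p : ℂ × ℂ) (hp : ‖p‖ ≤ 1) :
      Wiener.eval p hp (Θ c) = r * p.1 * Wiener.eval p hp (T c) := by
    rw [Wiener.eval_apply, evalSeries_of_fst_zero (fun d hd => by simp [Θ, divisorInv, hd]),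
      Wiener.eval_apply, mul_comm (r : ℂ), mul_assoc]
    simp only [evalSeries, ← tsum_mul_left]
    refine tsum_congr fun d => ?_
    simp only [Θ, T, Wiener.coeff_weightedComp, id]
    field_simp
  have hPs : AbsSummable fun d => Wiener.coeff d (P c) := (P c).summable_norm_coeff
  have hU0 : Wiener.coeff 0 (P c) = 0 := by simp [P, divisorInv]
  refine ⟨fun d => Wiener.coeff d (P c), fun d => Wiener.coeff d (Q c), hPs,
    (Q c).summable_norm_coeff, hU0, ?_, ?_, ?_⟩
  · have h1 := hev 0 (by simp)
    simp only [Wiener.eval_apply, evalSeries_zero, hU0] at h1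
    have hT0 : Wiener.coeff 0 (T c) = 0 := by simp [T]
    have hQ0 : Wiener.coeff 0 (Q c) = Wiener.coeff 0 c := by simp [Q, sectorInd]
    have hΘ0 : Wiener.coeff 0 (Θ c) = 0 := by simp [Θ]
    have hA0' : evalSeries A ((0 : ℂ × ℂ).1, (0 : ℂ × ℂ).2 * (1 + 0)) = 0 := by
      simp [hA0, evalSeries_zero, Prod.mk_zero_zero]
    rw [hT0, hΘ0, hA0'] at h1
    change Wiener.coeff 0 (Q c) = 0
    rw [hQ0, h1]
    ring
  · intro d hd
    simp [Q, sectorInd, hd]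
  · intro p hp
    have hsum := hPs.fderiv_evalSeries_apply hp (r * p.1)
      (1 + r * p.1 * (μ + evalSeries (fun d => Wiener.coeff d (Q c)) p))
    set α := evalSeries (fun d => Wiener.coeff d (Q c)) p with hα
    have hC := (c.summable_coeff_mul_monom hp.le).hasSum
    have hQ := ((Q c).summable_coeff_mul_monom hp.le).hasSum
    have hΘ := ((Θ c).summable_coeff_mul_monom hp.le).hasSum
    have hR := ((hC.sub hQ).mul_left (r * p.1)).add (hΘ.mul_left (1 + r * p.1 * α))
    have hSR := hsum.tsum_eq.symm.trans ((tsum_congr fun d => ?_).trans hR.tsum_eq)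
    · have h1 := hev p hp.le
      have h2 := hΘT p hp.le
      simp only [Wiener.eval_apply] at h1 h2
      rw [← hα] at h1
      rw [hSR]
      change r * p.1 * (evalSeries (fun d => Wiener.coeff d c) p - α) +
        (1 + r * p.1 * α) * evalSeries (fun d => Wiener.coeff d (Θ c)) p = _
      linear_combination r * p.1 * h1 + h2
    · have h1 := divisor_mul_divisorInv h d
      simp only [P, Q, Θ, Wiener.coeff_weightedComp, id]
      linear_combination r * p.1 * Wiener.coeff d c * monom d p * h1

end Homological

section Conjugacy

/-- Conjugacy of germs at `0` of holomorphic vector fields, by a germ of biholomorphism. -/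
def GermConjugate (X X' : ℂ × ℂ → ℂ × ℂ) : Prop :=
  ∃ (Φ : ℂ × ℂ → ℂ × ℂ) (e : (ℂ × ℂ) ≃L[ℂ] ℂ × ℂ), AnalyticAt ℂ Φ 0 ∧ Φ 0 = 0 ∧
    HasFDerivAt Φ (e : ℂ × ℂ →L[ℂ] ℂ × ℂ) 0 ∧
    ∀ᶠ p in nhds (0 : ℂ × ℂ), fderiv ℂ Φ p (X p) = X' (Φ p)

variable {X Y Z : ℂ × ℂ → ℂ × ℂ}

lemma GermConjugate.foliationEquiv (h : GermConjugate X Y) : FoliationEquiv X Y := by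
  obtain ⟨Φ, e, hΦ, h0, he, hXY⟩ := h
  refine ⟨Φ, fun _ => 1, hΦ, h0, ?_, analyticAt_const, one_ne_zero, by simpa using hXY⟩
  rw [he.fderiv]
  exact (LinearEquiv.isUnit_det' e.toLinearEquiv).ne_zero

lemma GermConjugate.trans (h : GermConjugate X Y) (h' : GermConjugate Y Z) :
    GermConjugate X Z := by
  obtain ⟨Φ, e, hΦ, h0, he, hXY⟩ := h
  obtain ⟨Ψ, e', hΨ, h0', he', hYZ⟩ := h'
  have hΨ0 : AnalyticAt ℂ Ψ (Φ 0) := by rwa [h0]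
  refine ⟨Ψ ∘ Φ, e.trans e', hΨ0.comp hΦ, by simp [h0, h0'], ?_, ?_⟩
  · rw [← h0] at he'
    exact he'.comp 0 he
  · have ht : Tendsto Φ (nhds 0) (nhds 0) := by simpa [ContinuousAt, h0] using hΦ.continuousAt
    filter_upwards [hXY, ht.eventually hYZ, hΦ.eventually_analyticAt,
      ht.eventually hΨ.eventually_analyticAt] with p h1 h2 h3 h4
    rw [fderiv_comp p h4.differentiableAt h3.differentiableAt, ContinuousLinearMap.comp_apply, h1,
      h2, Function.comp_apply]

lemma GermConjugate.symm (h : GermConjugate X Y) : GermConjugate Y X := by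
  obtain ⟨Φ, e, hΦ, h0, he, hXY⟩ := h
  have hs : HasStrictFDerivAt Φ (e : ℂ × ℂ →L[ℂ] ℂ × ℂ) 0 := by
    rw [← he.fderiv]
    exact hΦ.hasStrictFDerivAt
  set g := hs.localInverse Φ e 0 with hg
  have hg0 : g 0 = 0 := by
    have := hs.localInverse_apply_image
    rwa [h0] at this
  have hga : AnalyticAt ℂ g 0 := by
    have := (hs.toOpenPartialHomeomorph Φ).analyticAt_symm' (i := e)
      hs.mem_toOpenPartialHomeomorph_source hΦ he.fderiv
    rwa [hs.toOpenPartialHomeomorph_coe, h0] at this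
  have hge := hs.to_localInverse.hasFDerivAt
  rw [h0] at hge
  refine ⟨g, e.symm, hga, hg0, hge, ?_⟩
  have ht : Tendsto g (nhds 0) (nhds 0) := by simpa [ContinuousAt, hg0] using hga.continuousAt
  have hright := hs.eventually_right_inverse
  rw [h0] at hright
  filter_upwards [hright, ht.eventually hXY, ht.eventually hΦ.eventually_analyticAt,
    ht.eventually hs.eventually_left_inverse.eventually_nhds, hga.eventually_analyticAt]
    with q (h1 : Φ (g q) = q) h2 h3 h4 h5
  have h6 : fderiv ℂ (g ∘ Φ) (g q) = ContinuousLinearMap.id ℂ _ := by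
    have h4' : g ∘ Φ =ᶠ[nhds (g q)] id := h4
    rw [h4'.fderiv_eq, fderiv_id]
  have h5' : AnalyticAt ℂ g (Φ (g q)) := by rwa [h1]
  rw [fderiv_comp _ h5'.differentiableAt h3.differentiableAt] at h6
  have h7 := congrArg (fun M : ℂ × ℂ →L[ℂ] ℂ × ℂ => M (X (g q))) h6
  simp only [ContinuousLinearMap.comp_apply, ContinuousLinearMap.id_apply] at h7
  rwa [h2, h1] at h7

lemma GermConjugate.of_eventuallyEq (h : ∀ᶠ p in nhds (0 : ℂ × ℂ), X p = Y p) :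
    GermConjugate X Y :=
  ⟨id, .refl ℂ _, analyticAt_id, rfl, hasFDerivAt_id 0, by simpa using h⟩

/-- The saddle-node vector field `r x²∂x + (y + r x y f(x,y))∂y`. -/
def saddleField (r : ℂ) (f : ℂ × ℂ → ℂ) (p : ℂ × ℂ) : ℂ × ℂ :=
  (r * p.1 ^ 2, p.2 + r * p.1 * p.2 * f p)

lemma saddleField_scale (r : ℂ) (f : ℂ × ℂ → ℂ) {s t : ℂ} (hs : s ≠ 0) (ht : t ≠ 0) :
    GermConjugate (saddleField (r * s) fun p => f (s * p.1, t * p.2)) (saddleField r f) := by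
  let e : (ℂ × ℂ) ≃L[ℂ] ℂ × ℂ := (ContinuousLinearEquiv.smulLeft (Units.mk0 s hs)).prodCongr
    (ContinuousLinearEquiv.smulLeft (Units.mk0 t ht))
  have he (p : ℂ × ℂ) : e p = (s * p.1, t * p.2) := rfl
  refine ⟨e, e, e.analyticAt 0, map_zero e, e.hasFDerivAt, Eventually.of_forall fun p => ?_⟩
  rw [e.fderiv]
  change e _ = _
  simp only [he, saddleField]
  ext
  · simp only; ring
  · simp only; ring

end Conjugacy

section NormalForm

lemma exists_conjugate_sector {μ : ℂ} {r : ℝ} {κ : ℕ} (hr : 0 < r) (h : DivisorBound μ r κ)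
    {A : BiExp → ℂ} (hA0 : A 0 = 0) (hA : Summable fun d => ‖A d‖ * 4 ^ d 1)
    (hAε : ∑' d, ‖A d‖ * 4 ^ d 1 ≤ (128 * (1 + r))⁻¹) :
    ∃ α : BiExp → ℂ, AbsSummable α ∧ α 0 = 0 ∧ (∀ d, κ * d 1 < d 0 → α d = 0) ∧
      GermConjugate (saddleField r fun p => μ + evalSeries α p)
        (saddleField r fun p => μ + evalSeries A p) := by
  obtain ⟨U, α, hU, hα, hU0, hα0, hαs, hpde⟩ := exists_homological_solution hr h hA0 hA hAε
  refine ⟨α, hα, hα0, hαs, fun p => (p.1, p.2 * (1 + evalSeries U p)), .refl ℂ _, ?_, ?_, ?_, ?_⟩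
  · exact analyticAt_fst.prod (analyticAt_snd.mul (analyticAt_const.add hU.analyticAt_evalSeries))
  · simp
  · have h1 := (hU.hasFDerivAt_evalSeries (p := 0) (by simp)).1.const_add 1
    have h2 := (hasFDerivAt_fst (𝕜 := ℂ) (E := ℂ) (F := ℂ) (p := 0)).prodMk
      (hasFDerivAt_snd.mul h1)
    refine h2.congr_fderiv ?_
    ext <;> simp [evalSeries_zero, hU0]
  · filter_upwards [Metric.ball_mem_nhds (0 : ℂ × ℂ) one_pos] with p hp
    have hp1 : ‖p‖ < 1 := mem_ball_zero_iff.mp hp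
    have h1 := (hU.hasFDerivAt_evalSeries hp1).1.const_add 1
    have h2 := (hasFDerivAt_fst (𝕜 := ℂ) (E := ℂ) (F := ℂ) (p := p)).prodMk
      (hasFDerivAt_snd.mul h1)
    have h3 := hpde p hp1
    rw [(hU.hasFDerivAt_evalSeries hp1).1.fderiv] at h3
    have hX : saddleField r (fun p => μ + evalSeries α p) p =
        (p.1 * (r * p.1), p.2 * (1 + r * p.1 * (μ + evalSeries α p))) := by
      simp only [saddleField]
      ext
      · simp only; ring
      · simp only; ring
    have h4 : fderiv ℂ (fun p : ℂ × ℂ => (p.1, p.2 * (1 + evalSeries U p))) p = _ := h2.fderiv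
    rw [h4, hX]
    ext
    · simp [saddleField]; ring
    · simp only [ContinuousLinearMap.prod_apply, add_apply, smul_apply, h3, saddleField,
        ContinuousLinearMap.coe_snd', smul_eq_mul]
      ring

lemma evalSeries_scale (c : BiExp → ℂ) (s t : ℂ) (p : ℂ × ℂ) :
    evalSeries c (s * p.1, t * p.2) = evalSeries (fun d => c d * (s ^ d 0 * t ^ d 1)) p := by
  refine tsum_congr fun d => ?_
  simp only [monom, mul_pow]
  ring

lemma summable_and_tsum_le_of_le {c : BiExp → ℂ} (hc : AbsSummable c) {q : ℝ} {w : BiExp → ℝ}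
    (hw0 : ∀ d, 0 ≤ w d) (hw : ∀ d, w d ≤ ‖c d‖ * q) :
    Summable w ∧ ∑' d, w d ≤ (∑' d, ‖c d‖) * q := by
  have hs : Summable fun d => ‖c d‖ * q := Summable.mul_right q hc
  have h := Summable.of_nonneg_of_le hw0 hw hs
  refine ⟨h, ?_⟩
  rw [← tsum_mul_right]
  exact h.tsum_le_tsum hw hs

lemma divisorBound_of_le {μ : ℂ} {r : ℝ} {κ : ℕ} (hr : 0 < r) (h : 2 / r + ‖μ‖ ≤ κ) :
    DivisorBound μ r κ := by
  intro j n _ hj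
  have h1 : (κ : ℝ) * n ≤ j := by exact_mod_cast hj.le
  have h2 : (j : ℝ) - n * ‖μ‖ ≤ ‖(n : ℂ) * μ + j‖ := by
    have := norm_sub_le ((n : ℂ) * μ + j) (n * μ)
    rw [add_sub_cancel_left, norm_mul, Complex.norm_natCast, Complex.norm_natCast] at this
    linarith
  have h3 : 2 / r * n ≤ ‖(n : ℂ) * μ + j‖ := by
    have := mul_le_mul_of_nonneg_right h (Nat.cast_nonneg n (α := ℝ))
    linarith
  calc 2 * (n : ℝ) = r * (2 / r * n) := by field_simp
    _ ≤ _ := by gcongr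

lemma exists_norm_add_ge {μ : ℂ} (hμ : ∀ r : ℝ, (r : ℂ) = μ → 0 < r) :
    ∃ δ : ℝ, 0 < δ ∧ ∀ s : ℝ, 0 ≤ s → δ ≤ ‖μ + s‖ := by
  by_cases him : μ.im = 0
  · have h1 : ((μ.re : ℝ) : ℂ) = μ := Complex.ext (by simp) (by simp [him])
    refine ⟨μ.re, hμ _ h1, fun s hs => ?_⟩
    have h2 := Complex.re_le_norm (μ + s)
    simp only [Complex.add_re, Complex.ofReal_re] at h2
    linarith
  · refine ⟨|μ.im|, abs_pos.mpr him, fun s _ => ?_⟩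
    simpa using Complex.abs_im_le_norm (μ + s)

lemma exists_divisorBound_zero {μ : ℂ} (hμ : ∀ r : ℝ, (r : ℂ) = μ → 0 < r) :
    ∃ R : ℝ, 0 < R ∧ DivisorBound μ R 0 := by
  obtain ⟨δ, hδ, h⟩ := exists_norm_add_ge hμ
  refine ⟨2 / δ, by positivity, fun j n hn _ => ?_⟩
  have hn' : (n : ℂ) ≠ 0 := by exact_mod_cast (by omega : n ≠ 0)
  have h1 : (n : ℂ) * μ + j = n * (μ + ((j / n : ℝ) : ℂ)) := by
    push_cast
    field_simp
  rw [h1, norm_mul, Complex.norm_natCast]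
  calc 2 * (n : ℝ) = 2 / δ * (n * δ) := by field_simp
    _ ≤ _ := by gcongr; exact h _ (by positivity)

lemma exists_conjugate_wiener {a : ℂ × ℂ → ℂ} (ha : AnalyticAt ℂ a 0) :
    ∃ r : ℝ, 0 < r ∧ ∃ A : BiExp → ℂ, A 0 = 0 ∧ (Summable fun d => ‖A d‖ * 4 ^ d 1) ∧
      (∑' d, ‖A d‖ * 4 ^ d 1 ≤ (128 * (1 + r))⁻¹) ∧
      GermConjugate (saddleField r fun p => a 0 + evalSeries A p) (saddleField 1 a) := by
  classical
  obtain ⟨R, hR, f, hf⟩ := ha.exists_wiener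
  have hf0 : a 0 = Wiener.coeff 0 f := by
    simpa [evalSeries_zero] using hf.self_of_nhds
  set s : ℝ := (1024 * (1 + ‖f‖) * (1 + R))⁻¹ with hs
  have hfn := norm_nonneg f
  have hs0 : 0 < s := by positivity
  have hsr : s * R ≤ 1 := by
    rw [hs, inv_mul_le_iff₀ (by positivity)]
    nlinarith
  have hs4 : 4 * s ≤ 1 := by
    rw [hs, ← div_eq_mul_inv, div_le_iff₀ (by positivity)]
    nlinarith
  have hsf : ‖f‖ * (4 * s) ≤ 1 / 256 := by
    rw [hs, ← mul_assoc, ← div_eq_mul_inv, div_le_iff₀ (by positivity)]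
    nlinarith
  set A : BiExp → ℂ := fun d => if d = 0 then 0 else Wiener.coeff d f * (s ^ d 0 * s ^ d 1)
    with hA
  have hAle (d : BiExp) : ‖A d‖ * 4 ^ d 1 ≤ ‖Wiener.coeff d f‖ * (4 * s) := by
    by_cases hd : d = 0
    · simp only [hA, if_pos hd, norm_zero, zero_mul]
      positivity
    · have hd' : d 0 + d 1 ≠ 0 := fun h0 => hd (by
        ext i
        fin_cases i
        · exact (by omega : d 0 = 0)
        · exact (by omega : d 1 = 0))
      simp only [hA, if_neg hd, norm_mul, norm_pow, Complex.norm_real, Real.norm_of_nonneg hs0.le]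
      rw [mul_assoc]
      refine mul_le_mul_of_nonneg_left ?_ (norm_nonneg _)
      calc s ^ d 0 * s ^ d 1 * 4 ^ d 1 = s ^ d 0 * (4 * s) ^ d 1 := by rw [mul_pow]; ring
        _ ≤ (4 * s) ^ d 0 * (4 * s) ^ d 1 := by gcongr; linarith
        _ = (4 * s) ^ (d 0 + d 1) := by rw [pow_add]
        _ ≤ 4 * s := pow_le_of_le_one (by positivity) hs4 hd'
  obtain ⟨hAs, hAsum⟩ := summable_and_tsum_le_of_le f.summable_norm_coeff
    (fun d => by positivity) hAle
  have hsR : 0 < s * R := by positivity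
  refine ⟨s * R, hsR, A, by simp [hA], hAs, ?_, ?_⟩
  · rw [← Wiener.norm_eq_tsum f] at hAsum
    refine (hAsum.trans hsf).trans ?_
    rw [one_div]
    gcongr
    linarith
  · have hsR' : ((s * R : ℝ) : ℂ) ≠ 0 := by exact_mod_cast hsR.ne'
    have h1 := saddleField_scale 1 a hsR' hsR'
    rw [one_mul] at h1
    refine GermConjugate.trans (GermConjugate.of_eventuallyEq ?_) h1
    have ht : Tendsto (fun p : ℂ × ℂ => ((s : ℂ) * p.1, (s : ℂ) * p.2)) (nhds 0) (nhds 0) := by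
      have : Continuous fun p : ℂ × ℂ => ((s : ℂ) * p.1, (s : ℂ) * p.2) := by fun_prop
      simpa [Prod.mk_zero_zero] using this.tendsto 0
    filter_upwards [ht.eventually hf, Metric.closedBall_mem_nhds (0 : ℂ × ℂ) one_pos] with p hp hp1
    have hsum : Summable fun d => Wiener.coeff d f * (s ^ d 0 * s ^ d 1) * monom d p := by
      refine Summable.of_norm_bounded f.summable_norm_coeff fun d => ?_
      refine (norm_mul_monom_le _ d (mem_closedBall_zero_iff.mp hp1)).trans ?_
      rw [norm_mul, norm_mul, norm_pow, norm_pow, Complex.norm_real, Real.norm_of_nonneg hs0.le]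
      refine mul_le_of_le_one_right (norm_nonneg _) (mul_le_one₀ ?_ (by positivity) ?_) <;>
        exact pow_le_one₀ hs0.le (by linarith)
    have h2 : a 0 + evalSeries A p = a ((s * R : ℝ) * p.1, (s * R : ℝ) * p.2) := by
      have h3 : (((s * R : ℝ) : ℂ) * p.1, ((s * R : ℝ) : ℂ) * p.2) =
          (R : ℂ) • ((s : ℂ) * p.1, (s : ℂ) * p.2) := by
        push_cast
        ext <;> simp <;> ring
      rw [h3, hp, evalSeries_scale, evalSeries, evalSeries, hsum.tsum_eq_add_tsum_ite 0]
      simp only [hA, ite_mul, zero_mul]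
      simp [hf0]
    simp only [saddleField, h2]

lemma exists_conjugate_sector_zero {μ : ℂ} {r R : ℝ} {κ : ℕ} (hr : 0 < r) (hR : 0 < R)
    (h : DivisorBound μ R 0) {α : BiExp → ℂ} (hα : AbsSummable α) (hα0 : α 0 = 0)
    (hαs : ∀ d, κ * d 1 < d 0 → α d = 0) :
    ∃ β : BiExp → ℂ, AbsSummable β ∧ β 0 = 0 ∧ (∀ d, 0 < d 0 → β d = 0) ∧
      GermConjugate (saddleField 1 fun p => μ + evalSeries β p)
        (saddleField r fun p => μ + evalSeries α p) := by
  have hα1 : 0 ≤ ∑' d, ‖α d‖ := tsum_nonneg fun _ => norm_nonneg _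
  set K := max 1 (R / r) with hK
  have hK1 : 1 ≤ K := le_max_left _ _
  have hRr : R / r ≤ K := le_max_right _ _
  set B := 128 * (1 + R) * (1 + ∑' d, ‖α d‖) with hB
  have hB1 : 1 ≤ B := by nlinarith
  set t : ℝ := (4 * K ^ κ * B)⁻¹ with ht
  have ht0 : 0 < t := by positivity
  have htB : K ^ κ * (4 * t) = B⁻¹ := by rw [ht]; field_simp
  set A : BiExp → ℂ := fun d => α d * (((R / r : ℝ) : ℂ) ^ d 0 * (t : ℂ) ^ d 1) with hA
  have hAle (d : BiExp) : ‖A d‖ * 4 ^ d 1 ≤ ‖α d‖ * B⁻¹ := by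
    simp only [hA, norm_mul, norm_pow, Complex.norm_real, Real.norm_of_nonneg ht0.le,
      Real.norm_of_nonneg (div_pos hR hr).le]
    rw [mul_assoc]
    by_cases hd : κ * d 1 < d 0
    · simp [hαs d hd]
    by_cases hd1 : d 1 = 0
    · have : d = 0 := by
        ext i
        fin_cases i
        · change d 0 = 0
          simpa [hd1] using hd
        · exact hd1
      simp [this, hα0]
    refine mul_le_mul_of_nonneg_left ?_ (norm_nonneg _)
    calc (R / r) ^ d 0 * t ^ d 1 * 4 ^ d 1 ≤ K ^ (κ * d 1) * t ^ d 1 * 4 ^ d 1 := by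
          gcongr ?_ * _ * _
          exact (pow_le_pow_left₀ (by positivity) hRr _).trans
            (pow_le_pow_right₀ hK1 (not_lt.mp hd))
      _ = (K ^ κ * (4 * t)) ^ d 1 := by rw [mul_pow, mul_pow, pow_mul]; ring
      _ ≤ B⁻¹ := by
          rw [htB]
          exact pow_le_of_le_one (by positivity) (inv_le_one_of_one_le₀ hB1) hd1
  obtain ⟨hAs, hAsum⟩ := summable_and_tsum_le_of_le hα (fun d => by positivity) hAle
  have hAε : ∑' d, ‖A d‖ * 4 ^ d 1 ≤ (128 * (1 + R))⁻¹ := by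
    refine hAsum.trans ?_
    rw [hB, mul_inv, mul_left_comm]
    refine mul_le_of_le_one_right (by positivity) ?_
    rw [← div_eq_mul_inv, div_le_one (by positivity)]
    linarith
  obtain ⟨β, hβ, hβ0, hβs, h1⟩ := exists_conjugate_sector hR h (by simp [hA, hα0]) hAs hAε
  have hr' : (r : ℂ) ≠ 0 := by exact_mod_cast hr.ne'
  have hR' : (R : ℂ) ≠ 0 := by exact_mod_cast hR.ne'
  have ht' : (t : ℂ) ≠ 0 := by exact_mod_cast ht0.ne'
  have h2 := saddleField_scale r (fun p => μ + evalSeries α p)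
    (by exact_mod_cast (div_pos hR hr).ne' : ((R / r : ℝ) : ℂ) ≠ 0) ht'
  have h3 := saddleField_scale R (fun p => μ + evalSeries β p) (inv_ne_zero hR') one_ne_zero
  have hRR : (r : ℂ) * ((R / r : ℝ) : ℂ) = R := by
    push_cast
    field_simp
  have hβs' (d : BiExp) (hd : 0 < d 0) : β d = 0 := hβs d (by simpa using hd)
  have hβe (p : ℂ × ℂ) : evalSeries β ((R : ℂ)⁻¹ * p.1, 1 * p.2) = evalSeries β p := by
    rw [evalSeries_scale]
    refine tsum_congr fun d => ?_
    rcases Nat.eq_zero_or_pos (d 0) with hd | hd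
    · simp [hd]
    · simp [hβs' d hd]
  simp only [evalSeries_scale α, hRR] at h2
  simp only [hβe, mul_inv_cancel₀ hR'] at h3
  exact ⟨β, hβ, hβ0, hβs', (h3.trans h1).trans h2⟩

end NormalForm

/-- **Theorem (normal form for saddle-nodes with a central manifold, `k = 1`,
`μ ∉ ℝ≤0`).** Given `X = x²∂x + (y + x·y·a(x,y))∂y` with `μ := a(0,0)` not a
nonpositive real number (encoded: every real `r` with `(r : ℂ) = μ` satisfies
`0 < r`), the foliation of `X` is analytically equivalent to one of the form
`X_h = x²∂x + (y + x·y·h(y))∂y` with `h` holomorphic in one variable, `h 0 = μ`. -/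
theorem saddleNode_centralManifold_normal_form
    (a : ℂ × ℂ → ℂ) (ha : AnalyticAt ℂ a 0) (μ : ℂ) (hμ : μ = a 0)
    (hμpos : ∀ r : ℝ, (r : ℂ) = μ → 0 < r) :
    ∃ h : ℂ → ℂ, AnalyticAt ℂ h 0 ∧ h 0 = μ ∧
      FoliationEquiv (fun p => (p.1 ^ 2, p.2 + p.1 * p.2 * a p))
        (fun p => (p.1 ^ 2, p.2 + p.1 * p.2 * h p.2)) := by
  obtain ⟨r, hr, A, hA0, hA, hAε, h1⟩ := exists_conjugate_wiener ha
  rw [← hμ] at h1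
  obtain ⟨κ, hκ⟩ := exists_nat_ge (2 / r + ‖μ‖)
  obtain ⟨α, hα, hα0, hαs, h2⟩ :=
    exists_conjugate_sector hr (divisorBound_of_le hr hκ) hA0 hA hAε
  obtain ⟨R, hR, hb⟩ := exists_divisorBound_zero hμpos
  obtain ⟨β, hβ, hβ0, hβs, h3⟩ := exists_conjugate_sector_zero hr hR hb hα hα0 hαs
  have hβ2 (p : ℂ × ℂ) : evalSeries β p = evalSeries β (0, p.2) := by
    refine tsum_congr fun d => ?_
    rcases Nat.eq_zero_or_pos (d 0) with h | h
    · simp [monom, h]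
    · simp [hβs d h]
  refine ⟨fun y => μ + evalSeries β (0, y), ?_, ?_, ?_⟩
  · refine analyticAt_const.add ?_
    exact AnalyticAt.fun_comp (g := evalSeries β) hβ.analyticAt_evalSeries
      (analyticAt_const.prod analyticAt_id)
  · simp [evalSeries_zero, hβ0, Prod.mk_zero_zero]
  · have h4 := ((h3.trans h2).trans h1).symm.foliationEquiv
    convert h4 using 1 <;> funext p
    · simp [saddleField]
    · simp [saddleField, hβ2 p]
end
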